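/- Let α > 1, σ > 0, T > 0. Let b : [0,∞) → ℝ with b(0) ≥ 0 be four times continuously differentiable on (0,∞), 2(α−1)-locally Lipschitz, and such that for each i = 1,…,4 the i-th derivative b^{(i)} is (γ̄_i, γ_i)-locally Lipschitz. Assume b(z) ≤ B₁z − B₂z^{2α−1} + b(0) and b′(z) ≤ B₁′ − B₂′z^{2(α−1)} for all z > 0, where B₁, B₂, B₁′, B₂′ ≥ 0 satisfy, with β̄̄ = max(3(γ̄_2+1), γ̄_2+γ̄_3+2, γ̄_4+1): B₂ ≥ 3σ²α + (σ²/2)(max(2β̄̄, β̄̄+2α) − 1), B₂′ ≥ σ²α(17α/2 − 3), and, in case b(0) > 0, additionally α > 3/2 and B₂ ≥ 3σ²α + max(α²/2, (σ²/2)(max(2β̄̄, β̄̄+2α) − 1)). Let f : (0,∞) → ℝ be four times continuously differentiable, bounded, with bounded derivatives up to order 4. Then there exist a function u : [0,T]×(0,∞) → ℝ, once continuously differentiable in t and four times continuously differentiable in x, and a constant C ≥ 0, such that: ∂_t u(t,x) + b(x)∂_x u(t,x) + (σ²/2)x^{2α}∂²_{xx}u(t,x) = 0 for all (t,x) ∈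 [0,T)×(0,∞), u(T,x) = f(x) for all x > 0, and for all (t,x) ∈ [0,T]×(0,∞): |u(t,x)| ≤ C, |∂_x u(t,x)| ≤ C, |∂_t u(t,x)| ≤ C(1+x^{2α}), |∂²_{xx}u(t,x)| ≤ C(1+x^{γ̄_2+1}+x^{−γ_2}), |∂³_{xxx}u(t,x)| ≤ C(1+x^{β̄}+x^{−β}), and |∂⁴_{xxxx}u(t,x)| ≤ C(1+x^{β̄̄}+x^{−β̲̲}), where β̄ = max(2(γ̄_2+1), 1+γ̄_3), β = max(2γ_2, γ_3, γ_2+3−2α), and β̲̲ = max( max(γ_2, 3−2α)+β, γ_2+max(γ_3, 4−2α), γ_4 ). -/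

import Mathlib

open Real MeasureTheory Set

namespace KPde

/-- polynomial weight -/
noncomputable def Wt (p q x : ℝ) : ℝ := 1 + x ^ p + x ^ (-q)

lemma one_le_Wt {p q x : ℝ} (hx : 0 < x) : 1 ≤ Wt p q x := by
  have h1 := rpow_pos_of_pos hx p
  have h2 := rpow_pos_of_pos hx (-q)
  unfold Wt; linarith

lemma Wt_pos {p q x : ℝ} (hx : 0 < x) : 0 < Wt p q x := lt_of_lt_of_le one_pos (one_le_Wt hx)

lemma rpow_le_Wt {p q r x : ℝ} (hx : 0 < x) (h1 : -q ≤ r) (h2 : r ≤ p) : x ^ r ≤ Wt p q x := by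
  have hp := rpow_pos_of_pos hx p
  have hq := rpow_pos_of_pos hx (-q)
  unfold Wt
  rcases le_total 1 x with h | h
  · have := rpow_le_rpow_of_exponent_le h h2
    linarith
  · have := rpow_le_rpow_of_exponent_ge hx h h1
    linarith

lemma Wt_mono {p q p' q' x : ℝ} (hx : 0 < x) (hp : 0 ≤ p) (hq : 0 ≤ q) (h1 : p ≤ p')
    (h2 : q ≤ q') : Wt p q x ≤ 3 * Wt p' q' x := by
  have e1 : x ^ p ≤ Wt p' q' x := rpow_le_Wt hx (by linarith) h1
  have e2 : x ^ (-q) ≤ Wt p' q' x := rpow_le_Wt hx (by linarith) (by linarith)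
  have e3 : 1 ≤ Wt p' q' x := one_le_Wt hx
  have : Wt p q x = 1 + x ^ p + x ^ (-q) := rfl
  linarith

lemma Wt_mul {p q p' q' P Q x : ℝ} (hx : 0 < x) (hp : 0 ≤ p) (hq : 0 ≤ q) (hp' : 0 ≤ p')
    (hq' : 0 ≤ q') (h1 : p + p' ≤ P) (h2 : q + q' ≤ Q) :
    Wt p q x * Wt p' q' x ≤ 9 * Wt P Q x := by
  have key : ∀ r, -Q ≤ r → r ≤ P → x ^ r ≤ Wt P Q x := fun r h h' => rpow_le_Wt hx h h'
  have e : Wt p q x * Wt p' q' x = 1 + x ^ p' + x ^ (-q') + x ^ p + x ^ (p + p') + x ^ (p + -q')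
      + x ^ (-q) + x ^ (-q + p') + x ^ (-q + -q') := by
    unfold Wt
    rw [rpow_add hx, rpow_add hx, rpow_add hx, rpow_add hx]; ring
  rw [e]
  have := one_le_Wt (p := P) (q := Q) hx
  have := key p' (by linarith) (by linarith)
  have := key (-q') (by linarith) (by linarith)
  have := key p (by linarith) (by linarith)
  have := key (p + p') (by linarith) (by linarith)
  have := key (p + -q') (by linarith) (by linarith)
  have := key (-q) (by linarith) (by linarith)
  have := key (-q + p') (by linarith) (by linarith)
  have := key (-q + -q') (by linarith) (by linarith)
  linarith

lemma absorb {P Q r s ε : ℝ} (hP : 0 ≤ P) (hQ : 0 ≤ Q) (h1 : -Q ≤ r) (h2 : r < P + s)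
    (hε : 0 < ε) :
    ∃ C, 0 ≤ C ∧ ∀ x : ℝ, 0 < x → x ^ r ≤ ε * (x ^ s * Wt P Q x) + C * Wt P Q x := by
  obtain ⟨X0, hX1, hX0⟩ : ∃ X0 : ℝ, 1 ≤ X0 ∧ ∀ x, X0 ≤ x → x ^ (r - P - s) ≤ ε := by
    have ht : Filter.Tendsto (fun x : ℝ => x ^ (-(P + s - r))) Filter.atTop (nhds 0) :=
      tendsto_rpow_neg_atTop (by linarith)
    have h3 := (ht.eventually (Iio_mem_nhds hε))
    obtain ⟨Y, hY⟩ := Filter.eventually_atTop.1 h3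
    refine ⟨max Y 1, le_max_right _ _, fun x hx => ?_⟩
    have := hY x (le_trans (le_max_left _ _) hx)
    have e : r - P - s = -(P + s - r) := by ring
    rw [e]; exact le_of_lt this
  have hX0p : 0 < X0 := by linarith
  refine ⟨X0 ^ |r| , by positivity, fun x hx => ?_⟩
  have hW := one_le_Wt (p := P) (q := Q) hx
  have hxs := rpow_pos_of_pos hx s
  have hC1 : 1 ≤ X0 ^ |r| := one_le_rpow hX1 (abs_nonneg r)
  rcases le_total X0 x with h | h
  · have h4 := hX0 x h
    have e : x ^ r = x ^ (r - P - s) * (x ^ s * x ^ P) := by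
      rw [← rpow_add hx, ← rpow_add hx]; congr 1; ring
    have h5 : x ^ P ≤ Wt P Q x := rpow_le_Wt hx (by linarith) le_rfl
    have h6 : x ^ r ≤ ε * (x ^ s * Wt P Q x) := by
      rw [e]; gcongr
    have : 0 ≤ X0 ^ |r| * Wt P Q x := by positivity
    linarith
  · have h0 : 0 ≤ ε * (x ^ s * Wt P Q x) := by positivity
    rcases le_total 1 x with h' | h'
    · have h5 : x ^ r ≤ X0 ^ |r| :=
        le_trans (rpow_le_rpow_of_exponent_le h' (le_abs_self r))
          (rpow_le_rpow hx.le h (abs_nonneg r))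
      have : X0 ^ |r| * 1 ≤ X0 ^ |r| * Wt P Q x := by gcongr
      linarith
    · have h5 : x ^ r ≤ x ^ (-Q) := rpow_le_rpow_of_exponent_ge hx h' h1
      have h6 : x ^ (-Q) ≤ Wt P Q x := rpow_le_Wt hx le_rfl (by linarith)
      have h7 : 1 * Wt P Q x ≤ X0 ^ |r| * Wt P Q x := by gcongr
      linarith

end KPde


namespace KPde

/-- standing data -/
structure Par where
  (α σ B1 B2 B1' B2' K b00 β g2 g3 g4 c2 c3 c4 : ℝ)
  b : ℕ → ℝ → ℝ
  hα : 1 < α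
  hσ : 0 < σ
  hB1 : 0 ≤ B1
  hB2 : 0 ≤ B2
  hB1' : 0 ≤ B1'
  hB2' : 0 ≤ B2'
  hK : 1 ≤ K
  hb00 : 0 ≤ b00
  hβ : 3 ≤ β
  hg2 : 0 ≤ g2
  hg3 : 0 ≤ g3
  hg4 : 0 ≤ g4
  hc2 : 0 ≤ c2
  hc3 : 0 ≤ c3
  hc4 : 0 ≤ c4
  hchain : ∀ k < 4, ∀ x : ℝ, 0 < x → HasDerivAt (b k) (b (k + 1) x) x
  hcont : ContinuousOn (b 4) (Ioi 0)
  hlow : ∀ x : ℝ, 0 < x → -(K * (x + x ^ (2 * α - 1))) ≤ b 0 x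
  habs : ∀ x : ℝ, 0 < x → |b 0 x| ≤ K * (1 + x ^ (2 * α - 1))
  hb1abs : ∀ x : ℝ, 0 < x → |b 1 x| ≤ K * (1 + x ^ (2 * α - 2))
  hb2abs : ∀ x : ℝ, 0 < x → |b 2 x| ≤ K * Wt g2 c2 x
  hb3abs : ∀ x : ℝ, 0 < x → |b 3 x| ≤ K * Wt g3 c3 x
  hb4abs : ∀ x : ℝ, 0 < x → |b 4 x| ≤ K * Wt g4 c4 x
  hup : ∀ x : ℝ, 0 < x → b 0 x ≤ B1 * x - B2 * x ^ (2 * α - 1) + b00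
  hb1up : ∀ x : ℝ, 0 < x → b 1 x ≤ B1' - B2' * x ^ (2 * α - 2)
  hB2a : 3 * σ ^ 2 * α + σ ^ 2 / 2 * (2 * β - 1) ≤ B2
  hB2b : 3 * σ ^ 2 * α + σ ^ 2 / 2 * (β + 2 * α - 1) ≤ B2
  hB2c : σ ^ 2 * α * (17 * α / 2 - 3) ≤ B2'

namespace Par
variable (D : Par)

/-- derivatives of the diffusion coefficient -/
noncomputable def a (k : ℕ) (x : ℝ) : ℝ :=
  D.σ ^ 2 / 2 * (∏ i ∈ Finset.range k, (2 * D.α - i)) * x ^ (2 * D.α - k)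

lemma a_zero (x : ℝ) : D.a 0 x = D.σ ^ 2 / 2 * x ^ (2 * D.α) := by simp [a]

lemma a_one (x : ℝ) : D.a 1 x = D.σ ^ 2 * D.α * x ^ (2 * D.α - 1) := by
  simp [a]; left; ring

lemma a_two (x : ℝ) : D.a 2 x = D.σ ^ 2 * D.α * (2 * D.α - 1) * x ^ (2 * D.α - 2) := by
  simp [a, Finset.prod_range_succ]; left; ring

lemma a_pos {x : ℝ} (hx : 0 < x) : 0 < D.a 0 x := by
  rw [a_zero]; have := D.hσ; positivity

lemma a_hasDerivAt (k : ℕ) {x : ℝ} (hx : 0 < x) : HasDerivAt (D.a k) (D.a (k + 1) x) x := by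
  have h := ((hasDerivAt_id x).rpow_const (p := 2 * D.α - k) (Or.inl hx.ne')).const_mul
    (D.σ ^ 2 / 2 * (∏ i ∈ Finset.range k, (2 * D.α - i)))
  have e : D.a (k + 1) x = D.σ ^ 2 / 2 * (∏ i ∈ Finset.range k, (2 * D.α - i)) *
      (1 * (2 * D.α - k) * id x ^ (2 * D.α - k - 1)) := by
    simp only [a, Finset.prod_range_succ, id]
    have : 2 * D.α - ((k + 1 : ℕ) : ℝ) = 2 * D.α - k - 1 := by push_cast; ring
    rw [this]; ring
  rw [e]; exact h

/-- source coefficients -/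
noncomputable def src (k : ℕ) (F : ℕ → ℝ → ℝ) (x : ℝ) : ℝ :=
  match k with
  | 2 => |D.b 2 x| * F 1 x
  | 3 => |3 * D.b 2 x + D.a 3 x| * F 2 x + |D.b 3 x| * F 1 x
  | 4 => |6 * D.b 2 x + 4 * D.a 3 x| * F 3 x + |4 * D.b 3 x + D.a 4 x| * F 2 x + |D.b 4 x| * F 1 x
  | _ => 0

/-- left side of the Lyapunov inequality -/
noncomputable def lyap (k : ℕ) (F F1 F2 : ℕ → ℝ → ℝ) (x : ℝ) : ℝ :=
  D.a 0 x * F2 k x + (D.b 0 x + k * D.a 1 x) * F1 k x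
    + (k * D.b 1 x + (k.choose 2 : ℕ) * D.a 2 x) * F k x + D.src k F x

end Par

/-- first derivative of the weight -/
noncomputable def Wt1 (p q x : ℝ) : ℝ := p * x ^ (p - 1) - q * x ^ (-q - 1)
/-- second derivative of the weight -/
noncomputable def Wt2 (p q x : ℝ) : ℝ := p * (p - 1) * x ^ (p - 2) + q * (q + 1) * x ^ (-q - 2)

lemma Wt_hasDerivAt (p q : ℝ) {x : ℝ} (hx : 0 < x) : HasDerivAt (Wt p q) (Wt1 p q x) x := by
  have h1 := (hasDerivAt_id x).rpow_const (p := p) (Or.inl hx.ne')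
  have h2 := (hasDerivAt_id x).rpow_const (p := -q) (Or.inl hx.ne')
  have h := ((hasDerivAt_const x (1 : ℝ)).add h1).add h2
  refine (h.congr_deriv ?_)
  simp only [Wt1, id]; ring

lemma Wt1_hasDerivAt (p q : ℝ) {x : ℝ} (hx : 0 < x) : HasDerivAt (Wt1 p q) (Wt2 p q x) x := by
  have h1 := ((hasDerivAt_id x).rpow_const (p := p - 1) (Or.inl hx.ne')).const_mul p
  have h2 := ((hasDerivAt_id x).rpow_const (p := -q - 1) (Or.inl hx.ne')).const_mul q
  have h := h1.sub h2
  refine (h.congr_deriv ?_)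
  simp only [Wt2, id]
  have e1 : p - 1 - 1 = p - 2 := by ring
  have e2 : -q - 1 - 1 = -q - 2 := by ring
  rw [e1, e2]; ring

/-- admissible exponents -/
structure Adm (D : Par) (P Q : ℕ → ℝ) : Prop where
  hP : ∀ k, 0 ≤ P k
  hQ : ∀ k, 0 ≤ Q k
  hPu : ∀ k, P k ≤ D.β + 1 / (D.β + 1)
  hPQ : ∀ k, P k = 0 ∨ 1 ≤ P k ∨ 1 ≤ Q k
  hQ0 : Q 0 = 0 ∨ 2 * D.α - 2 ≤ Q 0
  p21 : P 1 + D.g2 ≤ P 2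
  p32 : P 2 + D.g2 ≤ P 3
  p31 : P 1 + D.g3 ≤ P 3
  p43 : P 3 + D.g2 ≤ P 4
  p42 : P 2 + D.g3 ≤ P 4
  p41 : P 1 + D.g4 ≤ P 4
  q21 : Q 1 + D.c2 ≤ Q 2
  q32 : Q 2 + D.c2 ≤ Q 3
  q32' : Q 2 + (3 - 2 * D.α) ≤ Q 3
  q31 : Q 1 + D.c3 ≤ Q 3
  q43 : Q 3 + D.c2 ≤ Q 4
  q43' : Q 3 + (3 - 2 * D.α) ≤ Q 4
  q42 : Q 2 + D.c3 ≤ Q 4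
  q42' : Q 2 + (4 - 2 * D.α) ≤ Q 4
  q41 : Q 1 + D.c4 ≤ Q 4

section
variable (D : Par)

lemma prin_le (k : ℕ) {p q : ℝ} (hp : 0 ≤ p) (hq : 0 ≤ q) (hpq : p = 0 ∨ 1 ≤ p ∨ 1 ≤ q)
    {x : ℝ} (hx : 0 < x) :
    D.a 0 x * Wt2 p q x + (D.b 0 x + k * D.a 1 x) * Wt1 p q x ≤
      p * (D.σ ^ 2 / 2 * (p - 1) + k * D.σ ^ 2 * D.α - D.B2) * (x ^ (2 * D.α - 2) * x ^ p)
      + (D.σ ^ 2 / 2 * (q * (q + 1)) + q * D.K) * (x ^ (2 * D.α - 2) * x ^ (-q))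
      + (p * D.B1 + p * D.b00 + q * D.K) * Wt p q x := by
  have hσ := D.hσ
  have hα := D.hα
  set θ := x ^ (2 * D.α - 2) with hθ
  have hθp : 0 < θ := rpow_pos_of_pos hx _
  have e0 : x ^ (2 * D.α) = θ * x ^ 2 := by
    rw [hθ, ← rpow_natCast, ← rpow_add hx]; congr 1; norm_num
  have e1 : x ^ (2 * D.α - 1) = θ * x := by
    rw [hθ]; nth_rewrite 3 [← rpow_one x]; rw [← rpow_add hx]; congr 1; ring
  have f1 : x ^ p = x ^ (p - 1) * x := by
    nth_rewrite 3 [← rpow_one x]; rw [← rpow_add hx]; congr 1; ring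
  have f2 : x ^ (p - 1) = x ^ (p - 2) * x := by
    nth_rewrite 3 [← rpow_one x]; rw [← rpow_add hx]; congr 1; ring
  have f3 : x ^ (-q) = x ^ (-q - 1) * x := by
    nth_rewrite 3 [← rpow_one x]; rw [← rpow_add hx]; congr 1; ring
  have f4 : x ^ (-q - 1) = x ^ (-q - 2) * x := by
    nth_rewrite 3 [← rpow_one x]; rw [← rpow_add hx]; congr 1; ring
  have hu := D.hup x hx
  have hl := D.hlow x hx
  rw [e1] at hu hl
  have g1 : 0 < x ^ (p - 1) := rpow_pos_of_pos hx _
  have g2 : 0 < x ^ (-q - 1) := rpow_pos_of_pos hx _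
  have u1 := mul_le_mul_of_nonneg_left hu (mul_nonneg hp g1.le)
  have u2 := mul_le_mul_of_nonneg_left hl (mul_nonneg hq g2.le)
  have w1 : p * x ^ (p - 1) ≤ p * Wt p q x := by
    rcases hpq with h | h | h
    · simp [h]
    · exact mul_le_mul_of_nonneg_left (rpow_le_Wt hx (by linarith) (by linarith)) hp
    · exact mul_le_mul_of_nonneg_left (rpow_le_Wt hx (by linarith) (by linarith)) hp
  have w1' := mul_le_mul_of_nonneg_left w1 D.hb00
  have w2 : x ^ p ≤ Wt p q x := rpow_le_Wt hx (by linarith) le_rfl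
  have w3 : x ^ (-q) ≤ Wt p q x := rpow_le_Wt hx le_rfl (by linarith)
  have w2' := mul_le_mul_of_nonneg_left w2 (mul_nonneg hp D.hB1)
  have w3' := mul_le_mul_of_nonneg_left w3 (mul_nonneg hq (le_trans zero_le_one D.hK))
  have n1 : 0 ≤ k * D.a 1 x * (q * x ^ (-q - 1)) := by
    rw [D.a_one]; positivity
  have main : D.a 0 x * Wt2 p q x + k * D.a 1 x * (p * x ^ (p - 1)) =
      p * (D.σ ^ 2 / 2 * (p - 1) + k * D.σ ^ 2 * D.α) * (θ * x ^ p)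
      + (D.σ ^ 2 / 2 * (q * (q + 1))) * (θ * x ^ (-q)) := by
    rw [D.a_zero, D.a_one, e0, e1, Wt2, f1, f2, f3, f4]; ring
  have m2 : (D.b 0 x + k * D.a 1 x) * Wt1 p q x = p * x ^ (p - 1) * D.b 0 x
      + k * D.a 1 x * (p * x ^ (p - 1)) - q * x ^ (-q - 1) * D.b 0 x
      - k * D.a 1 x * (q * x ^ (-q - 1)) := by
    rw [Wt1]; ring
  have u1' : p * x ^ (p - 1) * (D.B1 * x - D.B2 * (θ * x) + D.b00) =
      p * D.B1 * x ^ p - p * D.B2 * (θ * x ^ p) + D.b00 * (p * x ^ (p - 1)) := by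
    rw [f1]; ring
  have u2' : q * x ^ (-q - 1) * (-(D.K * (x + θ * x))) =
      -(q * D.K * x ^ (-q)) - q * D.K * (θ * x ^ (-q)) := by
    rw [f3]; ring
  rw [u1'] at u1
  rw [u2'] at u2
  rw [m2]
  have ex : p * (D.σ ^ 2 / 2 * (p - 1) + k * D.σ ^ 2 * D.α - D.B2) * (θ * x ^ p) =
    p * (D.σ ^ 2 / 2 * (p - 1) + k * D.σ ^ 2 * D.α) * (θ * x ^ p) - p * D.B2 * (θ * x ^ p) := by ring
  have ex2 : (D.σ ^ 2 / 2 * (q * (q + 1)) + q * D.K) * (θ * x ^ (-q)) =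
    (D.σ ^ 2 / 2 * (q * (q + 1))) * (θ * x ^ (-q)) + q * D.K * (θ * x ^ (-q)) := by ring
  rw [ex, ex2]
  linarith

/-- level 0 Lyapunov inequality -/
lemma lyap_zero {p q : ℝ} (hp : 0 ≤ p) (hq : 0 ≤ q) (hpq : p = 0 ∨ 1 ≤ p ∨ 1 ≤ q)
    (hp2 : p * (D.σ ^ 2 / 2 * (p - 1) - D.B2) ≤ 0) (hq2 : q = 0 ∨ 2 * D.α - 2 ≤ q) :
    ∃ ω, 0 ≤ ω ∧ ∀ x : ℝ, 0 < x →
      D.a 0 x * Wt2 p q x + D.b 0 x * Wt1 p q x ≤ ω * Wt p q x := by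
  have hK := le_trans zero_le_one D.hK
  have h1 := D.hB1
  have h2 := D.hb00
  refine ⟨(D.σ ^ 2 / 2 * (q * (q + 1)) + q * D.K) + (p * D.B1 + p * D.b00 + q * D.K),
    by positivity, fun x hx => ?_⟩
  have h := prin_le D 0 hp hq hpq hx
  simp only [Nat.cast_zero, zero_mul, add_zero] at h
  have t1 : p * (D.σ ^ 2 / 2 * (p - 1) - D.B2) * (x ^ (2 * D.α - 2) * x ^ p) ≤ 0 :=
    mul_nonpos_of_nonpos_of_nonneg hp2 (by positivity)
  have t2 : (D.σ ^ 2 / 2 * (q * (q + 1)) + q * D.K) * (x ^ (2 * D.α - 2) * x ^ (-q)) ≤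
      (D.σ ^ 2 / 2 * (q * (q + 1)) + q * D.K) * Wt p q x := by
    rcases hq2 with h | h
    · simp [h]
    · rw [← rpow_add hx]
      apply mul_le_mul_of_nonneg_left _ (by positivity)
      exact rpow_le_Wt hx (by linarith [D.hα]) (by linarith)
  rw [add_mul]
  linarith

lemma mk_le {p : ℝ} (k : ℕ) (hk : k ≤ 4) (hp : 0 ≤ p) (hpu : p ≤ D.β + 1 / (D.β + 1)) :
    p * (D.σ ^ 2 / 2 * (p - 1) + k * D.σ ^ 2 * D.α - D.B2) ≤ D.σ ^ 2 / 2 := by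
  have hβ := D.hβ
  have hσ := D.hσ
  have hα := D.hα
  have h1 : 1 / (D.β + 1) ≤ 1 := by rw [div_le_one (by linarith)]; linarith
  have hs : 0 < D.σ ^ 2 := by positivity
  rcases Nat.lt_or_ge k 4 with h | h
  · have hk3 : (k : ℝ) ≤ 3 := by exact_mod_cast Nat.lt_succ_iff.1 h
    have : D.σ ^ 2 / 2 * (p - 1) + k * D.σ ^ 2 * D.α - D.B2 ≤ 0 := by
      have := D.hB2a
      have e : (k : ℝ) * D.σ ^ 2 * D.α ≤ 3 * D.σ ^ 2 * D.α := by gcongr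
      have e2 : D.σ ^ 2 / 2 * (p - 1) ≤ D.σ ^ 2 / 2 * (2 * D.β - 1) := by
        gcongr; linarith
      linarith
    have := mul_nonpos_of_nonneg_of_nonpos hp this
    linarith
  · have hk4 : k = 4 := le_antisymm hk h
    subst hk4
    have h3 : D.σ ^ 2 / 2 * (p - 1) + (4 : ℕ) * D.σ ^ 2 * D.α - D.B2 ≤ D.σ ^ 2 / 2 * (p - D.β) := by
      have := D.hB2b
      push_cast
      nlinarith
    have h4 := mul_le_mul_of_nonneg_left h3 hp
    have h5 : p * (p - D.β) ≤ 1 := by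
      rcases le_total p D.β with h | h
      · have := mul_nonpos_of_nonneg_of_nonpos hp (sub_nonpos.2 h); linarith
      · have h6 : p - D.β ≤ 1 / (D.β + 1) := by linarith
        have h7 : p ≤ D.β + 1 := by linarith
        calc p * (p - D.β) ≤ (D.β + 1) * (1 / (D.β + 1)) := by
              apply mul_le_mul h7 h6 (by linarith) (by linarith)
          _ = 1 := by field_simp
    nlinarith

lemma pot_le (k : ℕ) (hk1 : 1 ≤ k) (hk : k ≤ 4) {x : ℝ} (hx : 0 < x) :
    k * D.b 1 x + (k.choose 2 : ℕ) * D.a 2 x ≤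
      4 * D.B1' - 4 * D.σ ^ 2 * x ^ (2 * D.α - 2) := by
  have hθ : 0 < x ^ (2 * D.α - 2) := rpow_pos_of_pos hx _
  have h1 := D.hb1up x hx
  have h2 := D.hB2c
  have h3 := D.hB1'
  have hα := D.hα
  have hs : 0 < D.σ ^ 2 := by have := D.hσ; positivity
  have hs1 : D.σ ^ 2 ≤ D.σ ^ 2 * D.α := by nlinarith
  have hs2 : D.σ ^ 2 * D.α ≤ D.σ ^ 2 * D.α * D.α := by nlinarith
  rw [D.a_two]
  set θ := x ^ (2 * D.α - 2)
  have h1' := mul_le_mul_of_nonneg_right h2 hθ.le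
  have hs1' := mul_le_mul_of_nonneg_right hs1 hθ.le
  have hs2' := mul_le_mul_of_nonneg_right hs2 hθ.le
  have hs0 : 0 < D.σ ^ 2 * θ := by positivity
  interval_cases k <;> simp [Nat.choose] <;> nlinarith

lemma absorb_mul (A : ℝ) (hA : 0 ≤ A) {P Q r s ε : ℝ} (hP : 0 ≤ P) (hQ : 0 ≤ Q) (h1 : -Q ≤ r)
    (h2 : r < P + s) (hε : 0 < ε) :
    ∃ C, 0 ≤ C ∧ ∀ x : ℝ, 0 < x → A * x ^ r ≤ ε * (x ^ s * Wt P Q x) + C * Wt P Q x := by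
  obtain ⟨C, hC, h⟩ := absorb (ε := ε / (A + 1)) hP hQ h1 h2 (by positivity)
  refine ⟨A * C, by positivity, fun x hx => ?_⟩
  have h3 := mul_le_mul_of_nonneg_left (h x hx) hA
  have hW := Wt_pos (p := P) (q := Q) hx
  have hs := rpow_pos_of_pos hx s
  have h4 : A * (ε / (A + 1)) ≤ ε := by
    rw [mul_div_assoc', div_le_iff₀ (by positivity)]; nlinarith
  have h5 := mul_le_mul_of_nonneg_right h4 (mul_pos hs hW).le
  nlinarith

lemma srcA_le (A : ℝ) (hA : 0 ≤ A) (i : ℝ) (hi : 3 ≤ i) {P Q p q : ℝ} (hp : 0 ≤ p)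
    (hq : 0 ≤ q) (hpP : p ≤ P) (hqQ : q + (i - 2 * D.α) ≤ Q) (hqQ' : q ≤ Q) {ε : ℝ}
    (hε : 0 < ε) :
    ∃ C, 0 ≤ C ∧ ∀ x : ℝ, 0 < x → A * x ^ (2 * D.α - i) * Wt p q x ≤
      ε * (x ^ (2 * D.α - 2) * Wt P Q x) + C * Wt P Q x := by
  have hP : 0 ≤ P := by linarith
  have hQ : 0 ≤ Q := by linarith
  obtain ⟨C1, hC1, h1⟩ := absorb_mul A hA (P := P) (Q := Q) (r := 2 * D.α - i) (s := 2 * D.α - 2)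
    (ε := ε / 3) hP hQ (by linarith) (by linarith) (by linarith)
  obtain ⟨C2, hC2, h2⟩ := absorb_mul A hA (P := P) (Q := Q) (r := 2 * D.α - i + p)
    (s := 2 * D.α - 2) (ε := ε / 3) hP hQ (by linarith) (by linarith) (by linarith)
  obtain ⟨C3, hC3, h3⟩ := absorb_mul A hA (P := P) (Q := Q) (r := 2 * D.α - i + -q)
    (s := 2 * D.α - 2) (ε := ε / 3) hP hQ (by linarith) (by linarith) (by linarith)
  refine ⟨C1 + C2 + C3, by positivity, fun x hx => ?_⟩
  have e1 := h1 x hx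
  have e2 := h2 x hx
  have e3 := h3 x hx
  rw [rpow_add hx] at e2 e3
  have e : A * x ^ (2 * D.α - i) * Wt p q x = A * x ^ (2 * D.α - i)
    + A * (x ^ (2 * D.α - i) * x ^ p) + A * (x ^ (2 * D.α - i) * x ^ (-q)) := by
    unfold Wt; ring
  rw [e]
  nlinarith

lemma a_abs (k : ℕ) {x : ℝ} (hx : 0 < x) :
    |D.a k x| = |D.σ ^ 2 / 2 * (∏ i ∈ Finset.range k, (2 * D.α - i))| * x ^ (2 * D.α - k) := by
  rw [Par.a, abs_mul, abs_of_pos (rpow_pos_of_pos hx _)]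

lemma srcB_le {c : ℝ → ℝ} {g m p q P Q : ℝ} (hg : 0 ≤ g) (hm : 0 ≤ m) (hp : 0 ≤ p) (hq : 0 ≤ q)
    (hc : ∀ x : ℝ, 0 < x → |c x| ≤ D.K * Wt g m x) (h1 : p + g ≤ P) (h2 : q + m ≤ Q)
    {x : ℝ} (hx : 0 < x) : |c x| * Wt p q x ≤ 9 * D.K * Wt P Q x := by
  have hK := D.hK
  calc |c x| * Wt p q x ≤ D.K * Wt g m x * Wt p q x :=
        mul_le_mul_of_nonneg_right (hc x hx) (Wt_pos hx).le
    _ = D.K * (Wt g m x * Wt p q x) := by ring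
    _ ≤ D.K * (9 * Wt P Q x) := by
        apply mul_le_mul_of_nonneg_left _ (by linarith)
        exact Wt_mul hx hg hm hp hq (by linarith) (by linarith)
    _ = _ := by ring

lemma src_le {P Q : ℕ → ℝ} (h : Adm D P Q) (k : ℕ) (hk : k ≤ 4) {ε : ℝ} (hε : 0 < ε) :
    ∃ C, 0 ≤ C ∧ ∀ x : ℝ, 0 < x → D.src k (fun k => Wt (P k) (Q k)) x ≤
      ε * (x ^ (2 * D.α - 2) * Wt (P k) (Q k) x) + C * Wt (P k) (Q k) x := by
  have hK := D.hK
  have triv : ∀ x : ℝ, 0 < x → 0 ≤ ε * (x ^ (2 * D.α - 2) * Wt (P k) (Q k) x) := fun x hx => by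
    have := Wt_pos (p := P k) (q := Q k) hx
    positivity
  have hc2 := D.hc2
  have hg2 := D.hg2
  have hg3 := D.hg3
  have hc3 := D.hc3
  have p1 := h.p21
  have p2 := h.p32
  have p3 := h.p43
  have q1 := h.q21
  have q2 := h.q32
  have q3 := h.q43
  have A3 : ∀ x : ℝ, 0 < x → |D.a 3 x| = |D.σ ^ 2 / 2 * (∏ i ∈ Finset.range 3, (2 * D.α - i))|
    * x ^ (2 * D.α - 3) := fun x hx => by have := a_abs D 3 hx; push_cast at this; exact this
  have A4 : ∀ x : ℝ, 0 < x → |D.a 4 x| = |D.σ ^ 2 / 2 * (∏ i ∈ Finset.range 4, (2 * D.α - i))|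
    * x ^ (2 * D.α - 4) := fun x hx => by have := a_abs D 4 hx; push_cast at this; exact this
  set E3 := |D.σ ^ 2 / 2 * (∏ i ∈ Finset.range 3, (2 * D.α - i))|
  set E4 := |D.σ ^ 2 / 2 * (∏ i ∈ Finset.range 4, (2 * D.α - i))|
  interval_cases k
  · exact ⟨0, le_rfl, fun x hx => by simp only [Par.src]; linarith [triv x hx]⟩
  · exact ⟨0, le_rfl, fun x hx => by simp only [Par.src]; linarith [triv x hx]⟩
  · refine ⟨9 * D.K, by positivity, fun x hx => ?_⟩
    have := srcB_le D D.hg2 D.hc2 (h.hP 1) (h.hQ 1) D.hb2abs h.p21 h.q21 hx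
    simp only [Par.src]; linarith [triv x hx]
  · obtain ⟨C, hC, e⟩ := srcA_le D E3 (abs_nonneg _) 3 le_rfl (P := P 3) (Q := Q 3) (p := P 2)
      (q := Q 2) (h.hP 2) (h.hQ 2) (by linarith) h.q32' (by linarith) hε
    refine ⟨C + 4 * (9 * D.K), by positivity, fun x hx => ?_⟩
    have f1 := srcB_le D D.hg2 D.hc2 (h.hP 2) (h.hQ 2) D.hb2abs h.p32 h.q32 hx
    have f2 := srcB_le D D.hg3 D.hc3 (h.hP 1) (h.hQ 1) D.hb3abs h.p31 h.q31 hx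
    have f3 := e x hx
    rw [← A3 x hx] at f3
    simp only [Par.src]
    have f4 : |3 * D.b 2 x + D.a 3 x| ≤ 3 * |D.b 2 x| + |D.a 3 x| := by
      refine (abs_add_le _ _).trans (le_of_eq ?_); rw [abs_mul]; norm_num
    have f5 := mul_le_mul_of_nonneg_right f4 (Wt_pos (p := P 2) (q := Q 2) hx).le
    nlinarith
  · obtain ⟨C, hC, e⟩ := srcA_le D (4 * E3) (by positivity) 3 le_rfl (P := P 4) (Q := Q 4)
      (p := P 3) (q := Q 3) (h.hP 3) (h.hQ 3) (by linarith) h.q43' (by linarith) (half_pos hε)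
    obtain ⟨C', hC', e'⟩ := srcA_le D E4 (abs_nonneg _) 4 (by norm_num) (P := P 4) (Q := Q 4)
      (p := P 2) (q := Q 2) (h.hP 2) (h.hQ 2) (by linarith) h.q42' (by linarith) (half_pos hε)
    refine ⟨C + C' + 11 * (9 * D.K), by positivity, fun x hx => ?_⟩
    have f1 := srcB_le D D.hg2 D.hc2 (h.hP 3) (h.hQ 3) D.hb2abs h.p43 h.q43 hx
    have f2 := srcB_le D D.hg3 D.hc3 (h.hP 2) (h.hQ 2) D.hb3abs h.p42 h.q42 hx
    have f2' := srcB_le D D.hg4 D.hc4 (h.hP 1) (h.hQ 1) D.hb4abs h.p41 h.q41 hx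
    have f3 := e x hx
    have f3' := e' x hx
    rw [mul_assoc 4, ← A3 x hx] at f3
    rw [← A4 x hx] at f3'
    simp only [Par.src]
    have f4 : |6 * D.b 2 x + 4 * D.a 3 x| ≤ 6 * |D.b 2 x| + 4 * |D.a 3 x| := by
      refine (abs_add_le _ _).trans (le_of_eq ?_); rw [abs_mul, abs_mul]; norm_num
    have f5 := mul_le_mul_of_nonneg_right f4 (Wt_pos (p := P 3) (q := Q 3) hx).le
    have f6 : |4 * D.b 3 x + D.a 4 x| ≤ 4 * |D.b 3 x| + |D.a 4 x| := by
      refine (abs_add_le _ _).trans (le_of_eq ?_); rw [abs_mul]; norm_num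
    have f7 := mul_le_mul_of_nonneg_right f6 (Wt_pos (p := P 2) (q := Q 2) hx).le
    nlinarith

/-- Lyapunov inequality for admissible families -/
theorem lyap_adm {P Q : ℕ → ℝ} (h : Adm D P Q) :
    ∃ ω, 0 ≤ ω ∧ ∀ k ≤ 4, ∀ x : ℝ, 0 < x →
      D.lyap k (fun k => Wt (P k) (Q k)) (fun k => Wt1 (P k) (Q k)) (fun k => Wt2 (P k) (Q k)) x
        ≤ ω * Wt (P k) (Q k) x := by
  have hK := D.hK
  have hσ := D.hσ
  have hs : 0 < D.σ ^ 2 := by positivity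
  have hB1 := D.hB1
  have hB1' := D.hB1'
  have hb00 := D.hb00
  have main : ∀ k, k ≤ 4 → ∃ ω, 0 ≤ ω ∧ ∀ x : ℝ, 0 < x →
      D.lyap k (fun k => Wt (P k) (Q k)) (fun k => Wt1 (P k) (Q k)) (fun k => Wt2 (P k) (Q k)) x
        ≤ ω * Wt (P k) (Q k) x := by
    intro k hk
    rcases Nat.eq_zero_or_pos k with h0 | h0
    · subst h0
      have hm : P 0 * (D.σ ^ 2 / 2 * (P 0 - 1) - D.B2) ≤ 0 := by
        apply mul_nonpos_of_nonneg_of_nonpos (h.hP 0)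
        have h1 := h.hPu 0
        have hβ := D.hβ
        have h2 : 1 / (D.β + 1) ≤ 1 := by rw [div_le_one (by linarith)]; linarith
        have := D.hB2a
        have h3 : D.σ ^ 2 / 2 * (P 0 - 1) ≤ D.σ ^ 2 / 2 * (2 * D.β - 1) := by
          gcongr; linarith
        have h4 : 0 ≤ 3 * D.σ ^ 2 * D.α := by have := D.hα; positivity
        linarith
      obtain ⟨ω, hω, e⟩ := lyap_zero D (h.hP 0) (h.hQ 0) (h.hPQ 0) hm h.hQ0
      refine ⟨ω, hω, fun x hx => ?_⟩
      have := e x hx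
      simpa [Par.lyap, Par.src] using this
    · have hp := h.hP k
      have hq := h.hQ k
      obtain ⟨C1, hC1, e1⟩ := src_le D h k hk hs
      obtain ⟨C2, hC2, e2⟩ : ∃ C, 0 ≤ C ∧ ∀ x : ℝ, 0 < x →
          (D.σ ^ 2 / 2 * (Q k * (Q k + 1)) + Q k * D.K) * (x ^ (2 * D.α - 2) * x ^ (-Q k)) ≤
          D.σ ^ 2 * (x ^ (2 * D.α - 2) * Wt (P k) (Q k) x) + C * Wt (P k) (Q k) x := by
        rcases hq.eq_or_lt with h0 | h0
        · refine ⟨0, le_rfl, fun x hx => ?_⟩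
          have := Wt_pos (p := P k) (q := Q k) hx
          have h2 : 0 ≤ D.σ ^ 2 * (x ^ (2 * D.α - 2) * Wt (P k) (Q k) x) := by positivity
          rw [← h0] at h2 ⊢
          simpa using h2
        · obtain ⟨C, hC, e⟩ := absorb_mul (D.σ ^ 2 / 2 * (Q k * (Q k + 1)) + Q k * D.K)
            (by positivity) (P := P k) (Q := Q k) (r := 2 * D.α - 2 + -Q k) (s := 2 * D.α - 2)
            (ε := D.σ ^ 2) hp hq (by linarith [D.hα]) (by linarith) hs
          refine ⟨C, hC, fun x hx => ?_⟩
          have := e x hx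
          rwa [rpow_add hx] at this
      refine ⟨4 * D.B1' + C1 + C2 + (P k * D.B1 + P k * D.b00 + Q k * D.K), by positivity,
        fun x hx => ?_⟩
      have hW := Wt_pos (p := P k) (q := Q k) hx
      have f1 := e1 x hx
      have f2 := e2 x hx
      have f3 := prin_le D k hp hq (h.hPQ k) hx
      have f4 := mul_le_mul_of_nonneg_right (pot_le D k h0 hk hx) hW.le
      have hθ : 0 < x ^ (2 * D.α - 2) := rpow_pos_of_pos hx _
      have hxp : 0 < x ^ P k := rpow_pos_of_pos hx _
      have f5 := mul_le_mul_of_nonneg_right (mk_le D k hk hp (h.hPu k)) (mul_pos hθ hxp).le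
      have f6 : x ^ P k ≤ Wt (P k) (Q k) x := rpow_le_Wt hx (by linarith) le_rfl
      have f7 := mul_le_mul_of_nonneg_left f6 (mul_pos hs hθ).le
      have f8 : 0 ≤ D.σ ^ 2 * x ^ (2 * D.α - 2) * Wt (P k) (Q k) x := by positivity
      simp only [Par.lyap]
      nlinarith
  choose! ω hω e using main
  refine ⟨ω 0 + ω 1 + ω 2 + ω 3 + ω 4, ?_, ?_⟩
  · have := hω 0 (by norm_num); have := hω 1 (by norm_num); have := hω 2 (by norm_num)
    have := hω 3 (by norm_num); have := hω 4 (by norm_num); linarith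
  · intro k hk x hx
    refine (e k hk x hx).trans (mul_le_mul_of_nonneg_right ?_ (Wt_pos hx).le)
    have := hω 0 (by norm_num); have := hω 1 (by norm_num); have := hω 2 (by norm_num)
    have := hω 3 (by norm_num); have := hω 4 (by norm_num)
    interval_cases k <;> linarith

end

end KPde


namespace KPde

/-- a chain of derivatives on the half line -/
def Chain (n : ℕ) (u : ℕ → ℝ → ℝ) : Prop :=
  ∀ k < n, ∀ x : ℝ, 0 < x → HasDerivAt (u k) (u (k + 1) x) x

lemma Chain.mono {m n : ℕ} (h : m ≤ n) {u : ℕ → ℝ → ℝ} (hu : Chain n u) : Chain m u :=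
  fun k hk x hx => hu k (lt_of_lt_of_le hk h) x hx

lemma Chain.continuousOn {n : ℕ} {u : ℕ → ℝ → ℝ} (hu : Chain n u) {k : ℕ} (hk : k < n) :
    ContinuousOn (u k) (Ioi 0) :=
  fun x hx => (hu k hk x hx).continuousAt.continuousWithinAt

/-- lower order terms -/
noncomputable def Par.low (D : Par) (k : ℕ) (u : ℕ → ℝ → ℝ) (x : ℝ) : ℝ :=
  match k with
  | 2 => D.b 2 x * u 1 x
  | 3 => (3 * D.b 2 x + D.a 3 x) * u 2 x + D.b 3 x * u 1 x
  | 4 => (6 * D.b 2 x + 4 * D.a 3 x) * u 3 x + (4 * D.b 3 x + D.a 4 x) * u 2 x + D.b 4 x * u 1 x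
  | _ => 0

/-- differentiated operator -/
noncomputable def Par.Lk (D : Par) (k : ℕ) (u : ℕ → ℝ → ℝ) (x : ℝ) : ℝ :=
  D.a 0 x * u (k + 2) x + (D.b 0 x + k * D.a 1 x) * u (k + 1) x
    + (k * D.b 1 x + (k.choose 2 : ℕ) * D.a 2 x) * u k x + D.low k u x

lemma Lk_zero (D : Par) (u : ℕ → ℝ → ℝ) (x : ℝ) :
    D.Lk 0 u x = D.a 0 x * u 2 x + D.b 0 x * u 1 x := by
  simp [Par.Lk, Par.low]

lemma Lk_hasDerivAt (D : Par) {u : ℕ → ℝ → ℝ} {k : ℕ} (hk : k < 4) {x : ℝ} (hx : 0 < x)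
    (hu : ∀ j ≤ k + 2, HasDerivAt (u j) (u (j + 1) x) x) :
    HasDerivAt (D.Lk k u) (D.Lk (k + 1) u x) x := by
  have ha := fun i => D.a_hasDerivAt i hx
  have hb := fun i (hi : i < 4) => D.hchain i hi x hx
  have m1 := (ha 0).mul (hu (k + 2) (by omega))
  have m2 := ((hb 0 (by omega)).add ((ha 1).const_mul (k : ℝ))).mul (hu (k + 1) (by omega))
  have m3 := (((hb 1 (by omega)).const_mul (k : ℝ)).add
    ((ha 2).const_mul ((k.choose 2 : ℕ) : ℝ))).mul (hu k (by omega))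
  have e : HasDerivAt (D.low k u) (D.Lk (k + 1) u x -
      ((D.a 1 x * u (k + 2) x + D.a 0 x * u (k + 3) x)
      + ((D.b 1 x + k * D.a 2 x) * u (k + 1) x + (D.b 0 x + k * D.a 1 x) * u (k + 2) x)
      + ((k * D.b 2 x + (k.choose 2 : ℕ) * D.a 3 x) * u k x
        + (k * D.b 1 x + (k.choose 2 : ℕ) * D.a 2 x) * u (k + 1) x))) x := by
    interval_cases k
    · have h := hasDerivAt_const x (0 : ℝ)
      refine h.congr_deriv ?_
      simp [Par.Lk, Par.low]; ring
    · have h := hasDerivAt_const x (0 : ℝ)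
      refine h.congr_deriv ?_
      simp [Par.Lk, Par.low]; ring
    · have h := (hb 2 (by omega)).mul (hu 1 (by omega))
      refine h.congr_deriv ?_
      simp [Par.Lk, Par.low, Nat.choose]; ring
    · have h := ((((hb 2 (by omega)).const_mul 3).add (ha 3)).mul (hu 2 (by omega))).add
        ((hb 3 (by omega)).mul (hu 1 (by omega)))
      refine h.congr_deriv ?_
      simp [Par.Lk, Par.low, Nat.choose]; ring
  have h := ((m1.add m2).add m3).add e
  refine h.congr_deriv ?_
  simp only [Pi.add_apply]
  ring

lemma low_le (D : Par) {u F : ℕ → ℝ → ℝ} {M : ℝ} (hM : 0 ≤ M) {x : ℝ}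
    (h : ∀ k ≤ 4, |u k x| ≤ M * F k x) (k : ℕ) : |D.low k u x| ≤ M * D.src k F x := by
  have key : ∀ (c : ℝ) (j : ℕ), j ≤ 4 → |c * u j x| ≤ M * (|c| * F j x) := fun c j hj => by
    rw [abs_mul]
    have := mul_le_mul_of_nonneg_left (h j hj) (abs_nonneg c)
    linarith
  unfold Par.low Par.src
  split
  · exact key _ 1 (by omega)
  · have h1 := key (3 * D.b 2 x + D.a 3 x) 2 (by omega)
    have h2 := key (D.b 3 x) 1 (by omega)
    refine (abs_add_le _ _).trans ?_
    try simp only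
    linarith
  · have h1 := key (6 * D.b 2 x + 4 * D.a 3 x) 3 (by omega)
    have h2 := key (4 * D.b 3 x + D.a 4 x) 2 (by omega)
    have h3 := key (D.b 4 x) 1 (by omega)
    refine (abs_add_three _ _ _).trans ?_
    try simp only
    linarith
  · simp

lemma lyap_add (D : Par) (F F1 F2 G G1 G2 : ℕ → ℝ → ℝ) (e : ℝ) (k : ℕ) (x : ℝ) :
    D.lyap k (fun k x => F k x + e * G k x) (fun k x => F1 k x + e * G1 k x)
      (fun k x => F2 k x + e * G2 k x) x = D.lyap k F F1 F2 x + e * D.lyap k G G1 G2 x := by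
  unfold Par.lyap Par.src
  split <;> ring

/-- second order necessary condition -/
lemma second_order {ψ ψ1 : ℝ → ℝ} {c e : ℝ} (h1 : ∀ᶠ y in nhds c, HasDerivAt ψ (ψ1 y) y)
    (h2 : HasDerivAt ψ1 e c) (hpos : ∀ᶠ y in nhds c, 0 ≤ ψ y) (h0 : ψ c = 0) :
    ψ1 c = 0 ∧ 0 ≤ e := by
  have hmin : IsLocalMin ψ c := by
    filter_upwards [hpos] with y hy; rw [h0]; exact hy
  have hd : ψ1 c = 0 := hmin.hasDerivAt_eq_zero h1.self_of_nhds
  refine ⟨hd, ?_⟩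
  by_contra hneg
  push Not at hneg
  have ed : deriv ψ =ᶠ[nhds c] ψ1 := h1.mono fun y hy => hy.deriv
  have hdd : deriv (deriv ψ) c = e := by rw [ed.deriv_eq]; exact h2.deriv
  have hmax : IsLocalMax ψ c := by
    apply isLocalMax_of_deriv_deriv_neg
    · rw [hdd]; exact hneg
    · rw [h1.self_of_nhds.deriv, hd]
    · exact h1.self_of_nhds.continuousAt
  have hz : ψ =ᶠ[nhds c] fun _ => 0 := by
    filter_upwards [hpos, hmax] with y hy hy2
    rw [h0] at hy2; exact le_antisymm hy2 hy
  have hz1 : deriv ψ =ᶠ[nhds c] fun _ => 0 := by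
    have := hz.deriv; simpa using this
  have : deriv (deriv ψ) c = 0 := by rw [hz1.deriv_eq]; simp
  rw [hdd] at this; linarith

/-- touching lemma -/
lemma touch {w w1 F F1 : ℝ → ℝ} {w2 F2 M c : ℝ} (hw : ∀ᶠ y in nhds c, HasDerivAt w (w1 y) y)
    (hw1 : HasDerivAt w1 w2 c) (hF : ∀ᶠ y in nhds c, HasDerivAt F (F1 y) y)
    (hF1 : HasDerivAt F1 F2 c) (hle : ∀ᶠ y in nhds c, |w y| ≤ M * F y) (heq : |w c| = M * F c) :
    ∃ s : ℝ, |s| = 1 ∧ s * w c = M * F c ∧ s * w1 c = M * F1 c ∧ s * w2 ≤ M * F2 := by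
  obtain ⟨s, hs, hsw⟩ : ∃ s : ℝ, |s| = 1 ∧ s * w c = |w c| := by
    rcases le_total 0 (w c) with h | h
    · exact ⟨1, by simp, by rw [abs_of_nonneg h, one_mul]⟩
    · exact ⟨-1, by simp, by rw [abs_of_nonpos h]; ring⟩
  have h := second_order (ψ := fun y => M * F y - s * w y) (ψ1 := fun y => M * F1 y - s * w1 y)
    (c := c) (e := M * F2 - s * w2)
    (by filter_upwards [hw, hF] with y h1 h2 using (h2.const_mul M).sub (h1.const_mul s))
    ((hF1.const_mul M).sub (hw1.const_mul s))
    (by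
      filter_upwards [hle] with y hy
      have : s * w y ≤ |w y| := by
        calc s * w y ≤ |s * w y| := le_abs_self _
          _ = |w y| := by rw [abs_mul, hs, one_mul]
      linarith)
    (by rw [hsw, heq]; ring)
  exact ⟨s, hs, by rw [hsw, heq], by linarith [h.1], by linarith [h.2]⟩

lemma sgn_mul_le {s c M G : ℝ} (hs : |s| = 1) (h : |c| ≤ M * G) : s * c ≤ M * G := by
  calc s * c ≤ |s * c| := le_abs_self _
    _ = |c| := by rw [abs_mul, hs, one_mul]
    _ ≤ _ := h

/-- global maximum of the ratio -/
lemma exists_ratio_max {w F : ℝ → ℝ} (hw : ContinuousOn w (Ioi 0)) (hF : ContinuousOn F (Ioi 0))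
    (hpos : ∀ x : ℝ, 0 < x → 0 < F x)
    (ht : Filter.Tendsto (fun y => w (exp y) / F (exp y)) (Filter.cocompact ℝ) (nhds 0)) :
    ∃ M, 0 ≤ M ∧ (∀ x : ℝ, 0 < x → |w x| ≤ M * F x) ∧
      (0 < M → ∃ c, 0 < c ∧ |w c| = M * F c) := by
  by_cases hz : ∀ x : ℝ, 0 < x → w x = 0
  · exact ⟨0, le_rfl, fun x hx => by simp [hz x hx], fun h => absurd h (lt_irrefl _)⟩
  push Not at hz
  obtain ⟨x0, hx0, hne⟩ := hz
  set φ : ℝ → ℝ := fun y => |w (exp y) / F (exp y)| with hφ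
  have hexp : ContinuousOn exp (univ : Set ℝ) := continuous_exp.continuousOn
  have hc : Continuous φ := by
    apply continuous_abs.comp
    rw [← continuousOn_univ]
    exact (hw.comp hexp (fun y _ => exp_pos y)).div (hF.comp hexp (fun y _ => exp_pos y))
      (fun y _ => (hpos _ (exp_pos y)).ne')
  have hφ0 : 0 < φ (log x0) := by
    rw [hφ]; simp only [exp_log hx0]
    exact abs_pos.2 (div_ne_zero hne (hpos _ hx0).ne')
  have hev : ∀ᶠ y in Filter.cocompact ℝ, φ y ≤ φ (log x0) := by
    have := ht.abs
    rw [abs_zero] at this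
    exact (this.eventually_lt_const hφ0).mono fun y hy => hy.le
  obtain ⟨y0, hy0⟩ := hc.exists_forall_ge' (log x0) hev
  have hid : ∀ y, |w (exp y)| = φ y * F (exp y) := fun y => by
    have := hpos _ (exp_pos y)
    rw [hφ]; simp only [abs_div, abs_of_pos this]; field_simp
  refine ⟨φ y0, abs_nonneg _, fun x hx => ?_, fun _ => ⟨exp y0, exp_pos _, hid y0⟩⟩
  have h1 := hid (log x)
  rw [exp_log hx] at h1
  rw [h1]
  exact mul_le_mul_of_nonneg_right (hy0 _) (hpos x hx).le

lemma Wt_ratio {p q p' q' : ℝ} (hp0 : 0 ≤ p) (hq0 : 0 ≤ q) (hp : p < p') (hq : q < q') (C : ℝ)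
    {w : ℝ → ℝ} (hw : ∀ x : ℝ, 0 < x → |w x| ≤ C * Wt p q x) :
    Filter.Tendsto (fun y => w (exp y) / Wt p' q' (exp y)) (Filter.cocompact ℝ) (nhds 0) := by
  have hC : 0 ≤ C := by
    have h := (abs_nonneg _).trans (hw 1 one_pos)
    have h2 : 0 < Wt p q 1 := Wt_pos one_pos
    exact nonneg_of_mul_nonneg_left h h2
  set m := min (p' - p) (q' - q) with hm
  have hm0 : 0 < m := lt_min (by linarith) (by linarith)
  have key : ∀ y : ℝ, ‖w (exp y) / Wt p' q' (exp y)‖ ≤ C * 3 * exp (-(m * ‖y‖)) := by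
    intro y
    have hpos : 0 < Wt p' q' (exp y) := Wt_pos (exp_pos y)
    rw [norm_div, norm_of_nonneg hpos.le, div_le_iff₀ hpos, norm_eq_abs]
    refine (hw _ (exp_pos y)).trans ?_
    have h2 : Wt p q (exp y) ≤ 3 * exp (-(m * ‖y‖)) * Wt p' q' (exp y) := by
      rw [norm_eq_abs]
      unfold Wt
      simp only [← exp_mul]
      rcases le_total 0 y with h | h
      · rw [abs_of_nonneg h]
        have e1 : (1 : ℝ) ≤ exp (y * p) := one_le_exp (by positivity)
        have e2 : exp (y * -q) ≤ 1 := exp_le_one_iff.2 (by nlinarith)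
        have e3 : exp (y * p) ≤ exp (-(m * y)) * exp (y * p') := by
          rw [← exp_add]; apply exp_le_exp.2
          have : m ≤ p' - p := min_le_left _ _
          nlinarith
        have e4 : 0 ≤ exp (-(m * y)) * (1 + exp (y * -q')) := by positivity
        nlinarith
      · rw [abs_of_nonpos h]
        have e1 : (1 : ℝ) ≤ exp (y * -q) := one_le_exp (by nlinarith)
        have e2 : exp (y * p) ≤ 1 := exp_le_one_iff.2 (by nlinarith)
        have e3 : exp (y * -q) ≤ exp (-(m * -y)) * exp (y * -q') := by
          rw [← exp_add]; apply exp_le_exp.2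
          have : m ≤ q' - q := min_le_right _ _
          nlinarith
        have e4 : 0 ≤ exp (-(m * -y)) * (1 + exp (y * p')) := by positivity
        nlinarith
    have := mul_le_mul_of_nonneg_left h2 hC
    linarith
  have hlim : Filter.Tendsto (fun y : ℝ => C * 3 * exp (-(m * ‖y‖))) (Filter.cocompact ℝ) (nhds 0) := by
    have h1 : Filter.Tendsto (fun y : ℝ => m * ‖y‖) (Filter.cocompact ℝ) Filter.atTop :=
      (tendsto_norm_cocompact_atTop (E := ℝ)).const_mul_atTop hm0
    have h2 := (tendsto_exp_neg_atTop_nhds_zero.comp h1).const_mul (C * 3)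
    simpa using h2
  exact squeeze_zero_norm key hlim

lemma Wt_continuousOn (p q : ℝ) : ContinuousOn (Wt p q) (Ioi 0) :=
  fun _ hx => (Wt_hasDerivAt p q hx).continuousAt.continuousWithinAt

/-- a family of positive weights satisfying the Lyapunov inequality -/
structure Good (D : Par) (ω : ℝ) (F F1 F2 : ℕ → ℝ → ℝ) : Prop where
  pos : ∀ k ≤ 4, ∀ x : ℝ, 0 < x → 0 < F k x
  d1 : ∀ k ≤ 4, ∀ x : ℝ, 0 < x → HasDerivAt (F k) (F1 k x) x
  d2 : ∀ k ≤ 4, ∀ x : ℝ, 0 < x → HasDerivAt (F1 k) (F2 k x) x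
  ly : ∀ k ≤ 4, ∀ x : ℝ, 0 < x → D.lyap k F F1 F2 x ≤ ω * F k x

lemma Good.add {D : Par} {ω : ℝ} {F F1 F2 G G1 G2 : ℕ → ℝ → ℝ} (h : Good D ω F F1 F2)
    (h' : Good D ω G G1 G2) {e : ℝ} (he : 0 < e) :
    Good D ω (fun k x => F k x + e * G k x) (fun k x => F1 k x + e * G1 k x)
      (fun k x => F2 k x + e * G2 k x) where
  pos k hk x hx := add_pos (h.pos k hk x hx) (mul_pos he (h'.pos k hk x hx))
  d1 k hk x hx := (h.d1 k hk x hx).add ((h'.d1 k hk x hx).const_mul e)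
  d2 k hk x hx := (h.d2 k hk x hx).add ((h'.d2 k hk x hx).const_mul e)
  ly k hk x hx := by
    rw [lyap_add]
    have h1 := h.ly k hk x hx
    have h2 := mul_le_mul_of_nonneg_left (h'.ly k hk x hx) he.le
    linarith

lemma good_of_adm {D : Par} {P Q : ℕ → ℝ} (h : Adm D P Q) :
    ∃ ω, 0 ≤ ω ∧ ∀ ω' ≥ ω, Good D ω' (fun k => Wt (P k) (Q k)) (fun k => Wt1 (P k) (Q k))
      (fun k => Wt2 (P k) (Q k)) := by
  obtain ⟨ω, h0, hω⟩ := lyap_adm D h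
  refine ⟨ω, h0, fun ω' hω' => ⟨fun k _ x hx => Wt_pos hx, fun k _ x hx => Wt_hasDerivAt _ _ hx,
    fun k _ x hx => Wt1_hasDerivAt _ _ hx, fun k hk x hx => (hω k hk x hx).trans ?_⟩⟩
  exact mul_le_mul_of_nonneg_right hω' (Wt_pos hx).le

lemma ev_pos {x : ℝ} (hx : 0 < x) {p : ℝ → Prop} (h : ∀ y : ℝ, 0 < y → p y) :
    ∀ᶠ y in nhds x, p y := by
  filter_upwards [Ioi_mem_nhds hx] with y hy using h y hy

lemma coupled_one {D : Par} {ω h N : ℝ} {F F1 F2 : ℕ → ℝ → ℝ} (hF : Good D ω F F1 F2)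
    (hh : 0 < h) (hω : h * ω < 1) (hN : 0 ≤ N) {u g : ℕ → ℝ → ℝ} (hu : Chain 6 u)
    (heq : ∀ k ≤ 4, ∀ x : ℝ, 0 < x → u k x - h * D.Lk k u x = g k x)
    (hg : ∀ k ≤ 4, ∀ x : ℝ, 0 < x → |g k x| ≤ N * F k x)
    (ht : ∀ k ≤ 4, Filter.Tendsto (fun y => u k (exp y) / F k (exp y)) (Filter.cocompact ℝ)
      (nhds 0)) :
    ∀ k ≤ 4, ∀ x : ℝ, 0 < x → |u k x| ≤ N / (1 - h * ω) * F k x := by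
  have hmax : ∀ k, ∃ M, 0 ≤ M ∧ (k ≤ 4 → (∀ x : ℝ, 0 < x → |u k x| ≤ M * F k x) ∧
      (0 < M → ∃ c, 0 < c ∧ |u k c| = M * F k c)) := by
    intro k
    by_cases hk : k ≤ 4
    · obtain ⟨M, h0, h1, h2⟩ := exists_ratio_max (hu.continuousOn (k := k) (by omega))
        (fun x hx => (hF.d1 k hk x hx).continuousAt.continuousWithinAt) (hF.pos k hk) (ht k hk)
      exact ⟨M, h0, fun _ => ⟨h1, h2⟩⟩
    · exact ⟨0, le_rfl, fun h => absurd h hk⟩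
  choose M hM0 hM using hmax
  obtain ⟨k, hk, hkmax⟩ := Finset.exists_max_image (Finset.range 5) M ⟨0, by simp⟩
  have hk4 : k ≤ 4 := by simp at hk; omega
  have hall : ∀ j ≤ 4, ∀ x : ℝ, 0 < x → |u j x| ≤ M k * F j x := fun j hj x hx =>
    ((hM j hj).1 x hx).trans (mul_le_mul_of_nonneg_right (hkmax j (by simp; omega))
      (hF.pos j hj x hx).le)
  have hp : 0 < 1 - h * ω := by linarith
  have hle : M k ≤ N / (1 - h * ω) := by
    rcases (hM0 k).eq_or_lt with h0 | h0
    · rw [← h0]; positivity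
    obtain ⟨c, hc, hce⟩ := (hM k hk4).2 h0
    have hFc := hF.pos k hk4 c hc
    obtain ⟨s, hs, s0, s1, s2⟩ := touch (ev_pos hc (hu k (by omega))) (hu (k + 1) (by omega) c hc)
      (ev_pos hc (hF.d1 k hk4)) (hF.d2 k hk4 c hc) (ev_pos hc (hall k hk4)) hce
    have hlow := sgn_mul_le hs (low_le D (hM0 k) (fun j hj => hall j hj c hc) k)
    have hgc := sgn_mul_le hs (hg k hk4 c hc)
    have ha := mul_le_mul_of_nonneg_left s2 (D.a_pos hc).le
    have hL : s * D.Lk k u c ≤ M k * D.lyap k F F1 F2 c := by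
      have e : s * D.Lk k u c = D.a 0 c * (s * u (k + 2) c)
        + (D.b 0 c + k * D.a 1 c) * (s * u (k + 1) c)
        + (k * D.b 1 c + (k.choose 2 : ℕ) * D.a 2 c) * (s * u k c) + s * D.low k u c := by
        unfold Par.Lk; ring
      rw [e, s1, s0]; unfold Par.lyap
      have ha' : D.a 0 c * (s * u (k + 2) c) ≤ D.a 0 c * (M k * F2 k c) := ha
      linarith
    have hly := mul_le_mul_of_nonneg_left (hF.ly k hk4 c hc) h0.le
    have hL2 := mul_le_mul_of_nonneg_left (hL.trans hly) hh.le
    have e2 : s * u k c - h * (s * D.Lk k u c) = s * g k c := by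
      rw [← heq k hk4 c hc]; ring
    rw [s0] at e2
    have : (M k * (1 - h * ω)) * F k c ≤ N * F k c := by nlinarith
    rw [le_div_iff₀ hp]
    exact le_of_mul_le_mul_right this hFc
  intro j hj x hx
  exact (hall j hj x hx).trans (mul_le_mul_of_nonneg_right hle (hF.pos j hj x hx).le)

lemma eps_limit {a c f z : ℝ} (hc : 0 ≤ c) (hz : 0 < z)
    (key : ∀ e : ℝ, 0 < e → a ≤ c * (f + e * z)) : a ≤ c * f := by
  refine le_of_forall_pos_le_add fun ε hε => ?_
  have h1 := key (ε / ((c + 1) * z)) (by positivity)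
  refine h1.trans ?_
  rw [mul_add]
  have h2 : c * (ε / ((c + 1) * z) * z) = c / (c + 1) * ε := by
    have : 0 < c + 1 := by positivity
    field_simp
  have h3 : c / (c + 1) ≤ 1 := by
    rw [div_le_one (by positivity)]; linarith
  rw [h2]
  nlinarith

lemma tendsto_ratio {w F Z : ℝ → ℝ} {e : ℝ} (he : 0 < e) (hF : ∀ x : ℝ, 0 < x → 0 < F x)
    (hZ : ∀ x : ℝ, 0 < x → 0 < Z x)
    (h : Filter.Tendsto (fun y => w (exp y) / Z (exp y)) (Filter.cocompact ℝ) (nhds 0)) :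
    Filter.Tendsto (fun y => w (exp y) / (F (exp y) + e * Z (exp y))) (Filter.cocompact ℝ)
      (nhds 0) := by
  have h2 := h.norm.const_mul (1 / e)
  rw [norm_zero, mul_zero] at h2
  refine squeeze_zero_norm (fun y => ?_) h2
  have hW := hZ _ (exp_pos y)
  have hFp := hF _ (exp_pos y)
  rw [norm_div, norm_div, norm_of_nonneg hW.le,
    norm_of_nonneg (show 0 ≤ F (exp y) + e * Z (exp y) by positivity), div_mul_div_comm, one_mul]
  apply div_le_div_of_nonneg_left (norm_nonneg _) (by positivity)
  linarith

/-- coupled a priori estimate -/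
lemma coupled {D : Par} {ω h N C : ℝ} {F F1 F2 : ℕ → ℝ → ℝ} (hF : Good D ω F F1 F2)
    {PZ QZ p q : ℕ → ℝ} (hZ : Good D ω (fun k => Wt (PZ k) (QZ k)) (fun k => Wt1 (PZ k) (QZ k))
      (fun k => Wt2 (PZ k) (QZ k)))
    (hp0 : ∀ k ≤ 4, 0 ≤ p k) (hq0 : ∀ k ≤ 4, 0 ≤ q k) (hp : ∀ k ≤ 4, p k < PZ k)
    (hq : ∀ k ≤ 4, q k < QZ k)
    (hh : 0 < h) (hω : h * ω < 1) (hN : 0 ≤ N) {u g : ℕ → ℝ → ℝ} (hu : Chain 6 u)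
    (heq : ∀ k ≤ 4, ∀ x : ℝ, 0 < x → u k x - h * D.Lk k u x = g k x)
    (hg : ∀ k ≤ 4, ∀ x : ℝ, 0 < x → |g k x| ≤ N * F k x)
    (hcr : ∀ k ≤ 4, ∀ x : ℝ, 0 < x → |u k x| ≤ C * Wt (p k) (q k) x) :
    ∀ k ≤ 4, ∀ x : ℝ, 0 < x → |u k x| ≤ N / (1 - h * ω) * F k x := by
  intro k hk x hx
  have hp1 : 0 < 1 - h * ω := by linarith
  have key : ∀ e : ℝ, 0 < e → |u k x| ≤ N / (1 - h * ω) * (F k x + e * Wt (PZ k) (QZ k) x) := by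
    intro e he
    refine coupled_one (hF.add hZ he) hh hω hN hu heq (fun j hj y hy => (hg j hj y hy).trans ?_) ?_
      k hk x hx
    · have := Wt_pos (p := PZ j) (q := QZ j) hy
      apply mul_le_mul_of_nonneg_left _ hN
      nlinarith
    · intro j hj
      exact tendsto_ratio he (hF.pos j hj) (fun x hx => Wt_pos hx)
        (Wt_ratio (hp0 j hj) (hq0 j hj) (hp j hj) (hq j hj) C (hcr j hj))
  exact eps_limit (by positivity) (Wt_pos hx) key

/-- scalar level zero comparison on the half line -/
lemma scalar_one {D : Par} {ω h N : ℝ} {F F1 F2 : ℝ → ℝ}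
    (hF0 : ∀ x : ℝ, 0 < x → 0 < F x) (hF1 : ∀ x : ℝ, 0 < x → HasDerivAt F (F1 x) x)
    (hF2 : ∀ x : ℝ, 0 < x → HasDerivAt F1 (F2 x) x)
    (hly : ∀ x : ℝ, 0 < x → D.a 0 x * F2 x + D.b 0 x * F1 x ≤ ω * F x)
    (hh : 0 < h) (hω : h * ω < 1) (hN : 0 ≤ N) {u u1 u2 g : ℝ → ℝ}
    (hu1 : ∀ x : ℝ, 0 < x → HasDerivAt u (u1 x) x) (hu2 : ∀ x : ℝ, 0 < x → HasDerivAt u1 (u2 x) x)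
    (heq : ∀ x : ℝ, 0 < x → u x - h * (D.a 0 x * u2 x + D.b 0 x * u1 x) = g x)
    (hg : ∀ x : ℝ, 0 < x → |g x| ≤ N * F x)
    (ht : Filter.Tendsto (fun y => u (exp y) / F (exp y)) (Filter.cocompact ℝ) (nhds 0)) :
    ∀ x : ℝ, 0 < x → |u x| ≤ N / (1 - h * ω) * F x := by
  obtain ⟨M, hM0, hM, hMc⟩ := exists_ratio_max
    (fun x hx => (hu1 x hx).continuousAt.continuousWithinAt)
    (fun x hx => (hF1 x hx).continuousAt.continuousWithinAt) hF0 ht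
  have hp : 0 < 1 - h * ω := by linarith
  have hle : M ≤ N / (1 - h * ω) := by
    rcases hM0.eq_or_lt with h0 | h0
    · rw [← h0]; positivity
    obtain ⟨c, hc, hce⟩ := hMc h0
    obtain ⟨s, hs, s0, s1, s2⟩ := touch (ev_pos hc hu1) (hu2 c hc)
      (ev_pos hc hF1) (hF2 c hc) (ev_pos hc hM) hce
    have hgc := sgn_mul_le hs (hg c hc)
    have ha := mul_le_mul_of_nonneg_left s2 (D.a_pos hc).le
    have hl := mul_le_mul_of_nonneg_left (hly c hc) h0.le
    have e2 : s * u c - h * (D.a 0 c * (s * u2 c) + D.b 0 c * (s * u1 c)) = s * g c := by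
      rw [← heq c hc]; ring
    rw [s0, s1] at e2
    have hL : h * (D.a 0 c * (s * u2 c) + D.b 0 c * (M * F1 c)) ≤ h * (M * (ω * F c)) := by
      apply mul_le_mul_of_nonneg_left _ hh.le
      nlinarith
    have : (M * (1 - h * ω)) * F c ≤ N * F c := by nlinarith
    rw [le_div_iff₀ hp]
    exact le_of_mul_le_mul_right this (hF0 c hc)
  intro x hx
  exact (hM x hx).trans (mul_le_mul_of_nonneg_right hle (hF0 x hx).le)

/-- scalar comparison with an auxiliary weight -/
lemma scalar_two {D : Par} {ω h N C p q p' q' : ℝ} {F F1 F2 : ℝ → ℝ}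
    (hF0 : ∀ x : ℝ, 0 < x → 0 < F x) (hF1 : ∀ x : ℝ, 0 < x → HasDerivAt F (F1 x) x)
    (hF2 : ∀ x : ℝ, 0 < x → HasDerivAt F1 (F2 x) x)
    (hly : ∀ x : ℝ, 0 < x → D.a 0 x * F2 x + D.b 0 x * F1 x ≤ ω * F x)
    (hlZ : ∀ x : ℝ, 0 < x → D.a 0 x * Wt2 p' q' x + D.b 0 x * Wt1 p' q' x ≤ ω * Wt p' q' x)
    (hp0 : 0 ≤ p) (hq0 : 0 ≤ q) (hp : p < p') (hq : q < q')
    (hh : 0 < h) (hω : h * ω < 1) (hN : 0 ≤ N) {u u1 u2 g : ℝ → ℝ}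
    (hu1 : ∀ x : ℝ, 0 < x → HasDerivAt u (u1 x) x) (hu2 : ∀ x : ℝ, 0 < x → HasDerivAt u1 (u2 x) x)
    (heq : ∀ x : ℝ, 0 < x → u x - h * (D.a 0 x * u2 x + D.b 0 x * u1 x) = g x)
    (hg : ∀ x : ℝ, 0 < x → |g x| ≤ N * F x)
    (hcr : ∀ x : ℝ, 0 < x → |u x| ≤ C * Wt p q x) :
    ∀ x : ℝ, 0 < x → |u x| ≤ N / (1 - h * ω) * F x := by
  intro x hx
  have hp1 : 0 < 1 - h * ω := by linarith
  refine eps_limit (z := Wt p' q' x) (by positivity) (Wt_pos hx) fun e he => ?_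
  refine scalar_one (F := fun x => F x + e * Wt p' q' x) (F1 := fun x => F1 x + e * Wt1 p' q' x)
    (F2 := fun x => F2 x + e * Wt2 p' q' x) (fun y hy => ?_) (fun y hy => ?_) (fun y hy => ?_)
    (fun y hy => ?_) hh hω hN hu1 hu2 heq (fun y hy => ?_) ?_ x hx
  · have := hF0 y hy
    have := Wt_pos (p := p') (q := q') hy
    positivity
  · exact (hF1 y hy).add ((Wt_hasDerivAt _ _ hy).const_mul e)
  · exact (hF2 y hy).add ((Wt1_hasDerivAt _ _ hy).const_mul e)
  · have h1 := hly y hy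
    have h2 := mul_le_mul_of_nonneg_left (hlZ y hy) he.le
    linarith
  · refine (hg y hy).trans (mul_le_mul_of_nonneg_left ?_ hN)
    have := Wt_pos (p := p') (q := q') hy
    nlinarith
  · exact tendsto_ratio he hF0 (fun x hx => Wt_pos hx) (Wt_ratio hp0 hq0 hp hq C hcr)

/-- scalar comparison on a compact interval with zero boundary data -/
lemma scalar_bvp {D : Par} {ω h N A B : ℝ} (hA : 0 < A) (hAB : A ≤ B) {F F1 F2 : ℝ → ℝ}
    (hF0 : ∀ x : ℝ, 0 < x → 0 < F x) (hF1 : ∀ x : ℝ, 0 < x → HasDerivAt F (F1 x) x)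
    (hF2 : ∀ x : ℝ, 0 < x → HasDerivAt F1 (F2 x) x)
    (hly : ∀ x : ℝ, 0 < x → D.a 0 x * F2 x + D.b 0 x * F1 x ≤ ω * F x)
    (hh : 0 < h) (hω : h * ω < 1) (hN : 0 ≤ N) {u u1 u2 g : ℝ → ℝ}
    (hu1 : ∀ x : ℝ, 0 < x → HasDerivAt u (u1 x) x) (hu2 : ∀ x : ℝ, 0 < x → HasDerivAt u1 (u2 x) x)
    (heq : ∀ x : ℝ, 0 < x → u x - h * (D.a 0 x * u2 x + D.b 0 x * u1 x) = g x)
    (hg : ∀ x : ℝ, 0 < x → |g x| ≤ N * F x) (huA : u A = 0) (huB : u B = 0) :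
    ∀ x ∈ Icc A B, |u x| ≤ N / (1 - h * ω) * F x := by
  have hsub : Icc A B ⊆ Ioi 0 := fun x hx => lt_of_lt_of_le hA hx.1
  have hc : ContinuousOn (fun x => |u x| / F x) (Icc A B) := by
    apply ContinuousOn.div
    · exact ContinuousOn.abs
        (fun x hx => (hu1 x (hsub hx)).continuousAt.continuousWithinAt)
    · exact fun x hx => (hF1 x (hsub hx)).continuousAt.continuousWithinAt
    · exact fun x hx => (hF0 x (hsub hx)).ne'
  obtain ⟨c, hcI, hcmax⟩ := isCompact_Icc.exists_isMaxOn (nonempty_Icc.2 hAB) hc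
  have hc0 : 0 < c := hsub hcI
  set M := |u c| / F c with hMdef
  have hM : ∀ x ∈ Icc A B, |u x| ≤ M * F x := fun x hx => by
    rw [← div_le_iff₀ (hF0 x (hsub hx))]; exact hcmax hx
  have hM0 : 0 ≤ M := div_nonneg (abs_nonneg _) (hF0 c hc0).le
  have hce : |u c| = M * F c := by
    have := hF0 c hc0
    rw [hMdef]; field_simp
  have hp : 0 < 1 - h * ω := by linarith
  have hle : M ≤ N / (1 - h * ω) := by
    rcases hM0.eq_or_lt with h0 | h0
    · rw [← h0]; positivity
    have hcA : A < c := lt_of_le_of_ne hcI.1 (fun h => by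
      rw [← h, huA] at hMdef; simp at hMdef; linarith)
    have hcB : c < B := lt_of_le_of_ne hcI.2 (fun h => by
      rw [h, huB] at hMdef; simp at hMdef; linarith)
    have hev : ∀ᶠ y in nhds c, |u y| ≤ M * F y := by
      filter_upwards [Icc_mem_nhds hcA hcB] with y hy using hM y hy
    obtain ⟨s, hs, s0, s1, s2⟩ := touch (ev_pos hc0 hu1) (hu2 c hc0)
      (ev_pos hc0 hF1) (hF2 c hc0) hev hce
    have hgc := sgn_mul_le hs (hg c hc0)
    have ha := mul_le_mul_of_nonneg_left s2 (D.a_pos hc0).le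
    have hl := mul_le_mul_of_nonneg_left (hly c hc0) h0.le
    have e2 : s * u c - h * (D.a 0 c * (s * u2 c) + D.b 0 c * (s * u1 c)) = s * g c := by
      rw [← heq c hc0]; ring
    rw [s0, s1] at e2
    have hL : h * (D.a 0 c * (s * u2 c) + D.b 0 c * (M * F1 c)) ≤ h * (M * (ω * F c)) := by
      apply mul_le_mul_of_nonneg_left _ hh.le
      nlinarith
    have : (M * (1 - h * ω)) * F c ≤ N * F c := by nlinarith
    rw [le_div_iff₀ hp]
    exact le_of_mul_le_mul_right this (hF0 c hc0)
  intro x hx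
  exact (hM x hx).trans (mul_le_mul_of_nonneg_right hle (hF0 x (hsub hx)).le)

end KPde


namespace KPde

open BoundedContinuousFunction in
/-- global solutions of Lipschitz ODE with locally bounded Lipschitz constant -/
lemma ode_global {E : Type*} [NormedAddCommGroup E] [NormedSpace ℝ E] [CompleteSpace E]
    (f : ℝ → E → E) (k : ℝ → ℝ) (hf : Continuous fun z : ℝ × E => f z.1 z.2) (hk : Continuous k)
    (hk0 : ∀ t, 0 ≤ k t) (hL : ∀ t y z, ‖f t y - f t z‖ ≤ k t * ‖y - z‖)
    (h0 : ∀ t, ‖f t 0‖ ≤ k t) (y0 : E) :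
    ∃ y : ℝ → E, y 0 = y0 ∧ ∀ t, HasDerivAt y (f t (y t)) t := by
  set θ : ℝ → ℝ := fun t => ∫ s in (0 : ℝ)..t, 2 * k s with hθ
  have hk2 : Continuous fun s => 2 * k s := by fun_prop
  have dθ : ∀ t, HasDerivAt θ (2 * k t) t := fun t =>
    intervalIntegral.integral_hasDerivAt_right (hk2.intervalIntegrable _ _)
      hk2.aestronglyMeasurable.stronglyMeasurableAtFilter hk2.continuousAt
  have cθ : Continuous θ := continuous_iff_continuousAt.2 fun t => (dθ t).continuousAt
  have hintg : ∀ t, ∫ s in (0 : ℝ)..t, k s * cosh (θ s) = sinh (θ t) / 2 := fun t => by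
    have h1 : ∀ s, HasDerivAt (fun s => sinh (θ s) / 2) (k s * cosh (θ s)) s := fun s => by
      refine (((dθ s).sinh).div_const 2).congr_deriv ?_; ring
    rw [intervalIntegral.integral_eq_sub_of_hasDerivAt (fun s _ => h1 s)
      ((by fun_prop : Continuous fun s => k s * cosh (θ s)).intervalIntegrable _ _)]
    simp [hθ]
  have hkey : ∀ (φ : ℝ → E) (C : ℝ), 0 ≤ C → (∀ s, ‖φ s‖ ≤ C * (k s * cosh (θ s))) → ∀ t,
      ‖∫ s in (0 : ℝ)..t, φ s‖ ≤ C / 2 * cosh (θ t) := by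
    intro φ C hC h t
    have h1 := intervalIntegral.norm_integral_le_abs_of_norm_le (μ := volume) (a := 0) (b := t)
      (f := φ) (g := fun s => C * (k s * cosh (θ s))) (Filter.Eventually.of_forall fun s => h s)
      ((by fun_prop : Continuous fun s => C * (k s * cosh (θ s))).intervalIntegrable _ _)
    rw [intervalIntegral.integral_const_mul, hintg, abs_mul, abs_of_nonneg hC, abs_div,
      abs_of_pos (a := (2 : ℝ)) (two_pos)] at h1
    have h2 : |sinh (θ t)| ≤ cosh (θ t) := by
      rw [abs_le]
      have h3 := cosh_add_sinh (θ t)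
      have h4 := cosh_sub_sinh (θ t)
      have h5 := exp_pos (θ t)
      have h6 := exp_pos (-θ t)
      constructor <;> linarith
    refine h1.trans ?_
    have := mul_le_mul_of_nonneg_left h2 hC
    linarith
  have hpos : ∀ t, 0 < cosh (θ t) := fun t => cosh_pos _
  have hfc : ∀ z : ℝ →ᵇ E, Continuous fun s => f s (cosh (θ s) • z s) := fun z =>
    hf.comp (continuous_id.prodMk
      ((by fun_prop : Continuous fun s => cosh (θ s)).smul z.continuous))
  have hbd : ∀ (z : ℝ →ᵇ E) s, ‖f s (cosh (θ s) • z s)‖ ≤ (1 + ‖z‖) * (k s * cosh (θ s)) := by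
    intro z s
    have h1 := hL s (cosh (θ s) • z s) 0
    have h2 := norm_add_le (f s (cosh (θ s) • z s) - f s 0) (f s 0)
    rw [sub_add_cancel] at h2
    rw [sub_zero, norm_smul, norm_of_nonneg (hpos s).le] at h1
    have h3 := z.norm_coe_le_norm s
    have h4 := h0 s
    have h5 := one_le_cosh (θ s)
    have h6 := hk0 s
    have h7 : k s ≤ k s * cosh (θ s) := le_mul_of_one_le_right h6 h5
    have h8 : k s * (cosh (θ s) * ‖z s‖) ≤ k s * (cosh (θ s) * ‖z‖) := by
      have := (hpos s).le
      gcongr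
    linarith
  have hci : ∀ z : ℝ →ᵇ E, Continuous fun t => ∫ s in (0 : ℝ)..t, f s (cosh (θ s) • z s) :=
    fun z => intervalIntegral.continuous_primitive (fun a b => (hfc z).intervalIntegrable a b) 0
  let S : (ℝ →ᵇ E) → (ℝ →ᵇ E) := fun z => BoundedContinuousFunction.ofNormedAddCommGroup
    (fun t => (cosh (θ t))⁻¹ • (y0 + ∫ s in (0 : ℝ)..t, f s (cosh (θ s) • z s)))
    (((by fun_prop : Continuous fun s => cosh (θ s)).inv₀ (fun t => (hpos t).ne')).smul
      (continuous_const.add (hci z)))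
    (‖y0‖ + (1 + ‖z‖) / 2) (fun t => by
      rw [norm_smul, norm_inv, norm_of_nonneg (hpos t).le, inv_mul_le_iff₀ (hpos t)]
      have h1 := hkey _ (1 + ‖z‖) (by positivity) (hbd z) t
      refine (norm_add_le _ _).trans ?_
      have h2 := one_le_cosh (θ t)
      have h3 := norm_nonneg y0
      nlinarith)
  have hcontr : ContractingWith (1 / 2) S := by
    refine ⟨by norm_num, LipschitzWith.of_dist_le_mul fun z w => ?_⟩
    rw [dist_eq_norm]
    have : ((1 / 2 : NNReal) : ℝ) = 1 / 2 := by norm_num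
    rw [this]
    refine (BoundedContinuousFunction.norm_le (by positivity)).2 fun t => ?_
    have e : (S z - S w) t = (cosh (θ t))⁻¹ • (∫ s in (0 : ℝ)..t,
        (f s (cosh (θ s) • z s) - f s (cosh (θ s) • w s))) := by
      rw [intervalIntegral.integral_sub ((hfc z).intervalIntegrable _ _)
        ((hfc w).intervalIntegrable _ _)]
      change (cosh (θ t))⁻¹ • (y0 + _) - (cosh (θ t))⁻¹ • (y0 + _) = _
      rw [← smul_sub, add_sub_add_left_eq_sub]
    rw [e, norm_smul, norm_inv, norm_of_nonneg (hpos t).le, inv_mul_le_iff₀ (hpos t), dist_eq_norm]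
    refine (hkey _ ‖z - w‖ (norm_nonneg _) (fun s => ?_) t).trans (le_of_eq (by ring))
    refine (hL s _ _).trans ?_
    rw [← smul_sub, norm_smul, norm_of_nonneg (hpos s).le]
    have h3 := (z - w).norm_coe_le_norm s
    have h4 := hk0 s
    have h5 := (hpos s).le
    calc k s * (cosh (θ s) * ‖z s - w s‖) ≤ k s * (cosh (θ s) * ‖z - w‖) := by gcongr; exact h3
      _ = _ := by ring
  obtain ⟨z, hz⟩ : ∃ z, S z = z := ⟨_, hcontr.fixedPoint_isFixedPt⟩
  have hy : ∀ t, cosh (θ t) • z t = y0 + ∫ s in (0 : ℝ)..t, f s (cosh (θ s) • z s) := fun t => by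
    have h1 : z t = (cosh (θ t))⁻¹ • (y0 + ∫ s in (0 : ℝ)..t, f s (cosh (θ s) • z s)) := by
      conv_lhs => rw [← hz]
      rfl
    conv_lhs => rw [h1]
    rw [smul_smul, mul_inv_cancel₀ (hpos t).ne', one_smul]
  refine ⟨fun t => cosh (θ t) • z t, ?_, fun t => ?_⟩
  · simp only [hy 0, intervalIntegral.integral_same, add_zero]
  · have h1 := (intervalIntegral.integral_hasDerivAt_right ((hfc z).intervalIntegrable 0 t)
      (hfc z).aestronglyMeasurable.stronglyMeasurableAtFilter (hfc z).continuousAt).const_add y0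
    refine h1.congr_of_eventuallyEq (Filter.Eventually.of_forall fun s => hy s)

/-- second order linear ODE on the half line -/
lemma ode2 (P Q R : ℝ → ℝ) (hP : ContinuousOn P (Ioi 0)) (hQ : ContinuousOn Q (Ioi 0))
    (hR : ContinuousOn R (Ioi 0)) (c d : ℝ) :
    ∃ u u1 : ℝ → ℝ, u 1 = c ∧ u1 1 = d ∧ ∀ x : ℝ, 0 < x → HasDerivAt u (u1 x) x ∧
      HasDerivAt u1 (P x * u1 x + Q x * u x + R x) x := by
  have hc : ∀ {φ : ℝ → ℝ}, ContinuousOn φ (Ioi 0) → Continuous fun s => φ (exp s) := fun h =>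
    continuousOn_univ.1 (h.comp continuous_exp.continuousOn fun y _ => exp_pos y)
  obtain ⟨p, hp⟩ : ∃ p : ℝ → ℝ, ∀ s, p s = P (exp s) := ⟨_, fun _ => rfl⟩
  obtain ⟨q, hq⟩ : ∃ p : ℝ → ℝ, ∀ s, p s = Q (exp s) := ⟨_, fun _ => rfl⟩
  obtain ⟨r, hr⟩ : ∃ p : ℝ → ℝ, ∀ s, p s = R (exp s) := ⟨_, fun _ => rfl⟩
  have cP : Continuous p := by rw [funext hp]; exact hc hP
  have cQ : Continuous q := by rw [funext hq]; exact hc hQ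
  have cR : Continuous r := by rw [funext hr]; exact hc hR
  obtain ⟨y, y0, hy⟩ := ode_global (E := ℝ × ℝ)
    (fun s y => (exp s * y.2, exp s * (p s * y.2 + q s * y.1 + r s)))
    (fun s => exp s * (1 + |p s| + |q s| + |r s|))
    (by fun_prop) (by fun_prop) (fun s => by positivity) (fun s y z => by
      have e : (exp s * y.2, exp s * (p s * y.2 + q s * y.1 + r s)) -
        (exp s * z.2, exp s * (p s * z.2 + q s * z.1 + r s)) =
        (exp s * (y - z).2, exp s * (p s * (y - z).2 + q s * (y - z).1)) := by
        ext
        · simp; ring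
        · simp; ring
      rw [e]
      have h1 : |(y - z).1| ≤ ‖y - z‖ := by simpa using norm_fst_le (y - z)
      have h2 : |(y - z).2| ≤ ‖y - z‖ := by simpa using norm_snd_le (y - z)
      have hE := exp_pos s
      refine norm_prod_le_iff.2 ⟨?_, ?_⟩
      · simp only
        rw [norm_mul, norm_of_nonneg hE.le, norm_eq_abs, mul_assoc]
        apply mul_le_mul_of_nonneg_left _ hE.le
        refine h2.trans (le_mul_of_one_le_left (norm_nonneg _) ?_)
        have := abs_nonneg (p s); have := abs_nonneg (q s)
        have := abs_nonneg (r s); linarith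
      · simp only
        rw [norm_mul, norm_of_nonneg hE.le, norm_eq_abs, mul_assoc]
        apply mul_le_mul_of_nonneg_left _ hE.le
        refine (abs_add_le _ _).trans ?_
        rw [abs_mul, abs_mul]
        have h3 := mul_le_mul_of_nonneg_left h2 (abs_nonneg (p s))
        have h4 := mul_le_mul_of_nonneg_left h1 (abs_nonneg (q s))
        have h5 := mul_nonneg (abs_nonneg (r s)) (norm_nonneg (y - z))
        have h6 := norm_nonneg (y - z)
        linarith)
    (fun s => by
      have hE := exp_pos s
      have := abs_nonneg (p s); have := abs_nonneg (q s)
      have := abs_nonneg (r s)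
      refine norm_prod_le_iff.2 ⟨?_, ?_⟩
      · simp; positivity
      · simp only [Prod.fst_zero, Prod.snd_zero, mul_zero, zero_add]
        rw [norm_mul, norm_of_nonneg hE.le, norm_eq_abs]
        apply mul_le_mul_of_nonneg_left _ hE.le
        linarith) (c, d)
  refine ⟨fun x => (y (log x)).1, fun x => (y (log x)).2, by simp [y0], by simp [y0],
    fun x hx => ?_⟩
  have h1 := hy (log x)
  have hl := Real.hasDerivAt_log hx.ne'
  have h2 : HasDerivAt (fun s => (y s).1) _ (log x) := (ContinuousLinearMap.fst ℝ ℝ ℝ).hasFDerivAt.comp_hasDerivAt _ h1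
  have h3 : HasDerivAt (fun s => (y s).2) _ (log x) := (ContinuousLinearMap.snd ℝ ℝ ℝ).hasFDerivAt.comp_hasDerivAt _ h1
  constructor
  · refine (h2.comp x hl).congr_deriv ?_
    simp only [hp, hq, hr, ContinuousLinearMap.coe_fst', ContinuousLinearMap.coe_snd', exp_log hx]; field_simp
  · refine (h3.comp x hl).congr_deriv ?_
    simp only [hp, hq, hr, ContinuousLinearMap.coe_fst', ContinuousLinearMap.coe_snd', exp_log hx]; field_simp

end KPde


namespace KPde

/-- `u` solves the resolvent equation with right side `g` -/
structure Sol (D : Par) (h : ℝ) (g u u1 u2 : ℝ → ℝ) : Prop where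
  d1 : ∀ x : ℝ, 0 < x → HasDerivAt u (u1 x) x
  d2 : ∀ x : ℝ, 0 < x → HasDerivAt u1 (u2 x) x
  eq : ∀ x : ℝ, 0 < x → u x - h * (D.a 0 x * u2 x + D.b 0 x * u1 x) = g x

lemma Sol.comb {D : Par} {h c d : ℝ} {g u u1 u2 v v1 v2 w w1 w2 : ℝ → ℝ}
    (hu : Sol D h g u u1 u2) (hv : Sol D h (fun _ => 0) v v1 v2)
    (hw : Sol D h (fun _ => 0) w w1 w2) :
    Sol D h g (fun x => u x + c * v x + d * w x) (fun x => u1 x + c * v1 x + d * w1 x)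
      (fun x => u2 x + c * v2 x + d * w2 x) where
  d1 x hx := ((hu.d1 x hx).add ((hv.d1 x hx).const_mul c)).add ((hw.d1 x hx).const_mul d)
  d2 x hx := ((hu.d2 x hx).add ((hv.d2 x hx).const_mul c)).add ((hw.d2 x hx).const_mul d)
  eq x hx := by
    have h1 := hu.eq x hx
    have h2 := hv.eq x hx
    have h3 := hw.eq x hx
    linear_combination h1 + c * h2 + d * h3

lemma b_continuousOn (D : Par) (k : ℕ) (hk : k ≤ 4) : ContinuousOn (D.b k) (Ioi 0) := by
  rcases hk.lt_or_eq with h | h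
  · exact fun x hx => (D.hchain k h x hx).continuousAt.continuousWithinAt
  · rw [h]; exact D.hcont

lemma a_continuousOn (D : Par) (k : ℕ) : ContinuousOn (D.a k) (Ioi 0) :=
  fun _ hx => (D.a_hasDerivAt k hx).continuousAt.continuousWithinAt

lemma exists_sol_at (D : Par) {h : ℝ} (hh : 0 < h) {g : ℝ → ℝ} (hg : ContinuousOn g (Ioi 0))
    (c d : ℝ) : ∃ u u1 u2, Sol D h g u u1 u2 ∧ u 1 = c ∧ u1 1 = d := by
  have ha := a_continuousOn D 0
  have hb := b_continuousOn D 0 (by omega)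
  have hne : ∀ x ∈ Ioi (0 : ℝ), h * D.a 0 x ≠ 0 := fun x hx => (mul_pos hh (D.a_pos hx)).ne'
  obtain ⟨u, u1, h0, h1, h2⟩ := ode2 (fun x => -(D.b 0 x / D.a 0 x)) (fun x => 1 / (h * D.a 0 x))
    (fun x => -(g x / (h * D.a 0 x)))
    (hb.div ha fun x hx => (D.a_pos hx).ne').neg
    (continuousOn_const.div (continuousOn_const.mul ha) hne)
    (hg.div (continuousOn_const.mul ha) hne).neg c d
  refine ⟨u, u1, _, ⟨fun x hx => (h2 x hx).1, fun x hx => (h2 x hx).2, fun x hx => ?_⟩, h0, h1⟩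
  have := (D.a_pos hx).ne'
  field_simp
  ring

lemma sol_zero {D : Par} {h A B : ℝ} (hA : 0 < A) (hAB : A ≤ B) (hh : 0 < h) {u u1 u2 : ℝ → ℝ}
    (hu : Sol D h (fun _ => 0) u u1 u2) (huA : u A = 0) (huB : u B = 0) :
    ∀ x ∈ Icc A B, u x = 0 := by
  intro x hx
  have := scalar_bvp (D := D) (ω := 0) (h := h) (N := 0) hA hAB (F := fun _ => 1) (F1 := fun _ => 0)
    (F2 := fun _ => 0) (fun _ _ => one_pos) (fun x _ => hasDerivAt_const _ _)
    (fun x _ => hasDerivAt_const _ _) (fun x _ => by simp) hh (by simp) le_rfl hu.d1 hu.d2 hu.eq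
    (fun x _ => by simp) huA huB x hx
  simpa using this

lemma exists_bvp (D : Par) {h A B : ℝ} (hh : 0 < h) (hA : 0 < A) (hA1 : A < 1) (hB1 : 1 < B)
    {p v v1 v2 w w1 w2 : ℝ → ℝ} (hv : Sol D h (fun _ => 0) v v1 v2)
    (hw : Sol D h (fun _ => 0) w w1 w2) (ev : v 1 = 1) (ev1 : v1 1 = 0) (ew : w 1 = 0)
    (ew1 : w1 1 = 1) :
    ∃ c d : ℝ, p A + c * v A + d * w A = 0 ∧ p B + c * v B + d * w B = 0 := by
  let Λ : ℝ × ℝ →ₗ[ℝ] ℝ × ℝ :=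
    { toFun := fun z => (z.1 * v A + z.2 * w A, z.1 * v B + z.2 * w B)
      map_add' := fun y z => by ext <;> simp <;> ring
      map_smul' := fun r z => by ext <;> simp <;> ring }
  have hinj : Function.Injective Λ := by
    rw [← LinearMap.ker_eq_bot, LinearMap.ker_eq_bot']
    rintro ⟨c, d⟩ hz
    have h1 : c * v A + d * w A = 0 := congrArg Prod.fst hz
    have h2 : c * v B + d * w B = 0 := congrArg Prod.snd hz
    have hz0 : Sol D h (fun _ => 0) (fun _ => 0) (fun _ => 0) (fun _ => 0) :=
      ⟨fun x _ => hasDerivAt_const _ _, fun x _ => hasDerivAt_const _ _, fun x _ => by simp⟩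
    have hs := hz0.comb (c := c) (d := d) hv hw
    have h0 := sol_zero hA (hA1.trans hB1).le hh hs (by simpa using h1) (by simpa using h2)
    have hc : c = 0 := by
      have := h0 1 ⟨hA1.le, hB1.le⟩
      simpa [ev, ew] using this
    have hd : d = 0 := by
      have e1 := hs.d1 1 one_pos
      have e2 : HasDerivAt (fun x => 0 + c * v x + d * w x) 0 1 := by
        refine (hasDerivAt_const 1 (0 : ℝ)).congr_of_eventuallyEq ?_
        filter_upwards [Icc_mem_nhds hA1 hB1] with y hy using h0 y hy
      have := e1.unique e2
      simpa [ev1, ew1] using this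
    rw [hc, hd]; rfl
  obtain ⟨⟨c, d⟩, hcd⟩ := LinearMap.injective_iff_surjective.1 hinj (-p A, -p B)
  have h1 : c * v A + d * w A = -p A := congrArg Prod.fst hcd
  have h2 : c * v B + d * w B = -p B := congrArg Prod.snd hcd
  exact ⟨c, d, by linarith, by linarith⟩

/-- existence of a solution of the resolvent equation, controlled by the weight -/
lemma exists_sol (D : Par) {ω h N : ℝ} {F F1 F2 : ℝ → ℝ}
    (hF0 : ∀ x : ℝ, 0 < x → 0 < F x) (hF1 : ∀ x : ℝ, 0 < x → HasDerivAt F (F1 x) x)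
    (hF2 : ∀ x : ℝ, 0 < x → HasDerivAt F1 (F2 x) x)
    (hly : ∀ x : ℝ, 0 < x → D.a 0 x * F2 x + D.b 0 x * F1 x ≤ ω * F x)
    (hh : 0 < h) (hω : h * ω < 1) (hN : 0 ≤ N) {g : ℝ → ℝ} (hgc : ContinuousOn g (Ioi 0))
    (hg : ∀ x : ℝ, 0 < x → |g x| ≤ N * F x) :
    ∃ u u1 u2, Sol D h g u u1 u2 ∧ ∀ x : ℝ, 0 < x → |u x| ≤ N / (1 - h * ω) * F x := by
  set K := N / (1 - h * ω)
  obtain ⟨p, p1, p2, hp, -, -⟩ := exists_sol_at D hh hgc 0 0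
  obtain ⟨v, v1, v2, hv, ev, ev1⟩ := exists_sol_at D hh (continuousOn_const (c := (0 : ℝ))) 1 0
  obtain ⟨w, w1, w2, hw, ew, ew1⟩ := exists_sol_at D hh (continuousOn_const (c := (0 : ℝ))) 0 1
  have hw2 : w 2 ≠ 0 := by
    intro h2
    have h0 := sol_zero one_pos one_le_two hh hw ew h2
    have e1 := (hw.d1 1 one_pos).hasDerivWithinAt (s := Icc 1 2)
    have e2 : HasDerivWithinAt w 0 (Icc 1 2) 1 :=
      (hasDerivWithinAt_const 1 (Icc (1 : ℝ) 2) (0 : ℝ)).congr (fun y hy => h0 y hy) ew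
    have := (uniqueDiffOn_Icc one_lt_two 1 (by simp)).eq_deriv _ e1 e2
    rw [ew1] at this
    exact one_ne_zero this
  have hA : ∀ n : ℕ, (0 : ℝ) < ((n : ℝ) + 2)⁻¹ := fun n => by positivity
  have hA1 : ∀ n : ℕ, ((n : ℝ) + 2)⁻¹ < 1 := fun n => inv_lt_one_of_one_lt₀ (by
    have : (0 : ℝ) ≤ n := n.cast_nonneg
    linarith)
  have hB1 : ∀ n : ℕ, (1 : ℝ) < (n : ℝ) + 2 := fun n => by
    have : (0 : ℝ) ≤ n := n.cast_nonneg
    linarith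
  have hcd := fun n : ℕ => exists_bvp D (p := p) hh (hA n) (hA1 n) (hB1 n) hv hw ev ev1 ew ew1
  choose c d hc hd using hcd
  have hbd : ∀ n : ℕ, ∀ x ∈ Icc ((n : ℝ) + 2)⁻¹ ((n : ℝ) + 2),
      |p x + c n * v x + d n * w x| ≤ K * F x := fun n => by
    have hs := hp.comb (c := c n) (d := d n) hv hw
    exact scalar_bvp (hA n) ((hA1 n).trans (hB1 n)).le hF0 hF1 hF2 hly hh hω hN hs.d1 hs.d2 hs.eq
      hg (hc n) (hd n)
  set C1 := K * F 1 + |p 1| with hC1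
  set C2 := (K * F 2 + |p 2| + C1 * |v 2|) / |w 2| with hC2
  have hcb : ∀ n, |c n| ≤ C1 := fun n => by
    have h1 := hbd n 1 ⟨(hA1 n).le, (hB1 n).le⟩
    rw [ev, ew, mul_one, mul_zero, add_zero] at h1
    have h2 := abs_sub_abs_le_abs_sub (c n) (-p 1)
    rw [sub_neg_eq_add, abs_neg, add_comm (c n)] at h2
    linarith
  have hdb : ∀ n, |d n| ≤ C2 := fun n => by
    have h1 := hbd n 2 ⟨(hA1 n).le.trans one_le_two, by
      have : (0 : ℝ) ≤ n := n.cast_nonneg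
      linarith⟩
    rw [hC2, le_div_iff₀ (abs_pos.2 hw2), ← abs_mul]
    have h2 : d n * w 2 = (p 2 + c n * v 2 + d n * w 2) - p 2 - c n * v 2 := by ring
    rw [h2]
    have h3 := abs_sub (p 2 + c n * v 2 + d n * w 2 - p 2) (c n * v 2)
    have h4 := abs_sub (p 2 + c n * v 2 + d n * w 2) (p 2)
    rw [abs_mul] at h3
    have h5 := mul_le_mul_of_nonneg_right (hcb n) (abs_nonneg (v 2))
    linarith
  have hcomp : IsCompact (Icc (-C1) C1 ×ˢ Icc (-C2) C2) := isCompact_Icc.prod isCompact_Icc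
  obtain ⟨z, -, φ, hφ, hz⟩ := hcomp.tendsto_subseq (x := fun n => (c n, d n))
    (fun n => ⟨abs_le.1 (hcb n), abs_le.1 (hdb n)⟩)
  have hz1 := (continuous_fst.tendsto _).comp hz
  have hz2 := (continuous_snd.tendsto _).comp hz
  refine ⟨_, _, _, hp.comb (c := z.1) (d := z.2) hv hw, fun x hx => ?_⟩
  have hlim : Filter.Tendsto (fun n => |p x + c (φ n) * v x + d (φ n) * w x|) Filter.atTop
      (nhds |p x + z.1 * v x + z.2 * w x|) :=
    (((hz1.mul_const _).const_add _).add (hz2.mul_const _)).abs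
  refine le_of_tendsto hlim ?_
  obtain ⟨m, hm⟩ := exists_nat_ge (max x x⁻¹)
  filter_upwards [Filter.eventually_ge_atTop m] with n hn
  have h1 : (m : ℝ) ≤ φ n := by exact_mod_cast hn.trans (hφ.id_le n)
  have h2 := (le_max_left _ _).trans (hm.trans h1)
  have h3 := (le_max_right _ _).trans (hm.trans h1)
  apply hbd
  constructor
  · rw [inv_le_comm₀ (by positivity) hx]; linarith
  · linarith

end KPde


namespace KPde

/-- Landau type inequality -/
lemma landau {f f1 f2 : ℝ → ℝ} {x A B M : ℝ} (hA : 0 < A)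
    (h1 : ∀ y ∈ Icc x (x + 1 / (2 * A)), HasDerivAt f (f1 y) y)
    (h2 : ∀ y ∈ Icc x (x + 1 / (2 * A)), HasDerivAt f1 (f2 y) y)
    (hM : ∀ y ∈ Icc x (x + 1 / (2 * A)), |f y| ≤ M)
    (hB : ∀ y ∈ Icc x (x + 1 / (2 * A)), |f2 y| ≤ A * |f1 y| + B) :
    |f1 x| ≤ 8 * A * M + B / A := by
  set l := 1 / (2 * A) with hl
  have hl0 : 0 < l := by positivity
  have hne : (Icc x (x + l)).Nonempty := nonempty_Icc.2 (by linarith)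
  have hc1 : ContinuousOn f1 (Icc x (x + l)) := fun y hy => (h2 y hy).continuousAt.continuousWithinAt
  obtain ⟨c, hc, hmax⟩ := isCompact_Icc.exists_isMaxOn hne hc1.abs
  obtain ⟨ξ, hξ, hξe⟩ := exists_hasDerivAt_eq_slope f f1 (show x < x + l by linarith)
    (fun y hy => (h1 y hy).continuousAt.continuousWithinAt)
    (fun y hy => h1 y (Ioo_subset_Icc_self hy))
  have hξI := Ioo_subset_Icc_self hξ
  have hx : x ∈ Icc x (x + l) := ⟨le_rfl, by linarith⟩
  have hxl : x + l ∈ Icc x (x + l) := ⟨by linarith, le_rfl⟩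
  have e1 : |f1 ξ| ≤ 4 * A * M := by
    rw [hξe, abs_div, add_sub_cancel_left, abs_of_pos hl0, div_le_iff₀ hl0]
    have := abs_sub (f (x + l)) (f x)
    have e : 4 * A * M * l = 2 * M := by rw [hl]; field_simp; ring
    rw [e]
    linarith [hM _ hx, hM _ hxl]
  set m := |f1 c|
  have hm : ∀ y ∈ Icc x (x + l), |f1 y| ≤ m := fun y hy => hmax hy
  have e2 : |f1 c - f1 ξ| ≤ (A * m + B) * |c - ξ| := by
    have := (convex_Icc x (x + l)).norm_image_sub_le_of_norm_hasDerivWithin_le (f := f1) (f' := f2)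
      (C := A * m + B) (fun y hy => (h2 y hy).hasDerivWithinAt) (fun y hy => ?_) hξI hc
    · simpa using this
    · rw [norm_eq_abs]
      refine (hB y hy).trans ?_
      have := mul_le_mul_of_nonneg_left (hm y hy) hA.le
      linarith
  have hAB : 0 ≤ A * m + B := by
    refine (abs_nonneg _).trans ((hB c hc))
  have e3 : |c - ξ| ≤ l := by
    rw [abs_le]; constructor <;> linarith [hc.1, hc.2, hξI.1, hξI.2]
  have e4 : m ≤ |f1 c - f1 ξ| + |f1 ξ| := by
    have := abs_add_le (f1 c - f1 ξ) (f1 ξ)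
    rwa [sub_add_cancel] at this
  have e5 := mul_le_mul_of_nonneg_left e3 hAB
  have e6 : (A * m + B) * l = m / 2 + B / A / 2 := by rw [hl]; field_simp
  have := hm x hx
  linarith

/-- polynomial growth class -/
def Bd (p q : ℝ) (f : ℝ → ℝ) : Prop := ∃ C, 0 ≤ C ∧ ∀ x : ℝ, 0 < x → |f x| ≤ C * Wt p q x

lemma Bd.mono {p q p' q' : ℝ} {f : ℝ → ℝ} (h : Bd p q f) (hp0 : 0 ≤ p) (hq0 : 0 ≤ q) (hp : p ≤ p')
    (hq : q ≤ q') : Bd p' q' f := by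
  obtain ⟨C, hC, h⟩ := h
  refine ⟨C * 3, by positivity, fun x hx => (h x hx).trans ?_⟩
  rw [mul_assoc]
  exact mul_le_mul_of_nonneg_left (Wt_mono hx hp0 hq0 hp hq) hC

lemma Bd.add {p q : ℝ} {f g : ℝ → ℝ} (hf : Bd p q f) (hg : Bd p q g) :
    Bd p q (fun x => f x + g x) := by
  obtain ⟨C, hC, hf⟩ := hf
  obtain ⟨C', hC', hg⟩ := hg
  refine ⟨C + C', by positivity, fun x hx => (abs_add_le _ _).trans ?_⟩
  rw [add_mul]
  exact add_le_add (hf x hx) (hg x hx)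

lemma Bd.const_mul {p q : ℝ} {f : ℝ → ℝ} (c : ℝ) (hf : Bd p q f) : Bd p q (fun x => c * f x) := by
  obtain ⟨C, hC, hf⟩ := hf
  refine ⟨|c| * C, by positivity, fun x hx => ?_⟩
  rw [abs_mul, mul_assoc]
  exact mul_le_mul_of_nonneg_left (hf x hx) (abs_nonneg c)

lemma Bd.neg {p q : ℝ} {f : ℝ → ℝ} (hf : Bd p q f) : Bd p q (fun x => -f x) := by
  obtain ⟨C, hC, hf⟩ := hf
  exact ⟨C, hC, fun x hx => by rw [abs_neg]; exact hf x hx⟩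

lemma Bd.sub {p q : ℝ} {f g : ℝ → ℝ} (hf : Bd p q f) (hg : Bd p q g) :
    Bd p q (fun x => f x - g x) := by
  simpa [sub_eq_add_neg] using hf.add hg.neg

lemma Bd.mul {p q p' q' P Q : ℝ} {f g : ℝ → ℝ} (hf : Bd p q f) (hg : Bd p' q' g) (hp : 0 ≤ p)
    (hq : 0 ≤ q) (hp' : 0 ≤ p') (hq' : 0 ≤ q') (hP : p + p' ≤ P) (hQ : q + q' ≤ Q) :
    Bd P Q (fun x => f x * g x) := by
  obtain ⟨C, hC, hf⟩ := hf
  obtain ⟨C', hC', hg⟩ := hg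
  refine ⟨C * C' * 9, by positivity, fun x hx => ?_⟩
  rw [abs_mul]
  calc |f x| * |g x| ≤ (C * Wt p q x) * (C' * Wt p' q' x) :=
        mul_le_mul (hf x hx) (hg x hx) (abs_nonneg _) (mul_nonneg hC (Wt_pos hx).le)
    _ = C * C' * (Wt p q x * Wt p' q' x) := by ring
    _ ≤ C * C' * (9 * Wt P Q x) := by
        apply mul_le_mul_of_nonneg_left _ (by positivity)
        exact Wt_mul hx hp hq hp' hq' hP hQ
    _ = _ := by ring

lemma Bd.congr {p q : ℝ} {f g : ℝ → ℝ} (hf : Bd p q f) (h : ∀ x : ℝ, 0 < x → g x = f x) :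
    Bd p q g := by
  obtain ⟨C, hC, hf⟩ := hf
  exact ⟨C, hC, fun x hx => by rw [h x hx]; exact hf x hx⟩

lemma Bd.rpow {p q r : ℝ} (h1 : -q ≤ r) (h2 : r ≤ p) : Bd p q (fun x => x ^ r) :=
  ⟨1, zero_le_one, fun x hx => by
    rw [abs_of_pos (rpow_pos_of_pos hx _), one_mul]; exact rpow_le_Wt hx h1 h2⟩

lemma ainv_eq (D : Par) {x : ℝ} (hx : 0 < x) :
    1 / D.a 0 x = 2 / D.σ ^ 2 * x ^ (-(2 * D.α)) := by
  have := D.hσ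
  rw [D.a_zero, rpow_neg hx.le]
  have := rpow_pos_of_pos hx (2 * D.α)
  field_simp

lemma bd_ainv (D : Par) : Bd 0 (2 * D.α) (fun x => 1 / D.a 0 x) := by
  refine Bd.congr ((Bd.rpow (r := -(2 * D.α)) le_rfl ?_).const_mul (2 / D.σ ^ 2)) ?_
  · linarith [D.hα]
  · exact fun x hx => ainv_eq D hx

lemma bd_of_le_div (D : Par) {c : ℝ → ℝ} {C r : ℝ} (hr0 : 0 ≤ r) (hr : r ≤ 2 * D.α)
    (hC : 0 ≤ C) (hc : ∀ x : ℝ, 0 < x → |c x| ≤ C * (1 + x ^ r)) :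
    Bd 0 (2 * D.α) (fun x => c x / D.a 0 x) := by
  have hs : 0 < D.σ ^ 2 := by have := D.hσ; positivity
  refine ⟨C * (2 / D.σ ^ 2) * 2, by positivity, fun x hx => ?_⟩
  have h1 : c x / D.a 0 x = c x * (2 / D.σ ^ 2 * x ^ (-(2 * D.α))) := by
    rw [← ainv_eq D hx]; ring
  have hp := rpow_pos_of_pos hx (-(2 * D.α))
  beta_reduce
  rw [h1, abs_mul, abs_of_pos (show 0 < 2 / D.σ ^ 2 * x ^ (-(2 * D.α)) by positivity)]
  have h2 := mul_le_mul_of_nonneg_right (hc x hx)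
    (show 0 ≤ 2 / D.σ ^ 2 * x ^ (-(2 * D.α)) by positivity)
  refine h2.trans ?_
  have h3 : x ^ (-(2 * D.α)) ≤ Wt 0 (2 * D.α) x := rpow_le_Wt hx le_rfl (by linarith)
  have h4 : x ^ (r - 2 * D.α) ≤ Wt 0 (2 * D.α) x := rpow_le_Wt hx (by linarith) (by linarith)
  have h5 : x ^ r * x ^ (-(2 * D.α)) = x ^ (r - 2 * D.α) := by rw [← rpow_add hx]; rfl
  calc C * (1 + x ^ r) * (2 / D.σ ^ 2 * x ^ (-(2 * D.α)))
      = C * (2 / D.σ ^ 2) * (x ^ (-(2 * D.α)) + x ^ (r - 2 * D.α)) := by rw [← h5]; ring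
    _ ≤ C * (2 / D.σ ^ 2) * (Wt 0 (2 * D.α) x + Wt 0 (2 * D.α) x) := by gcongr
    _ = _ := by ring

lemma bd_b0 (D : Par) : Bd 0 (2 * D.α) (fun x => D.b 0 x / D.a 0 x) :=
  bd_of_le_div D (r := 2 * D.α - 1) (by linarith [D.hα]) (by linarith) (by linarith [D.hK]) D.habs

lemma bd_b1 (D : Par) : Bd 0 (2 * D.α) (fun x => D.b 1 x / D.a 0 x) :=
  bd_of_le_div D (r := 2 * D.α - 2) (by linarith [D.hα]) (by linarith) (by linarith [D.hK]) D.hb1abs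

lemma bd_a (D : Par) (k : ℕ) (hk : k ≤ 2) : Bd 0 (2 * D.α) (fun x => D.a k x / D.a 0 x) := by
  have hk' : (k : ℝ) ≤ 2 := by exact_mod_cast hk
  refine bd_of_le_div D (r := 2 * D.α - k)
    (C := |D.σ ^ 2 / 2 * (∏ i ∈ Finset.range k, (2 * D.α - i))|) (by linarith [D.hα])
    (by have : (0 : ℝ) ≤ k := k.cast_nonneg
        linarith) (abs_nonneg _) fun x hx => ?_
  rw [a_abs D k hx]
  exact mul_le_mul_of_nonneg_left (by linarith) (abs_nonneg _)

lemma Wt_double {p q x y : ℝ} (hp : 0 ≤ p) (hq : 0 ≤ q) (hx : 0 < x) (hxy : x ≤ y)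
    (hy : y ≤ 2 * x) : Wt p q y ≤ 2 ^ p * Wt p q x := by
  have hy0 : 0 < y := lt_of_lt_of_le hx hxy
  have h1 : y ^ p ≤ 2 ^ p * x ^ p := by
    rw [← mul_rpow (by norm_num) hx.le]; exact rpow_le_rpow hy0.le hy hp
  have h2 : y ^ (-q) ≤ x ^ (-q) := rpow_le_rpow_of_nonpos hx hxy (by linarith)
  have h3 : (1 : ℝ) ≤ 2 ^ p := one_le_rpow (by norm_num) hp
  have h4 := rpow_pos_of_pos hx (-q)
  unfold Wt
  nlinarith

lemma grad_crude {D : Par} {h : ℝ} (hh : 0 < h) {g u u1 u2 : ℝ → ℝ} (hu : Sol D h g u u1 u2)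
    {p q : ℝ} (hp : 0 ≤ p) (hq : 0 ≤ q) (bu : Bd p q u) (bg : Bd p q g) :
    Bd p (q + 2 * D.α) u1 := by
  obtain ⟨Cu, hCu, bu⟩ := bu
  obtain ⟨Cg, hCg, bg⟩ := bg
  have hK := D.hK
  have hα := D.hα
  have hs : 0 < D.σ ^ 2 := by have := D.hσ; positivity
  set c := 2 / D.σ ^ 2 with hc
  have hc0 : 0 < c := by positivity
  set C0 := c * D.K + 1 with hC0
  have hC01 : 1 ≤ C0 := by
    have : 0 ≤ c * D.K := by positivity
    linarith
  set E := (2 : ℝ) ^ p with hE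
  have hE0 : 0 < E := by positivity
  have hD1 : Bd p (q + 2 * D.α) (fun x => (C0 * (x ^ (-(2 * D.α)) + x ^ (-1 : ℝ))) * Wt p q x) := by
    refine Bd.mul (p := 0) (q := 2 * D.α) (p' := p) (q' := q) ?_ ?_ le_rfl (by linarith) hp hq
      (by linarith) (by linarith)
    · exact ((Bd.rpow le_rfl (by linarith)).add (Bd.rpow (by linarith) (by norm_num))).const_mul C0
    · exact ⟨1, zero_le_one, fun x hx => by rw [abs_of_pos (Wt_pos hx), one_mul]⟩
  obtain ⟨C1, hC1, hD1⟩ := hD1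
  refine ⟨8 * (E * Cu) * C1 + (Cu + Cg) / h * c * E * 3, by positivity, fun x hx => ?_⟩
  set A := C0 * (x ^ (-(2 * D.α)) + x ^ (-1 : ℝ)) with hA
  have hx1 := rpow_pos_of_pos hx (-(2 * D.α))
  have hx2 := rpow_pos_of_pos hx (-1 : ℝ)
  have hA0 : 0 < A := by positivity
  have hAx : 1 / (2 * A) ≤ x := by
    rw [div_le_iff₀ (by positivity)]
    have e : x * x ^ (-1 : ℝ) = 1 := by rw [rpow_neg_one]; field_simp
    have : 1 ≤ x * A := by
      calc (1 : ℝ) = x * x ^ (-1 : ℝ) := e.symm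
        _ ≤ x * A := by
          apply mul_le_mul_of_nonneg_left _ hx.le
          rw [hA]; nlinarith
    linarith
  have hW := Wt_pos (p := p) (q := q) hx
  have hin : ∀ y ∈ Icc x (x + 1 / (2 * A)), 0 < y ∧ y ≤ 2 * x := fun y hy =>
    ⟨lt_of_lt_of_le hx hy.1, by linarith [hy.2]⟩
  have hL := landau (f := u) (f1 := u1) (f2 := u2) (x := x) (A := A)
    (B := (Cu + Cg) / h * c * x ^ (-(2 * D.α)) * (E * Wt p q x)) (M := Cu * (E * Wt p q x)) hA0
    (fun y hy => hu.d1 y (hin y hy).1) (fun y hy => hu.d2 y (hin y hy).1)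
    (fun y hy => (bu y (hin y hy).1).trans
      (mul_le_mul_of_nonneg_left (Wt_double hp hq hx hy.1 (hin y hy).2) hCu))
    (fun y hy => by
      obtain ⟨hy0, hy2⟩ := hin y hy
      have ha := (D.a_pos hy0).ne'
      have heq := hu.eq y hy0
      have e : u2 y = (u y - g y) / h * (1 / D.a 0 y) - D.b 0 y * (1 / D.a 0 y) * u1 y := by
        field_simp
        linarith
      have hym := rpow_le_rpow_of_nonpos hx hy.1 (show -(2 * D.α) ≤ 0 by linarith)
      have hym1 := rpow_le_rpow_of_nonpos hx hy.1 (show (-1 : ℝ) ≤ 0 by norm_num)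
      have hyp := rpow_pos_of_pos hy0 (-(2 * D.α))
      have hdw := Wt_double hp hq hx hy.1 hy2
      have t1 : |(u y - g y) / h * (1 / D.a 0 y)| ≤
          (Cu + Cg) / h * c * x ^ (-(2 * D.α)) * (E * Wt p q x) := by
        have s1 : |u y - g y| ≤ (Cu + Cg) * (E * Wt p q x) := by
          have i1 := bu y hy0
          have i2 := bg y hy0
          have i3 := mul_le_mul_of_nonneg_left hdw hCu
          have i4 := mul_le_mul_of_nonneg_left hdw hCg
          have i5 := abs_sub (u y) (g y)
          rw [← hE] at i3 i4
          linarith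
        rw [ainv_eq D hy0, abs_mul, abs_div, abs_of_pos hh,
          abs_of_pos (show 0 < 2 / D.σ ^ 2 * y ^ (-(2 * D.α)) by positivity)]
        calc |u y - g y| / h * (c * y ^ (-(2 * D.α)))
            ≤ (Cu + Cg) * (E * Wt p q x) / h * (c * x ^ (-(2 * D.α))) := by gcongr
          _ = _ := by ring
      have t2 : |D.b 0 y * (1 / D.a 0 y) * u1 y| ≤ A * |u1 y| := by
        rw [abs_mul]
        apply mul_le_mul_of_nonneg_right _ (abs_nonneg _)
        rw [ainv_eq D hy0, abs_mul, abs_of_pos (show 0 < 2 / D.σ ^ 2 * y ^ (-(2 * D.α)) by positivity)]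
        have s2 := D.habs y hy0
        have s3 : y ^ (2 * D.α - 1) * y ^ (-(2 * D.α)) = y ^ (-1 : ℝ) := by
          rw [← rpow_add hy0]; congr 1; ring
        calc |D.b 0 y| * (c * y ^ (-(2 * D.α)))
            ≤ D.K * (1 + y ^ (2 * D.α - 1)) * (c * y ^ (-(2 * D.α))) := by gcongr
          _ = c * D.K * (y ^ (-(2 * D.α)) + y ^ (-1 : ℝ)) := by rw [← s3]; ring
          _ ≤ c * D.K * (x ^ (-(2 * D.α)) + x ^ (-1 : ℝ)) := by gcongr
          _ ≤ A := by
            rw [hA]; gcongr; linarith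
      rw [e]
      refine (abs_sub _ _).trans ?_
      linarith)
  refine hL.trans ?_
  have f1 : 8 * A * (Cu * (E * Wt p q x)) ≤ 8 * (E * Cu) * C1 * Wt p (q + 2 * D.α) x := by
    have := hD1 x hx
    rw [abs_of_pos (by positivity)] at this
    calc 8 * A * (Cu * (E * Wt p q x)) = 8 * (E * Cu) * (A * Wt p q x) := by ring
      _ ≤ 8 * (E * Cu) * (C1 * Wt p (q + 2 * D.α) x) := by gcongr
      _ = _ := by ring
  have f2 : (Cu + Cg) / h * c * x ^ (-(2 * D.α)) * (E * Wt p q x) / A ≤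
      (Cu + Cg) / h * c * E * 3 * Wt p (q + 2 * D.α) x := by
    rw [div_le_iff₀ hA0]
    have g1 : x ^ (-(2 * D.α)) ≤ A := by rw [hA]; nlinarith
    have g2 : Wt p q x ≤ 3 * Wt p (q + 2 * D.α) x := Wt_mono hx hp hq le_rfl (by linarith)
    calc (Cu + Cg) / h * c * x ^ (-(2 * D.α)) * (E * Wt p q x)
        ≤ (Cu + Cg) / h * c * A * (E * (3 * Wt p (q + 2 * D.α) x)) := by gcongr
      _ = _ := by ring
  rw [add_mul]
  exact add_le_add f1 f2

end KPde


namespace KPde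

lemma low_differentiableAt (D : Par) {U : ℕ → ℝ → ℝ} {k : ℕ} (hk : k < 4) {x : ℝ} (hx : 0 < x)
    (hU : ∀ j < k + 2, DifferentiableAt ℝ (U j) x) : DifferentiableAt ℝ (D.low k U) x := by
  have ha := fun i => (D.a_hasDerivAt i hx).differentiableAt
  have hb := fun i (hi : i < 4) => (D.hchain i hi x hx).differentiableAt
  interval_cases k
  · exact differentiableAt_const _
  · exact differentiableAt_const _
  · exact (hb 2 (by omega)).mul (hU 1 (by omega))
  · exact ((((hb 2 (by omega)).const_mul 3).add (ha 3)).mul (hU 2 (by omega))).add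
        ((hb 3 (by omega)).mul (hU 1 (by omega)))

lemma sol_chain {D : Par} {h : ℝ} (hh : 0 < h) {g : ℕ → ℝ → ℝ} (hg : Chain 4 g)
    {u u1 u2 : ℝ → ℝ} (hu : Sol D h (g 0) u u1 u2) :
    Chain 6 (fun j => deriv^[j] u) ∧
    ∀ k ≤ 4, ∀ x : ℝ, 0 < x → deriv^[k] u x - h * D.Lk k (fun j => deriv^[j] u) x = g k x := by
  set U : ℕ → ℝ → ℝ := fun j => deriv^[j] u with hU
  have hsucc : ∀ j, U (j + 1) = deriv (U j) := fun j => by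
    rw [hU]; simp only [Function.iterate_succ', Function.comp_apply]
  have e1 : ∀ x : ℝ, 0 < x → U 1 x = u1 x := fun x hx => (hu.d1 x hx).deriv
  have e1' : ∀ x : ℝ, 0 < x → U 1 =ᶠ[nhds x] u1 := fun x hx => ev_pos hx e1
  have e2 : ∀ x : ℝ, 0 < x → U 2 x = u2 x := fun x hx => by
    rw [hsucc 1, (e1' x hx).deriv_eq]; exact (hu.d2 x hx).deriv
  have key : ∀ k ≤ 4, Chain (k + 2) U ∧
      ∀ x : ℝ, 0 < x → U k x - h * D.Lk k U x = g k x := by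
    intro k
    induction k with
    | zero =>
      intro _
      refine ⟨fun j hj x hx => ?_, fun x hx => ?_⟩
      · interval_cases j
        · rw [e1 x hx]; exact hu.d1 x hx
        · have : U (1 + 1) x = u2 x := e2 x hx
          rw [this]; exact (hu.d2 x hx).congr_of_eventuallyEq (e1' x hx)
      · rw [Lk_zero, e1 x hx, e2 x hx]; exact hu.eq x hx
    | succ k ih =>
      intro hk
      obtain ⟨hc, he⟩ := ih (by omega)
      have hdiff : ∀ x : ℝ, 0 < x → DifferentiableAt ℝ (U (k + 2)) x := by
        intro x hx
        have ha := fun i => (D.a_hasDerivAt i hx).differentiableAt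
        have hb := fun i (hi : i < 4) => (D.hchain i hi x hx).differentiableAt
        have hUd := fun j (hj : j < k + 2) => (hc j hj x hx).differentiableAt
        have hf : U (k + 2) =ᶠ[nhds x] fun y => ((U k y - g k y) / h
            - ((D.b 0 y + k * D.a 1 y) * U (k + 1) y
            + (k * D.b 1 y + (k.choose 2 : ℕ) * D.a 2 y) * U k y + D.low k U y)) / D.a 0 y := by
          refine ev_pos hx fun y hy => ?_
          have h1 := he y hy
          have h2 := (D.a_pos hy).ne'
          unfold Par.Lk at h1
          field_simp
          linarith
        refine DifferentiableAt.congr_of_eventuallyEq ?_ hf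
        have d1 : DifferentiableAt ℝ (fun y => (U k y - g k y) / h) x :=
          ((hUd k (by omega)).sub (hg k (by omega) x hx).differentiableAt).div_const h
        have d2 := ((hb 0 (by omega)).add ((ha 1).const_mul (k : ℝ))).mul (hUd (k + 1) (by omega))
        have d3 := (((hb 1 (by omega)).const_mul (k : ℝ)).add
          ((ha 2).const_mul ((k.choose 2 : ℕ) : ℝ))).mul (hUd k (by omega))
        have d4 := low_differentiableAt D (k := k) (by omega) hx hUd
        exact (d1.sub ((d2.add d3).add d4)).div (ha 0) (D.a_pos hx).ne'
      have hc' : Chain (k + 1 + 2) U := by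
        intro j hj x hx
        rcases Nat.lt_succ_iff_lt_or_eq.1 hj with h1 | h1
        · exact hc j h1 x hx
        · have h3 := (hdiff x hx).hasDerivAt
          rw [← hsucc] at h3
          rw [h1]
          exact h3
      refine ⟨hc', fun x hx => ?_⟩
      have hL := Lk_hasDerivAt D (u := U) (k := k) (by omega) hx
        (fun j hj => hc' j (by omega) x hx)
      have h1 := (hc' k (by omega) x hx).sub (hL.const_mul h)
      have h2 : HasDerivAt (fun y => U k y - h * D.Lk k U y) (g (k + 1) x) x :=
        (hg k (by omega) x hx).congr_of_eventuallyEq (ev_pos hx he)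
      exact h1.unique h2
  exact ⟨(key 4 le_rfl).1, fun k hk => (key k hk).2⟩

lemma crude {D : Par} {h : ℝ} (hh : 0 < h) {u g : ℕ → ℝ → ℝ} (hu : Chain 6 u)
    (heq : ∀ k ≤ 4, ∀ x : ℝ, 0 < x → u k x - h * D.Lk k u x = g k x) {p q : ℝ} (hp : 0 ≤ p)
    (hq : 0 ≤ q) (bu : Bd p q (u 0)) (bg0 : Bd p q (g 0)) (bg1 : Bd p q (g 1))
    (bg2 : Bd (D.g2 + p) q (g 2)) :
    (∀ k ≤ 3, Bd p (q + 8 * D.α + D.c2) (u k)) ∧ Bd (D.g2 + p) (q + 8 * D.α + D.c2) (u 4) := by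
  have hα := D.hα
  have hg2 := D.hg2
  have hc2 := D.hc2
  have hs : Sol D h (g 0) (u 0) (u 1) (u 2) := ⟨hu 0 (by omega), hu 1 (by omega), fun x hx => by
    rw [← Lk_zero]; exact heq 0 (by omega) x hx⟩
  have b1 : Bd p (q + 2 * D.α) (u 1) := grad_crude hh hs hp hq bu bg0
  -- scaled products
  have mulA : ∀ {c f : ℝ → ℝ} {P Q : ℝ}, 0 ≤ P → 0 ≤ Q → Bd 0 (2 * D.α) c → Bd P Q f →
      Bd P (Q + 2 * D.α) (fun x => c x * f x) := fun hP hQ hc hf =>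
    hc.mul hf le_rfl (by linarith) hP hQ (by linarith) (by linarith)
  have hai := bd_ainv D
  have hb0 := bd_b0 D
  have hb1 := bd_b1 D
  have ha1 := bd_a D 1 (by omega)
  have ha2 := bd_a D 2 (by omega)
  have b2 : Bd p (q + 4 * D.α) (u 2) := by
    have t1 := mulA hp hq hai ((bu.sub bg0).const_mul (1 / h))
    have t2 := mulA hp (by linarith) hb0 b1
    refine Bd.congr ((t1.mono hp (by linarith) le_rfl (q' := q + 4 * D.α) (by linarith)).sub
      (t2.mono hp (by linarith) le_rfl (by linarith))) fun x hx => ?_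
    have h1 := heq 0 (by omega) x hx
    rw [Lk_zero] at h1
    have h2 := (D.a_pos hx).ne'
    field_simp
    linarith
  have b3 : Bd p (q + 6 * D.α) (u 3) := by
    have t1 := mulA hp (by linarith) hai ((b1.sub (bg1.mono hp hq le_rfl
      (q' := q + 2 * D.α) (by linarith))).const_mul (1 / h))
    have t2 := mulA hp (by linarith) (hb0.add ha1) b2
    have t3 := mulA hp (by linarith) hb1 b1
    refine Bd.congr (((t1.mono hp (by linarith) le_rfl (q' := q + 6 * D.α) (by linarith)).sub
      (t2.mono hp (by linarith) le_rfl (by linarith))).sub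
      (t3.mono hp (by linarith) le_rfl (by linarith))) fun x hx => ?_
    have h1 := heq 1 (by omega) x hx
    simp [Par.Lk, Par.low] at h1
    have h2 := (D.a_pos hx).ne'
    field_simp
    linarith
  have b4 : Bd (D.g2 + p) (q + 8 * D.α + D.c2) (u 4) := by
    have t1 := mulA (by linarith) (by linarith) hai (((b2.mono (p' := D.g2 + p) hp (by linarith)
      (by linarith) le_rfl).sub (bg2.mono (by linarith) hq le_rfl
      (q' := q + 4 * D.α) (by linarith))).const_mul (1 / h))
    have t2 := mulA hp (by linarith) (hb0.add (ha1.const_mul 2)) b3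
    have t3 := mulA hp (by linarith) ((hb1.const_mul 2).add ha2) b2
    have hb2 : Bd D.g2 D.c2 (D.b 2) := ⟨D.K, by linarith [D.hK], D.hb2abs⟩
    have t4 := mulA (by linarith) (by linarith) hai (hb2.mul b1 hg2 hc2 hp (by linarith) le_rfl le_rfl)
    refine Bd.congr ((((t1.mono (by linarith) (by linarith) le_rfl
      (q' := q + 8 * D.α + D.c2) (by linarith)).sub
      (t2.mono hp (by linarith) (by linarith) (by linarith))).sub
      (t3.mono hp (by linarith) (by linarith) (by linarith))).sub
      (t4.mono (by linarith) (by linarith) le_rfl (by linarith))) fun x hx => ?_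
    have h1 := heq 2 (by omega) x hx
    simp [Par.Lk, Par.low] at h1
    have h2 := (D.a_pos hx).ne'
    field_simp
    linarith
  refine ⟨fun k hk => ?_, b4⟩
  interval_cases k
  · exact bu.mono hp hq le_rfl (by linarith)
  · exact b1.mono hp (by linarith) le_rfl (by linarith)
  · exact b2.mono hp (by linarith) le_rfl (by linarith)
  · exact b3.mono hp (by linarith) le_rfl (by linarith)

end KPde

namespace KPde

/-- the three weight families used -/
structure Wts (D : Par) where
  (PX QX PY QY PZ QZ : ℕ → ℝ)
  (δ q ω : ℝ)
  hω : 0 ≤ ω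
  gX : Good D ω (fun k => Wt (PX k) (QX k)) (fun k => Wt1 (PX k) (QX k)) (fun k => Wt2 (PX k) (QX k))
  gY : Good D ω (fun k => Wt (PY k) (QY k)) (fun k => Wt1 (PY k) (QY k)) (fun k => Wt2 (PY k) (QY k))
  gZ : Good D ω (fun k => Wt (PZ k) (QZ k)) (fun k => Wt1 (PZ k) (QZ k)) (fun k => Wt2 (PZ k) (QZ k))
  hly : ∀ x : ℝ, 0 < x →
    D.a 0 x * Wt2 (2 * D.α) 0 x + D.b 0 x * Wt1 (2 * D.α) 0 x ≤ ω * Wt (2 * D.α) 0 x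
  hδ : 0 < δ
  hPY0 : PY 0 = δ
  hPY1 : PY 1 = δ
  hPY2 : PY 2 = D.g2 + δ
  hPY : ∀ k, δ ≤ PY k
  hQY : ∀ k : ℕ, (k : ℝ) + 1 ≤ QY k
  hq : ∀ k ≤ 2, QY k ≤ q
  hPZ : ∀ k ≤ 3, δ < PZ k
  hPZ4 : D.g2 + δ < PZ 4
  hQZ : ∀ k ≤ 4, q + 8 * D.α + D.c2 < QZ k

namespace Wts
variable {D : Par} (W : Wts D)

/-- weights of the Banach space -/
noncomputable def V (k : ℕ) (x : ℝ) : ℝ := Wt (W.PY k) (W.QY k) x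

lemma V_pos {k : ℕ} {x : ℝ} (hx : 0 < x) : 0 < W.V k x := Wt_pos hx

lemma lyap0 {F F1 F2 : ℕ → ℝ → ℝ} {ω : ℝ} (h : Good D ω F F1 F2) (x : ℝ) (hx : 0 < x) :
    D.a 0 x * F2 0 x + D.b 0 x * F1 0 x ≤ ω * F 0 x := by
  have := h.ly 0 (by omega) x hx
  simpa [Par.lyap, Par.src] using this

lemma uniq {h : ℝ} (hh : 0 < h) (hω : h * W.ω < 1) {u u1 u2 : ℝ → ℝ} {C : ℝ}
    (hu : Sol D h (fun _ => 0) u u1 u2) (hC : ∀ x : ℝ, 0 < x → |u x| ≤ C * W.V 0 x) :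
    ∀ x : ℝ, 0 < x → u x = 0 := by
  intro x hx
  have hq := W.hq 0 (by omega)
  have hQ := W.hQY 0
  have hQZ := W.hQZ 0 (by omega)
  have hα := D.hα
  have hc := D.hc2
  push_cast at hQ
  have h1 := scalar_two (D := D) (N := 0) (W.gY.pos 0 (by omega)) (W.gY.d1 0 (by omega))
    (W.gY.d2 0 (by omega)) (lyap0 W.gY) (lyap0 W.gZ)
    (p := W.PY 0) (q := W.QY 0) (by rw [W.hPY0]; exact W.hδ.le) (by linarith)
    (by rw [W.hPY0]; exact W.hPZ 0 (by omega)) (by linarith) hh hω le_rfl hu.d1 hu.d2 hu.eq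
    (fun y hy => by simp) hC x hx
  simpa using h1

theorem resolvent {h N : ℝ} (hh : 0 < h) (hω : h * W.ω < 1) (hN : 0 ≤ N) {g : ℕ → ℝ → ℝ}
    (hg : Chain 4 g) (hgN : ∀ k ≤ 4, ∀ x : ℝ, 0 < x → |g k x| ≤ N * W.V k x) :
    ∃ u : ℕ → ℝ → ℝ, Chain 6 u ∧
      (∀ x : ℝ, 0 < x → u 0 x - h * (D.a 0 x * u 2 x + D.b 0 x * u 1 x) = g 0 x) ∧
      (∀ k ≤ 4, ∀ x : ℝ, 0 < x → |u k x| ≤ N / (1 - h * W.ω) * W.V k x) ∧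
      (∀ M, 0 ≤ M → (∀ k ≤ 4, ∀ x : ℝ, 0 < x → |g k x| ≤ M * Wt (W.PX k) (W.QX k) x) →
        ∀ k ≤ 4, ∀ x : ℝ, 0 < x → |u k x| ≤ M / (1 - h * W.ω) * Wt (W.PX k) (W.QX k) x) ∧
      (∀ M, 0 ≤ M → (∀ x : ℝ, 0 < x → |D.a 0 x * g 2 x + D.b 0 x * g 1 x| ≤ M * Wt (2 * D.α) 0 x) →
        ∀ x : ℝ, 0 < x →
          |D.a 0 x * u 2 x + D.b 0 x * u 1 x| ≤ M / (1 - h * W.ω) * Wt (2 * D.α) 0 x) := by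
  have hα := D.hα
  have hc := D.hc2
  have hg2 := D.hg2
  have hδ := W.hδ
  have h1ω : 0 < 1 - h * W.ω := by linarith
  have hQ : ∀ k, 0 ≤ W.QY k := fun k => by
    have := W.hQY k
    have := Nat.cast_nonneg (α := ℝ) k
    linarith
  obtain ⟨v, v1, v2, hv, hvb⟩ := exists_sol D (W.gY.pos 0 (by omega)) (W.gY.d1 0 (by omega))
    (W.gY.d2 0 (by omega)) (lyap0 W.gY) hh hω hN (hg.continuousOn (k := 0) (by omega))
    (hgN 0 (by omega))
  obtain ⟨hu, heq⟩ := sol_chain hh hg hv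
  set u : ℕ → ℝ → ℝ := fun j => deriv^[j] v with hudef
  have hK : 0 ≤ N / (1 - h * W.ω) := by positivity
  have hq0 : 0 ≤ W.q := (hQ 0).trans (W.hq 0 (by omega))
  have bg : ∀ k ≤ 2, Bd (W.PY k) W.q (g k) := fun k hk =>
    Bd.mono (p := W.PY k) (q := W.QY k) ⟨N, hN, hgN k (by omega)⟩ (hδ.le.trans (W.hPY k)) (hQ k)
      le_rfl (W.hq k hk)
  have bu : Bd W.δ W.q (u 0) := by
    rw [← W.hPY0]
    exact Bd.mono (p := W.PY 0) (q := W.QY 0) ⟨_, hK, hvb⟩ (hδ.le.trans (W.hPY 0)) (hQ 0)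
      le_rfl (W.hq 0 (by omega))
  have b0 := bg 0 (by omega)
  have b1 := bg 1 (by omega)
  have b2 := bg 2 (by omega)
  rw [W.hPY0] at b0
  rw [W.hPY1] at b1
  rw [W.hPY2] at b2
  obtain ⟨c3, c4⟩ := crude hh hu heq hδ.le hq0 bu b0 b1 b2
  set p : ℕ → ℝ := fun k => if k ≤ 3 then W.δ else D.g2 + W.δ with hp
  have hcr : ∀ k ≤ 4, Bd (p k) (W.q + 8 * D.α + D.c2) (u k) := by
    intro k hk
    by_cases h3 : k ≤ 3
    · simp only [hp, h3, if_true]; exact c3 k h3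
    · have : k = 4 := by omega
      subst this; simpa [hp] using c4
  have hcrude : ∃ C, ∀ k ≤ 4, ∀ x : ℝ, 0 < x → |u k x| ≤ C * Wt (p k) (W.q + 8 * D.α + D.c2) x := by
    choose! C hC0 hC using hcr
    refine ⟨∑ k ∈ Finset.range 5, |C k|, fun k hk x hx => (hC k hk x hx).trans ?_⟩
    refine mul_le_mul_of_nonneg_right ?_ (Wt_pos hx).le
    exact (le_abs_self _).trans (Finset.single_le_sum (f := fun k => |C k|)
      (fun _ _ => abs_nonneg _) (Finset.mem_range.2 (by omega)))
  obtain ⟨C, hC⟩ := hcrude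
  have hp0 : ∀ k ≤ 4, 0 ≤ p k := fun k _ => by
    simp only [hp]; split_ifs <;> linarith
  have hpZ : ∀ k ≤ 4, p k < W.PZ k := fun k hk => by
    simp only [hp]; split_ifs with h3
    · exact W.hPZ k h3
    · have : k = 4 := by omega
      subst this; exact W.hPZ4
  have cpl : ∀ {F F1 F2 : ℕ → ℝ → ℝ} (hF : Good D W.ω F F1 F2) (M : ℝ), 0 ≤ M →
      (∀ k ≤ 4, ∀ x : ℝ, 0 < x → |g k x| ≤ M * F k x) →
      ∀ k ≤ 4, ∀ x : ℝ, 0 < x → |u k x| ≤ M / (1 - h * W.ω) * F k x := fun hF M hM hgM =>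
    coupled hF W.gZ hp0 (q := fun _ => W.q + 8 * D.α + D.c2) (fun k _ => by positivity) hpZ
      (fun k hk => W.hQZ k hk) hh hω hM hu heq hgM hC
  have heq0 : ∀ x : ℝ, 0 < x → u 0 x - h * (D.a 0 x * u 2 x + D.b 0 x * u 1 x) = g 0 x :=
    fun x hx => by rw [← Lk_zero]; exact heq 0 (by omega) x hx
  have huY := cpl W.gY N hN hgN
  refine ⟨u, hu, heq0, huY, fun M hM hgM => cpl W.gX M hM hgM, fun M hM hgM => ?_⟩
  set w : ℕ → ℝ → ℝ := fun k x => (u k x - g k x) / h with hw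
  have hwd : ∀ k < 4, ∀ x : ℝ, 0 < x → HasDerivAt (w k) (w (k + 1) x) x := fun k hk x hx =>
    ((hu k (by omega) x hx).sub (hg k hk x hx)).div_const h
  have hw0 : ∀ x : ℝ, 0 < x → w 0 x = D.a 0 x * u 2 x + D.b 0 x * u 1 x := fun x hx => by
    simp only [hw]
    rw [← heq0 x hx]; field_simp; ring
  have hweq : ∀ x : ℝ, 0 < x → w 0 x - h * (D.a 0 x * w 2 x + D.b 0 x * w 1 x)
      = D.a 0 x * g 2 x + D.b 0 x * g 1 x := fun x hx => by
    rw [hw0 x hx]; simp only [hw]; field_simp; ring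
  have hwb : ∀ x : ℝ, 0 < x → |w 0 x| ≤ (N / (1 - h * W.ω) + N) / h * Wt (W.PY 0) (W.QY 0) x := by
    intro x hx
    simp only [hw]
    rw [abs_div, abs_of_pos hh, div_mul_eq_mul_div, add_mul]
    have h1 := huY 0 (by omega) x hx
    have h2 := hgN 0 (by omega) x hx
    exact div_le_div_of_nonneg_right ((abs_sub _ _).trans (add_le_add h1 h2)) hh.le
  have hQ0 := hQ 0
  have hq' := W.hq 0 (by omega)
  have hQZ := W.hQZ 0 (by omega)
  have hfin := scalar_two (D := D) (F := Wt (2 * D.α) 0) (fun x hx => Wt_pos hx)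
    (fun x hx => Wt_hasDerivAt _ _ hx)
    (fun x hx => Wt1_hasDerivAt _ _ hx) W.hly (lyap0 W.gZ)
    (p := W.PY 0) (q := W.QY 0) (by rw [W.hPY0]; exact W.hδ.le) (by linarith)
    (by rw [W.hPY0]; exact W.hPZ 0 (by omega)) (by linarith) hh hω hM (hwd 0 (by omega))
    (hwd 1 (by omega)) hweq hgM hwb
  intro x hx
  rw [← hw0 x hx]
  exact hfin x hx

end Wts
end KPde

namespace KPde

section HY
variable {E : Type*} [NormedAddCommGroup E] [NormedSpace ℝ E] [CompleteSpace E]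
variable {F : Type*} [NormedAddCommGroup F] [NormedSpace ℝ F]

lemma exp_fun_bound (R : E →L[ℝ] E) (ℓ : E →L[ℝ] F) (f : E) {c ρ s : ℝ} (hs : 0 ≤ s)
    (h : ∀ n : ℕ, ‖ℓ ((R ^ n) f)‖ ≤ c * ρ ^ n) :
    ‖ℓ (NormedSpace.exp (s • R) f)‖ ≤ c * Real.exp (s * ρ) := by
  have h1 : HasSum (fun n : ℕ => ((n.factorial : ℝ)⁻¹) • (s • R) ^ n) (NormedSpace.exp (s • R)) :=
    NormedSpace.exp_series_hasSum_exp' (𝕂 := ℝ) (s • R)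
  have h2 : HasSum (fun n : ℕ => ℓ ((((n.factorial : ℝ)⁻¹) • (s • R) ^ n) f))
      (ℓ (NormedSpace.exp (s • R) f)) :=
    (h1.mapL (ContinuousLinearMap.apply ℝ E f)).mapL ℓ
  have h3 : HasSum (fun n : ℕ => (s * ρ) ^ n / n.factorial) (Real.exp (s * ρ)) := by
    rw [Real.exp_eq_exp_ℝ]
    exact NormedSpace.expSeries_div_hasSum_exp (s * ρ)
  have h4 := h3.mul_left c
  refine h2.norm_le_of_bounded h4 fun n => ?_
  have e : ℓ ((((n.factorial : ℝ)⁻¹) • (s • R) ^ n) f)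
      = ((n.factorial : ℝ)⁻¹ * s ^ n) • ℓ ((R ^ n) f) := by
    rw [smul_pow]; simp [smul_smul]
  rw [e, norm_smul, Real.norm_of_nonneg (by positivity)]
  calc _ ≤ ((n.factorial : ℝ)⁻¹ * s ^ n) * (c * ρ ^ n) :=
        mul_le_mul_of_nonneg_left (h n) (by positivity)
    _ = _ := by rw [mul_pow]; ring

/-- resolvent data -/
structure HYData (E : Type*) [NormedAddCommGroup E] [NormedSpace ℝ E] where
  R : ℕ → E →L[ℝ] E
  lam : ℕ → ℝ
  ω : ℝ
  hω : 0 ≤ ω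
  hlam : ∀ n, 2 * ω + 1 ≤ lam n
  htend : Filter.Tendsto lam Filter.atTop Filter.atTop
  hR : ∀ n, ‖R n‖ ≤ 1 / (lam n - ω)
  hres : ∀ n m, R n - R m = (lam m - lam n) • (R n * R m)

namespace HYData
variable (H : HYData E)

noncomputable def J (n : ℕ) : E →L[ℝ] E := H.lam n • H.R n

noncomputable def A (n : ℕ) : E →L[ℝ] E := H.lam n • (H.J n - 1)

noncomputable def S (n : ℕ) (t : ℝ) : E →L[ℝ] E := NormedSpace.exp (t • H.A n)

lemma R_comm (n m : ℕ) : H.R n * H.R m = H.R m * H.R n := by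
  have h1 := H.hres n m
  have h2 := H.hres m n
  by_cases h : H.lam n = H.lam m
  · rw [h, sub_self, zero_smul, sub_eq_zero] at h1
    rw [h1]
  · have h3 : (H.lam m - H.lam n) • (H.R n * H.R m) = (H.lam m - H.lam n) • (H.R m * H.R n) := by
      rw [← h1, ← neg_sub (H.R m), h2, ← neg_smul, neg_sub]
    exact smul_right_injective _ (sub_ne_zero.2 (Ne.symm h)) h3

lemma J_comm (n m : ℕ) : H.J n * H.J m = H.J m * H.J n := by
  simp only [J, smul_mul_assoc, mul_smul_comm, H.R_comm n m]
  rw [smul_comm]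

lemma A_comm (n m : ℕ) : Commute (H.A n) (H.A m) := by
  have h : Commute (H.J n) (H.J m) := H.J_comm n m
  have h2 : Commute (H.J n - 1) (H.J m - 1) :=
    (h.sub_left (Commute.one_left _)).sub_right ((Commute.one_right _))
  exact (h2.smul_left _).smul_right _

lemma J_A_comm (n : ℕ) : Commute (H.J n) (H.A n) :=
  (((Commute.refl _).sub_right (Commute.one_right _)).smul_right _)

lemma A_J (n m : ℕ) : H.A n * H.J m = H.J n * H.A m := by
  have h := H.hres n m
  have h2 : (H.lam n • H.R n - 1) * H.R m = H.R n * (H.lam m • H.R m - 1) := by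
    rw [sub_mul, mul_sub, smul_mul_assoc, mul_smul_comm, one_mul, mul_one]
    linear_combination (norm := module) h
  simp only [A, J, smul_mul_assoc, mul_smul_comm] at h2 ⊢
  rw [h2, smul_comm]

lemma S_bound (ℓ : E →L[ℝ] F) (f : E) {c t : ℝ} (hc : 0 ≤ c) (ht : 0 ≤ t) (n : ℕ)
    (h : ∀ j : ℕ, ‖ℓ ((H.R n ^ j) f)‖ ≤ c * (1 / (H.lam n - H.ω)) ^ j) :
    ‖ℓ (H.S n t f)‖ ≤ c * Real.exp (2 * H.ω * t) := by
  have hω := H.hω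
  have hl := H.hlam n
  have e1 : H.S n t = Real.exp (-(t * H.lam n)) • NormedSpace.exp ((t * H.lam n ^ 2) • H.R n) := by
    have e2 : t • H.A n = (t * H.lam n ^ 2) • H.R n + algebraMap ℝ (E →L[ℝ] E) (-(t * H.lam n)) := by
      rw [Algebra.algebraMap_eq_smul_one]
      simp only [A, J]
      module
    let _ : NormedAlgebra ℚ (E →L[ℝ] E) := NormedAlgebra.restrictScalars ℚ ℝ _
    rw [S, e2, NormedSpace.exp_add_of_commute (Algebra.commutes' _ _).symm]
    rw [← NormedSpace.algebraMap_exp_comm, ← Real.exp_eq_exp_ℝ, Algebra.algebraMap_eq_smul_one]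
    simp
  have h1 := exp_fun_bound (H.R n) ℓ f (s := t * H.lam n ^ 2) (by positivity) h
  rw [e1]
  simp only [_root_.smul_apply, map_smul, norm_smul, Real.norm_eq_abs, Real.abs_exp]
  calc _ ≤ Real.exp (-(t * H.lam n)) * (c * Real.exp (t * H.lam n ^ 2 * (1 / (H.lam n - H.ω)))) :=
        mul_le_mul_of_nonneg_left h1 (Real.exp_pos _).le
    _ = c * Real.exp (-(t * H.lam n) + t * H.lam n ^ 2 * (1 / (H.lam n - H.ω))) := by
        rw [Real.exp_add]; ring
    _ ≤ _ := by
        refine mul_le_mul_of_nonneg_left (Real.exp_le_exp.2 ?_) hc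
        have hp : 0 < H.lam n - H.ω := by linarith
        have : -(t * H.lam n) + t * H.lam n ^ 2 * (1 / (H.lam n - H.ω))
          = t * H.ω * (H.lam n / (H.lam n - H.ω)) := by field_simp; ring
        rw [this]
        have h5 : H.lam n / (H.lam n - H.ω) ≤ 2 := by rw [div_le_iff₀ hp]; linarith
        have h6 : 0 ≤ t * H.ω := by positivity
        nlinarith

lemma S_norm (n : ℕ) {t : ℝ} (ht : 0 ≤ t) (f : E) : ‖H.S n t f‖ ≤ Real.exp (2 * H.ω * t) * ‖f‖ := by
  rw [mul_comm]
  have hp : 0 < H.lam n - H.ω := by linarith [H.hlam n, H.hω]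
  refine H.S_bound (ContinuousLinearMap.id ℝ E) f (norm_nonneg _) ht n fun j => ?_
  induction j with
  | zero => simp
  | succ j ih =>
    rw [pow_succ', ContinuousLinearMap.id_apply]
    refine ((H.R n).le_opNorm _).trans ?_
    refine (mul_le_mul (H.hR n) ih (norm_nonneg _) (by positivity)).trans (le_of_eq ?_)
    ring

lemma S_hasDerivAt (n : ℕ) (t : ℝ) (f : E) :
    HasDerivAt (fun t => H.S n t f) (H.S n t (H.A n f)) t := by
  have h := hasDerivAt_exp_smul_const (𝕂 := ℝ) (H.A n) t
  exact (ContinuousLinearMap.apply ℝ E f).hasFDerivAt.comp_hasDerivAt t h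

lemma S_diff (n m : ℕ) {t T : ℝ} (ht : 0 ≤ t) (hT : t ≤ T) (g : E) :
    ‖H.S n t g - H.S m t g‖ ≤ T * Real.exp (4 * H.ω * T) * ‖H.A n g - H.A m g‖ := by
  have hω := H.hω
  have hS : ∀ k t, Commute (H.S k t) (H.A k) := fun k t =>
    (((Commute.refl (H.A k)).smul_left t).exp_left )
  have hS2 : Commute (H.S n t) (H.A m) := (((H.A_comm n m).smul_left t).exp_left )
  have hd : ∀ s ∈ Icc (0 : ℝ) t, HasDerivWithinAt (fun s => H.S n s (H.S m (t - s) g))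
      (H.S n s (H.S m (t - s) (H.A n g - H.A m g))) (Icc 0 t) s := by
    intro s hs
    have h1 := hasDerivAt_exp_smul_const (𝕂 := ℝ) (H.A n) s
    have h2 : HasDerivAt (fun s => H.S m (t - s) g) (-(H.S m (t - s) (H.A m g))) s := by
      have := (H.S_hasDerivAt m (t - s) g).scomp s ((hasDerivAt_id s).const_sub t)
      simp only [neg_smul, one_smul] at this
      exact this
    have h3 := h1.clm_apply h2
    refine (h3.congr_deriv ?_).hasDerivWithinAt
    have hc : H.A n * H.S m (t - s) = H.S m (t - s) * H.A n :=
      ((((H.A_comm n m)).smul_right (t - s)).exp_right )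
    have hc' : H.A n (H.S m (t - s) g) = H.S m (t - s) (H.A n g) := by
      have := congrArg (fun T => T g) hc
      simpa using this
    change H.S n s (H.A n (H.S m (t - s) g)) + H.S n s (-(H.S m (t - s) (H.A m g))) = _
    rw [hc', ← map_add, ← sub_eq_add_neg, ← map_sub]
  have hb : ∀ s ∈ Icc (0 : ℝ) t, ‖H.S n s (H.S m (t - s) (H.A n g - H.A m g))‖
      ≤ Real.exp (4 * H.ω * T) * ‖H.A n g - H.A m g‖ := by
    intro s hs
    refine (H.S_norm n hs.1 _).trans ?_
    refine (mul_le_mul_of_nonneg_left (H.S_norm m (by linarith [hs.2]) _) (Real.exp_pos _).le).trans ?_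
    rw [← mul_assoc, ← Real.exp_add]
    refine mul_le_mul_of_nonneg_right (Real.exp_le_exp.2 ?_) (norm_nonneg _)
    have := hs.2
    nlinarith
  have h := (convex_Icc (0 : ℝ) t).norm_image_sub_le_of_norm_hasDerivWithin_le hd hb
    (left_mem_Icc.2 ht) (right_mem_Icc.2 ht)
  have e0 : ∀ k, H.S k 0 = 1 := fun k => by simp [S]
  simp only [sub_zero, sub_self, e0, one_apply_eq_self] at h
  refine h.trans ?_
  rw [Real.norm_of_nonneg ht]
  have := mul_nonneg (Real.exp_pos (4 * H.ω * T)).le (norm_nonneg (H.A n g - H.A m g))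
  nlinarith

lemma J_norm (n : ℕ) (f : E) : ‖H.J n f‖ ≤ 2 * ‖f‖ := by
  have hω := H.hω
  have hl := H.hlam n
  have hp : 0 < H.lam n - H.ω := by linarith
  have hl0 : 0 ≤ H.lam n := by linarith
  have h1 : ‖H.J n f‖ ≤ H.lam n * (1 / (H.lam n - H.ω) * ‖f‖) := by
    rw [J, _root_.smul_apply, norm_smul, Real.norm_of_nonneg hl0]
    exact mul_le_mul_of_nonneg_left ((H.R n).le_of_opNorm_le (H.hR n) f) hl0
  have h5 : H.lam n / (H.lam n - H.ω) ≤ 2 := by rw [div_le_iff₀ hp]; linarith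
  calc _ ≤ _ := h1
    _ = H.lam n / (H.lam n - H.ω) * ‖f‖ := by ring
    _ ≤ _ := mul_le_mul_of_nonneg_right h5 (norm_nonneg _)

lemma tendsto_J_A {f : E} (hf : Filter.Tendsto (fun n => H.J n f) Filter.atTop (nhds f)) (m : ℕ) :
    Filter.Tendsto (fun n => H.A n (H.J m f)) Filter.atTop (nhds (H.A m f)) := by
  have e : ∀ n, H.A n (H.J m f) = H.A m (H.J n f) := fun n => by
    have h1 : H.A n (H.J m f) = H.J n (H.A m f) := by
      have := congrArg (fun T => T f) (H.A_J n m); simpa using this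
    have hc : Commute (H.J n) (H.A m) := by
      have h : Commute (H.J n) (H.J m) := H.J_comm n m
      exact (h.sub_right (Commute.one_right _)).smul_right _
    have h2 : H.J n (H.A m f) = H.A m (H.J n f) := by
      have := congrArg (fun T => T f) hc.eq; simpa using this
    rw [h1, h2]
  simp only [e]
  exact ((H.A m).continuous.tendsto f).comp hf

lemma S_cauchy {f : E} (hf : Filter.Tendsto (fun n => H.J n f) Filter.atTop (nhds f)) {T : ℝ}
    (hT : 0 ≤ T) :
    UniformCauchySeqOn (fun n t => H.S n t f) Filter.atTop (Icc 0 T) := by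
  rw [Metric.uniformCauchySeqOn_iff]
  intro ε hε
  set M := Real.exp (2 * H.ω * T) with hM
  have hMp : 0 < M := Real.exp_pos _
  obtain ⟨m, hm⟩ : ∃ m, ‖f - H.J m f‖ < ε / (4 * M) := by
    have h1 := (Metric.tendsto_atTop.1 hf) (ε / (4 * M)) (by positivity)
    obtain ⟨m, hm⟩ := h1
    refine ⟨m, ?_⟩
    have := hm m le_rfl
    rwa [dist_comm, dist_eq_norm] at this
  set K := T * Real.exp (4 * H.ω * T) + 1 with hK
  have hKp : 0 < K := by positivity
  obtain ⟨N, hN⟩ := (Metric.tendsto_atTop.1 (H.tendsto_J_A hf m)) (ε / (4 * K)) (by positivity)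
  refine ⟨N, fun n hn k hk t ht => ?_⟩
  have hω := H.hω
  have hSM : ∀ j, ‖H.S j t (f - H.J m f)‖ ≤ ε / 4 := fun j => by
    refine (H.S_norm j ht.1 _).trans ?_
    have h1 : Real.exp (2 * H.ω * t) ≤ M :=
      Real.exp_le_exp.2 (mul_le_mul_of_nonneg_left ht.2 (by positivity))
    calc _ ≤ M * (ε / (4 * M)) := mul_le_mul h1 hm.le (norm_nonneg _) hMp.le
      _ = _ := by field_simp
  have h2 := H.S_diff n k ht.1 ht.2 (H.J m f)
  have h3 : ‖H.A n (H.J m f) - H.A k (H.J m f)‖ < ε / (2 * K) := by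
    have a1 := hN n hn
    have a2 := hN k hk
    rw [← dist_eq_norm]
    refine (dist_triangle_right _ _ (H.A m f)).trans_lt ?_
    have : ε / (2 * K) = ε / (4 * K) + ε / (4 * K) := by field_simp; ring
    linarith
  have h4 : ‖H.S n t (H.J m f) - H.S k t (H.J m f)‖ < ε / 2 := by
    refine h2.trans_lt ?_
    calc _ ≤ K * ‖H.A n (H.J m f) - H.A k (H.J m f)‖ :=
          mul_le_mul_of_nonneg_right (by linarith) (norm_nonneg _)
      _ < K * (ε / (2 * K)) := mul_lt_mul_of_pos_left h3 hKp
      _ = _ := by field_simp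
  rw [dist_eq_norm]
  have e : H.S n t f - H.S k t f = H.S n t (f - H.J m f) +
      (H.S n t (H.J m f) - H.S k t (H.J m f)) - H.S k t (f - H.J m f) := by
    simp only [map_sub]; abel
  rw [e]
  refine (norm_sub_le _ _).trans_lt ?_
  have := norm_add_le (H.S n t (f - H.J m f)) (H.S n t (H.J m f) - H.S k t (H.J m f))
  linarith [hSM n, hSM k]

theorem main {f : E} (hf : Filter.Tendsto (fun n => H.J n f) Filter.atTop (nhds f)) {T : ℝ}
    (hT : 0 ≤ T) : ∃ U : ℝ → E, Continuous U ∧ U 0 = f ∧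
      (∀ t ∈ Icc (0 : ℝ) T, Filter.Tendsto (fun n => H.S n t f) Filter.atTop (nhds (U t))) ∧
      ∀ e ℓ : E →L[ℝ] ℝ, (∀ n g, e (H.A n g) = ℓ (H.J n g)) → ∀ t ∈ Icc (0 : ℝ) T,
        HasDerivWithinAt (fun t => e (U t)) (ℓ (U t)) (Icc 0 T) t := by
  have hC := H.S_cauchy hf hT
  have hω := H.hω
  have hlim : ∀ t ∈ Icc (0 : ℝ) T, ∃ v, Filter.Tendsto (fun n => H.S n t f) Filter.atTop (nhds v) :=
    fun t ht => cauchySeq_tendsto_of_complete (hC.cauchySeq ht)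
  choose! V hV using hlim
  have hU := hC.tendstoUniformlyOn_of_tendsto hV
  have hScont : ∀ n (g : E), Continuous (fun t => H.S n t g) := fun n g =>
    continuous_iff_continuousAt.2 fun t => (H.S_hasDerivAt n t g).continuousAt
  have hVc : ContinuousOn V (Icc 0 T) :=
    hU.continuousOn (Filter.Frequently.of_forall fun n => (hScont n f).continuousOn)
  have hUc : Continuous (fun t : ℝ => V (max 0 (min T t))) := by
    refine hVc.comp_continuous (by fun_prop) fun t => ⟨le_max_left _ _, max_le hT (min_le_left _ _)⟩
  have hUV : ∀ t ∈ Icc (0 : ℝ) T, V (max 0 (min T t)) = V t := fun t ht => by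
    rw [min_eq_right ht.2, max_eq_right ht.1]
  refine ⟨fun t => V (max 0 (min T t)), hUc, ?_, ?_, ?_⟩
  · have h0 : (0 : ℝ) ∈ Icc 0 T := ⟨le_rfl, hT⟩
    simp only [hUV 0 h0]
    refine tendsto_nhds_unique (hV 0 h0) ?_
    have : ∀ n, H.S n 0 f = f := fun n => by simp [S]
    simp only [this]; exact tendsto_const_nhds
  · intro t ht
    simp only [hUV t ht]
    exact hV t ht
  · intro e ℓ he
    have hintg : ∀ t ∈ Icc (0 : ℝ) T, e (V t) = e f + ∫ s in (0 : ℝ)..t, ℓ (V (max 0 (min T s))) := by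
      intro t ht
      have h1 : Filter.Tendsto (fun n => e (H.S n t f)) Filter.atTop (nhds (e (V t))) :=
        (e.continuous.tendsto _).comp (hV t ht)
      refine tendsto_nhds_unique h1 ?_
      have h2 : ∀ n, e (H.S n t f) = e f + ∫ s in (0 : ℝ)..t, ℓ (H.S n s (H.J n f)) := by
        intro n
        have hd : ∀ s : ℝ, HasDerivAt (fun s => e (H.S n s f)) (ℓ (H.S n s (H.J n f))) s := by
          intro s
          have h3 := e.hasFDerivAt.comp_hasDerivAt s (H.S_hasDerivAt n s f)
          refine h3.congr_deriv ?_
          have c1 : H.S n s (H.A n f) = H.A n (H.S n s f) := by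
            have hS : Commute (H.S n s) (H.A n) :=
              ((Commute.refl (H.A n)).smul_left s).exp_left
            have := congrArg (fun T => T f) hS.eq; simpa using this
          have c2 : H.S n s (H.J n f) = H.J n (H.S n s f) := by
            have hS : Commute (H.S n s) (H.J n) :=
              ((H.J_A_comm n).symm.smul_left s).exp_left
            have := congrArg (fun T => T f) hS.eq; simpa using this
          rw [c1, c2, he]
        have h4 := intervalIntegral.integral_eq_sub_of_hasDerivAt (a := 0) (b := t)
          (fun s _ => hd s)
          ((ℓ.continuous.comp (hScont n (H.J n f))).intervalIntegrable _ _)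
        have h5 : H.S n 0 f = f := by simp [S]
        rw [h4, h5]; ring
      simp only [h2]
      refine Filter.Tendsto.const_add _ ?_
      rw [Metric.tendsto_atTop]
      intro ε hε
      set M := Real.exp (2 * H.ω * T) with hM
      have hMp : 0 < M := Real.exp_pos _
      set η := ε / (2 * (T + 1) * (‖ℓ‖ + 1)) with hη
      have hηp : 0 < η := by positivity
      obtain ⟨N1, hN1⟩ := (Metric.tendsto_atTop.1 hf) (η / M) (by positivity)
      obtain ⟨N2, hN2⟩ := Filter.eventually_atTop.1 ((Metric.tendstoUniformlyOn_iff.1 hU) η hηp)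
      refine ⟨max N1 N2, fun n hn => ?_⟩
      have hc1 : Continuous (fun s => ℓ (H.S n s (H.J n f))) := ℓ.continuous.comp (hScont n _)
      have hc2 : Continuous (fun s : ℝ => ℓ (V (max 0 (min T s)))) := ℓ.continuous.comp hUc
      rw [dist_eq_norm, ← intervalIntegral.integral_sub (hc1.intervalIntegrable _ _)
        (hc2.intervalIntegrable _ _)]
      have hb : ∀ s ∈ Set.uIoc 0 t, ‖ℓ (H.S n s (H.J n f)) - ℓ (V (max 0 (min T s)))‖
          ≤ ‖ℓ‖ * (2 * η) := by
        intro s hs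
        rw [Set.uIoc_of_le ht.1] at hs
        have hs' : s ∈ Icc (0 : ℝ) T := ⟨hs.1.le, hs.2.trans ht.2⟩
        rw [hUV s hs', ← map_sub]
        refine (ℓ.le_opNorm _).trans (mul_le_mul_of_nonneg_left ?_ (norm_nonneg _))
        have a1 : ‖H.S n s (H.J n f - f)‖ ≤ η := by
          refine (H.S_norm n hs'.1 _).trans ?_
          have h1 : Real.exp (2 * H.ω * s) ≤ M :=
            Real.exp_le_exp.2 (mul_le_mul_of_nonneg_left hs'.2 (by positivity))
          have h2 := hN1 n (le_trans (le_max_left _ _) hn)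
          rw [dist_eq_norm] at h2
          calc _ ≤ M * (η / M) := mul_le_mul h1 h2.le (norm_nonneg _) hMp.le
            _ = _ := by field_simp
        have a2 := hN2 n (le_trans (le_max_right _ _) hn) s hs'
        rw [dist_comm, dist_eq_norm] at a2
        have e1 : H.S n s (H.J n f) - V s = H.S n s (H.J n f - f) + (H.S n s f - V s) := by
          simp only [map_sub]; abel
        rw [e1]
        refine (norm_add_le _ _).trans ?_
        linarith
      refine (intervalIntegral.norm_integral_le_of_norm_le_const hb).trans_lt ?_
      rw [sub_zero, abs_of_nonneg ht.1]
      have hl := norm_nonneg ℓ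
      have : ‖ℓ‖ * (2 * η) * t ≤ ‖ℓ‖ * (2 * η) * (T + 1) :=
        mul_le_mul_of_nonneg_left (by linarith [ht.2]) (by positivity)
      refine this.trans_lt ?_
      have e2 : ε = (‖ℓ‖ + 1) * (2 * η) * (T + 1) := by rw [hη]; field_simp
      rw [e2]
      have : 0 < 2 * η * (T + 1) := by positivity
      nlinarith
    intro t ht
    have hc2 : Continuous (fun s : ℝ => ℓ (V (max 0 (min T s)))) := ℓ.continuous.comp hUc
    have h1 := (hc2.integral_hasStrictDerivAt 0 t).hasDerivAt.const_add (e f)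
    refine h1.hasDerivWithinAt.congr_of_mem (fun s hs => ?_) ht
    change e (V (max 0 (min T s))) = _
    rw [hUV s hs]
    exact hintg s hs

end HYData
end HY
end KPde

open scoped BoundedContinuousFunction
namespace KPde

/-- ambient Banach space -/
abbrev Amb := Fin 5 → (ℝ →ᵇ ℝ)

namespace Wts
variable {D : Par} (W : Wts D)

/-- actual function attached to an element -/
noncomputable def fn (φ : Amb) (k : ℕ) (x : ℝ) : ℝ :=
  if h : k < 5 then W.V k x * φ ⟨k, h⟩ (Real.log x) else 0

lemma fn_add (φ ψ : Amb) (k : ℕ) (x : ℝ) : W.fn (φ + ψ) k x = W.fn φ k x + W.fn ψ k x := by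
  unfold fn; split_ifs <;> simp [mul_add]

lemma fn_smul (c : ℝ) (φ : Amb) (k : ℕ) (x : ℝ) : W.fn (c • φ) k x = c * W.fn φ k x := by
  unfold fn; split_ifs <;> simp; ring

lemma fn_zero (k : ℕ) (x : ℝ) : W.fn 0 k x = 0 := by
  unfold fn; split_ifs <;> simp

lemma fn_bound (φ : Amb) (k : ℕ) {x : ℝ} (hx : 0 < x) : |W.fn φ k x| ≤ ‖φ‖ * W.V k x := by
  have hV := W.V_pos (k := k) hx
  unfold fn
  split_ifs with h
  · rw [abs_mul, abs_of_pos hV, mul_comm]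
    refine mul_le_mul_of_nonneg_right ?_ hV.le
    exact ((φ ⟨k, h⟩).norm_coe_le_norm _).trans (norm_le_pi_norm φ _)
  · simp; positivity

lemma fn_norm_le (φ : Amb) {N : ℝ} (hN : 0 ≤ N)
    (h : ∀ k ≤ 4, ∀ x : ℝ, 0 < x → |W.fn φ k x| ≤ N * W.V k x) : ‖φ‖ ≤ N := by
  refine (pi_norm_le_iff_of_nonneg hN).2 fun i => ?_
  refine (BoundedContinuousFunction.norm_le hN).2 fun s => ?_
  have hx := Real.exp_pos s
  have h1 := h i (by omega) (Real.exp s) hx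
  have hV := W.V_pos (k := i) hx
  simp only [fn, i.2, dif_pos, Real.log_exp, abs_mul, abs_of_pos hV] at h1
  rw [mul_comm] at h1
  exact le_of_mul_le_mul_right h1 hV

lemma V_continuousOn (k : ℕ) : ContinuousOn (W.V k) (Ioi 0) := by
  intro x hx
  exact (Wt_hasDerivAt _ _ hx).continuousAt.continuousWithinAt

lemma fn_continuousOn (φ : Amb) (k : ℕ) : ContinuousOn (W.fn φ k) (Ioi 0) := by
  by_cases h : k < 5
  · have : W.fn φ k = fun x => W.V k x * φ ⟨k, h⟩ (Real.log x) := by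
      funext x; simp [fn, h]
    rw [this]
    refine (W.V_continuousOn k).mul ((φ ⟨k, h⟩).continuous.comp_continuousOn ?_)
    exact Real.continuousOn_log.mono fun x hx => ne_of_gt hx
  · have : W.fn φ k = fun x => 0 := by funext x; simp [fn, h]
    rw [this]; exact continuousOn_const

/-- The Banach space -/
noncomputable def Y : Submodule ℝ Amb where
  carrier := {φ | Chain 4 (W.fn φ)}
  add_mem' := fun {φ ψ} h1 h2 k hk x hx => by
    have := (h1 k hk x hx).add (h2 k hk x hx)
    rw [← W.fn_add] at this
    refine this.congr_of_eventuallyEq (Filter.Eventually.of_forall fun y => W.fn_add _ _ _ _)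
  zero_mem' := fun k hk x hx => by
    rw [W.fn_zero]
    refine (hasDerivAt_const x (0 : ℝ)).congr_of_eventuallyEq
      (Filter.Eventually.of_forall fun y => W.fn_zero _ _)
  smul_mem' := fun c φ h1 k hk x hx => by
    have := (h1 k hk x hx).const_mul c
    rw [← W.fn_smul] at this
    refine this.congr_of_eventuallyEq (Filter.Eventually.of_forall fun y => W.fn_smul _ _ _ _)

lemma fn_sub (φ ψ : Amb) (k : ℕ) (x : ℝ) : W.fn (φ - ψ) k x = W.fn φ k x - W.fn ψ k x := by
  unfold fn; split_ifs <;> simp [mul_sub]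

lemma Y_closed : IsClosed (W.Y : Set Amb) := by
  refine IsSeqClosed.isClosed fun φ ψ hφ hlim => ?_
  intro k hk x hx
  have hn : Filter.Tendsto (fun n => ‖φ n - ψ‖) Filter.atTop (nhds 0) :=
    tendsto_iff_norm_sub_tendsto_zero.1 hlim
  have hbd : ∀ n j (y : ℝ), 0 < y → |W.fn (φ n) j y - W.fn ψ j y| ≤ ‖φ n - ψ‖ * W.V j y :=
    fun n j y hy => by rw [← W.fn_sub]; exact W.fn_bound _ _ hy
  refine hasDerivAt_of_tendstoLocallyUniformlyOn (s := Ioi 0) (l := Filter.atTop)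
    (f := fun n => W.fn (φ n) k) (f' := fun n => W.fn (φ n) (k + 1)) (g' := W.fn ψ (k + 1))
    isOpen_Ioi ?_ (Filter.Eventually.of_forall fun n y hy => hφ n k hk y hy) ?_ hx
  · rw [Metric.tendstoLocallyUniformlyOn_iff]
    intro ε hε y hy
    have hc := (W.V_continuousOn (k + 1)).continuousAt (Ioi_mem_nhds hy)
    have hM : ∀ᶠ z in nhds y, W.V (k + 1) z < W.V (k + 1) y + 1 :=
      hc.eventually (gt_mem_nhds (by linarith))
    have hVy := W.V_pos (k := k + 1) hy
    refine ⟨{z | W.V (k + 1) z < W.V (k + 1) y + 1} ∩ Ioi 0,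
      mem_nhdsWithin_of_mem_nhds (Filter.inter_mem hM (Ioi_mem_nhds hy)), ?_⟩
    filter_upwards [hn.eventually (gt_mem_nhds (show 0 < ε / (W.V (k + 1) y + 1) by positivity))]
      with n hn z hz
    rw [dist_comm, Real.dist_eq]
    refine (hbd n (k + 1) z hz.2).trans_lt ?_
    rw [lt_div_iff₀ (by positivity)] at hn
    refine lt_of_le_of_lt ?_ hn
    exact mul_le_mul_of_nonneg_left (le_of_lt hz.1) (norm_nonneg _)
  · intro y hy
    rw [tendsto_iff_norm_sub_tendsto_zero]
    refine squeeze_zero (fun _ => norm_nonneg _) (fun n => hbd n k y hy) ?_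
    simpa using hn.mul_const (W.V k y)

instance : CompleteSpace W.Y := W.Y_closed.completeSpace_coe

/-- evaluation functional, linear version -/
noncomputable def evL (k : ℕ) (x : ℝ) : Amb →ₗ[ℝ] ℝ where
  toFun := fun u => W.fn u k x
  map_add' := fun _ _ => W.fn_add _ _ _ _
  map_smul' := fun _ _ => W.fn_smul _ _ _ _

lemma evL_bound (k : ℕ) (x : ℝ) (u : Amb) : ‖W.evL k x u‖ ≤ |W.V k x| * ‖u‖ := by
  change |W.fn u k x| ≤ _
  by_cases h : k < 5
  · simp only [fn, h, dif_pos, abs_mul]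
    refine mul_le_mul_of_nonneg_left ?_ (abs_nonneg _)
    exact ((u ⟨k, h⟩).norm_coe_le_norm _).trans (norm_le_pi_norm u _)
  · simp only [fn, h, dif_neg, not_false_eq_true, abs_zero]; positivity

/-- the Banach space as a type of its own -/
def YT : Type := W.Y

noncomputable instance instNormedAddCommGroupYT : NormedAddCommGroup W.YT :=
  inferInstanceAs (NormedAddCommGroup W.Y)
noncomputable instance instNormedSpaceYT : NormedSpace ℝ W.YT :=
  inferInstanceAs (NormedSpace ℝ W.Y)
instance instCompleteSpaceYT : CompleteSpace W.YT :=
  inferInstanceAs (CompleteSpace W.Y)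

/-- underlying element -/
def val (u : W.YT) : Amb := Subtype.val u

/-- evaluation functional -/
noncomputable def ev (k : ℕ) (x : ℝ) : W.YT →L[ℝ] ℝ :=
  LinearMap.mkContinuous
    { toFun := fun u => W.fn (W.val u) k x
      map_add' := fun _ _ => W.fn_add _ _ _ _
      map_smul' := fun _ _ => W.fn_smul _ _ _ _ } |W.V k x|
    (fun u => W.evL_bound k x (W.val u))

lemma ev_apply (k : ℕ) (x : ℝ) (u : W.YT) : W.ev k x u = W.fn (W.val u) k x := rfl

/-- generator functional -/
noncomputable def Lop (x : ℝ) : W.YT →L[ℝ] ℝ := D.a 0 x • W.ev 2 x + D.b 0 x • W.ev 1 x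

lemma Lop_apply (x : ℝ) (u : W.YT) :
    W.Lop x u = D.a 0 x * W.fn (W.val u) 2 x + D.b 0 x * W.fn (W.val u) 1 x := rfl

lemma chain (u : W.YT) : Chain 4 (W.fn (W.val u)) := u.2

lemma bound (u : W.YT) (k : ℕ) {x : ℝ} (hx : 0 < x) : |W.ev k x u| ≤ ‖u‖ * W.V k x :=
  W.fn_bound (W.val u) k hx

lemma norm_le (u : W.YT) {N : ℝ} (hN : 0 ≤ N)
    (h : ∀ k ≤ 4, ∀ x : ℝ, 0 < x → |W.ev k x u| ≤ N * W.V k x) : ‖u‖ ≤ N :=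
  W.fn_norm_le (W.val u) hN h

lemma exists_mk {g : ℕ → ℝ → ℝ} (hg : Chain 4 g) (hc : ContinuousOn (g 4) (Ioi 0)) {N : ℝ}
    (hb : ∀ k ≤ 4, ∀ x : ℝ, 0 < x → |g k x| ≤ N * W.V k x) :
    ∃ u : W.YT, ∀ k ≤ 4, ∀ x : ℝ, 0 < x → W.ev k x u = g k x := by
  have hcont : ∀ k ≤ 4, ContinuousOn (g k) (Ioi 0) := fun k hk => by
    rcases Nat.lt_or_eq_of_le hk with h | h
    · intro x hx; exact (hg k h x hx).continuousAt.continuousWithinAt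
    · rw [h]; exact hc
  let φ : Amb := fun i => BoundedContinuousFunction.ofNormedAddCommGroup
    (fun s => g i (Real.exp s) / W.V i (Real.exp s))
    (((hcont i (by omega)).comp_continuous Real.continuous_exp Real.exp_pos).div
      ((W.V_continuousOn i).comp_continuous Real.continuous_exp Real.exp_pos)
      fun s => (W.V_pos (Real.exp_pos s)).ne') N (fun s => by
        have hV := W.V_pos (k := i) (Real.exp_pos s)
        rw [norm_div, Real.norm_eq_abs, Real.norm_of_nonneg hV.le, div_le_iff₀ hV]
        exact hb i (by omega) _ (Real.exp_pos s))
  have hφ : ∀ k ≤ 4, ∀ x : ℝ, 0 < x → W.fn φ k x = g k x := by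
    intro k hk x hx
    have h5 : k < 5 := by omega
    have hV := W.V_pos (k := k) hx
    simp only [fn, h5, dif_pos]
    change W.V k x * (g k (Real.exp (Real.log x)) / W.V k (Real.exp (Real.log x))) = g k x
    rw [Real.exp_log hx]; field_simp
  refine ⟨⟨φ, fun k hk x hx => ?_⟩, hφ⟩
  rw [hφ (k + 1) (by omega) x hx]
  exact (hg k hk x hx).congr_of_eventuallyEq (ev_pos hx (hφ k (by omega)))

lemma ext0 {u : W.YT} (h : ∀ x : ℝ, 0 < x → W.ev 0 x u = 0) : u = 0 := by
  have key : ∀ k ≤ 4, ∀ x : ℝ, 0 < x → W.fn (W.val u) k x = 0 := by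
    intro k
    induction k with
    | zero => intro _ x hx; exact h x hx
    | succ k ih =>
      intro hk x hx
      have h1 := W.chain u k (by omega) x hx
      have h2 : HasDerivAt (W.fn (W.val u) k) 0 x :=
        (hasDerivAt_const x (0 : ℝ)).congr_of_eventuallyEq (ev_pos hx (ih (by omega)))
      exact h1.unique h2
  have h3 : ‖u‖ ≤ 0 := W.norm_le u le_rfl fun k hk x hx => by
    rw [ev_apply, key k hk x hx]; simp
  have h4 : ‖(W.val u)‖ ≤ 0 := h3
  have h5 : (W.val u) = 0 := norm_eq_zero.1 (le_antisymm h4 (norm_nonneg (W.val u)))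
  exact Subtype.ext h5

lemma res_uniq {lam : ℝ} (hl : W.ω < lam) {u : W.YT}
    (h : ∀ x : ℝ, 0 < x → lam * W.ev 0 x u - W.Lop x u = 0) : u = 0 := by
  have hl0 : 0 < lam := W.hω.trans_lt hl
  refine W.ext0 fun x hx => ?_
  refine W.uniq (h := 1 / lam) (C := ‖u‖) (by positivity) ?_ (u := W.fn (W.val u) 0) (u1 := W.fn (W.val u) 1)
    (u2 := W.fn (W.val u) 2) ⟨W.chain u 0 (by omega), W.chain u 1 (by omega), fun y hy => ?_⟩
    (fun y hy => W.bound u 0 hy) x hx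
  · rw [one_div, inv_mul_lt_iff₀ hl0]; linarith
  · have h1 := h y hy
    rw [ev_apply, Lop_apply] at h1
    field_simp
    linarith

lemma res_exists {lam : ℝ} (hl : W.ω < lam) (g : W.YT) :
    ∃ u : W.YT, (∀ x : ℝ, 0 < x → lam * W.ev 0 x u - W.Lop x u = W.ev 0 x g) ∧
      ‖u‖ ≤ 1 / (lam - W.ω) * ‖g‖ ∧
      (∀ M, 0 ≤ M → (∀ k ≤ 4, ∀ x : ℝ, 0 < x → |W.ev k x g| ≤ M * Wt (W.PX k) (W.QX k) x) →
        ∀ k ≤ 4, ∀ x : ℝ, 0 < x →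
          |W.ev k x u| ≤ M * (1 / (lam - W.ω)) * Wt (W.PX k) (W.QX k) x) ∧
      (∀ M, 0 ≤ M → (∀ x : ℝ, 0 < x → |W.Lop x g| ≤ M * Wt (2 * D.α) 0 x) →
        ∀ x : ℝ, 0 < x → |W.Lop x u| ≤ M * (1 / (lam - W.ω)) * Wt (2 * D.α) 0 x) := by
  have hl0 : 0 < lam := W.hω.trans_lt hl
  have hd : 0 < lam - W.ω := by linarith
  have e1 : ∀ M, M / lam / (1 - 1 / lam * W.ω) = M * (1 / (lam - W.ω)) := fun M => by
    have : 1 - 1 / lam * W.ω ≠ 0 := by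
      have : 1 - 1 / lam * W.ω = (lam - W.ω) / lam := by field_simp
      rw [this]; positivity
    field_simp
  have hω' : 1 / lam * W.ω < 1 := by rw [one_div, inv_mul_lt_iff₀ hl0]; linarith
  have sc : ∀ {a M c : ℝ}, |a| ≤ M * c → |a / lam| ≤ M / lam * c := fun {a M c} h => by
    rw [abs_div, abs_of_pos hl0, div_mul_eq_mul_div]
    exact div_le_div_of_nonneg_right h hl0.le
  obtain ⟨u, hu, heq, hY, hX, hL⟩ := W.resolvent (h := 1 / lam) (N := ‖g‖ / lam) (by positivity)
    hω' (by positivity) (g := fun k x => W.fn (W.val g) k x / lam)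
    (fun k hk x hx => (W.chain g k hk x hx).div_const lam)
    (fun k hk x hx => sc (W.bound g k hx))
  rw [e1] at hY
  obtain ⟨v, hv⟩ := W.exists_mk (hu.mono (by omega)) (hu.continuousOn (k := 4) (by omega)) hY
  have hvL : ∀ x : ℝ, 0 < x → W.Lop x v = D.a 0 x * u 2 x + D.b 0 x * u 1 x := fun x hx => by
    rw [Lop_apply, ← ev_apply, ← ev_apply, hv 2 (by omega) x hx, hv 1 (by omega) x hx]
  refine ⟨v, fun x hx => ?_, ?_, fun M hM h k hk x hx => ?_, fun M hM h x hx => ?_⟩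
  · have h1 := heq x hx
    rw [hvL x hx, hv 0 (by omega) x hx, ev_apply]
    field_simp at h1
    linarith
  · rw [mul_comm]
    refine W.norm_le v (by positivity) fun k hk x hx => ?_
    rw [hv k hk x hx]; exact hY k hk x hx
  · rw [hv k hk x hx, ← e1]
    exact hX (M / lam) (by positivity) (fun k hk x hx => sc (h k hk x hx)) k hk x hx
  · rw [hvL x hx, ← e1]
    refine hL (M / lam) (by positivity) (fun x hx => ?_) x hx
    have : D.a 0 x * (W.fn (W.val g) 2 x / lam) + D.b 0 x * (W.fn (W.val g) 1 x / lam) = W.Lop x g / lam := by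
      rw [Lop_apply]; ring
    rw [this]
    exact sc (h x hx)

end Wts
end KPde

namespace KPde
namespace Wts
variable {D : Par} (W : Wts D)

/-- resolvent value -/
noncomputable def rs {lam : ℝ} (hl : W.ω < lam) (g : W.YT) : W.YT := (W.res_exists hl g).choose

lemma rs_spec {lam : ℝ} (hl : W.ω < lam) (g : W.YT) (x : ℝ) (hx : 0 < x) :
    lam * W.ev 0 x (W.rs hl g) - W.Lop x (W.rs hl g) = W.ev 0 x g :=
  (W.res_exists hl g).choose_spec.1 x hx

lemma rs_eq {lam : ℝ} (hl : W.ω < lam) {g u : W.YT}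
    (h : ∀ x : ℝ, 0 < x → lam * W.ev 0 x u - W.Lop x u = W.ev 0 x g) : W.rs hl g = u := by
  refine sub_eq_zero.1 (W.res_uniq hl fun x hx => ?_)
  have h1 := W.rs_spec hl g x hx
  have h2 := h x hx
  rw [map_sub, map_sub]
  linarith

/-- resolvent operator, linear version -/
noncomputable def RL {lam : ℝ} (hl : W.ω < lam) : W.YT →ₗ[ℝ] W.YT where
  toFun := W.rs hl
  map_add' := fun g g' => W.rs_eq hl fun x hx => by
    have h1 := W.rs_spec hl g x hx
    have h2 := W.rs_spec hl g' x hx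
    simp only [map_add]
    linarith
  map_smul' := fun c g => W.rs_eq hl fun x hx => by
    have h1 := W.rs_spec hl g x hx
    simp only [map_smul, smul_eq_mul, RingHom.id_apply]
    rw [← h1]; ring

lemma RL_bound {lam : ℝ} (hl : W.ω < lam) (g : W.YT) : ‖W.RL hl g‖ ≤ 1 / (lam - W.ω) * ‖g‖ :=
  (W.res_exists hl g).choose_spec.2.1

/-- resolvent operator -/
noncomputable def Rop {lam : ℝ} (hl : W.ω < lam) : W.YT →L[ℝ] W.YT :=
  (W.RL hl).mkContinuous _ (W.RL_bound hl)

lemma Rop_apply {lam : ℝ} (hl : W.ω < lam) (g : W.YT) : W.Rop hl g = W.rs hl g := rfl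

/-- the sequence of parameters -/
noncomputable def lam (n : ℕ) : ℝ := n + (2 * W.ω + 1)

lemma lam_gt (n : ℕ) : W.ω < W.lam n := by
  have := W.hω
  have := Nat.cast_nonneg (α := ℝ) n
  unfold lam; linarith

/-- the Hille--Yosida data -/
noncomputable def hy : HYData W.YT where
  R n := W.Rop (W.lam_gt n)
  lam := W.lam
  ω := W.ω
  hω := W.hω
  hlam n := by
    have := Nat.cast_nonneg (α := ℝ) n
    unfold lam; linarith
  htend := Filter.tendsto_atTop_add_const_right _ _ tendsto_natCast_atTop_atTop
  hR n := LinearMap.mkContinuous_norm_le _ (by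
    have := W.lam_gt n
    have : 0 < W.lam n - W.ω := by linarith
    positivity) _
  hres n m := by
    ext1 g
    change W.rs (W.lam_gt n) g - W.rs (W.lam_gt m) g
      = (W.lam m - W.lam n) • W.rs (W.lam_gt n) (W.rs (W.lam_gt m) g)
    rw [← Rop_apply W (W.lam_gt n) (W.rs (W.lam_gt m) g), ← map_smul, Rop_apply]
    symm
    refine W.rs_eq _ fun x hx => ?_
    have h1 := W.rs_spec (W.lam_gt n) g x hx
    have h2 := W.rs_spec (W.lam_gt m) g x hx
    simp only [map_sub, map_smul, smul_eq_mul]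
    linear_combination h1 - h2

lemma hy_R (n : ℕ) (g : W.YT) : W.hy.R n g = W.rs (W.lam_gt n) g := rfl

lemma hy_lam (n : ℕ) : W.hy.lam n = W.lam n := rfl
lemma hy_ω : W.hy.ω = W.ω := rfl

lemma J_tendsto {f : W.YT} (hf : ∀ ε > 0, ∃ g v : W.YT, ‖f - g‖ < ε ∧
    ∀ x : ℝ, 0 < x → W.ev 0 x v = W.Lop x g) :
    Filter.Tendsto (fun n => W.hy.J n f) Filter.atTop (nhds f) := by
  rw [Metric.tendsto_atTop]
  intro ε hε
  obtain ⟨g, v, hg, hv⟩ := hf (ε / 4) (by positivity)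
  have e1 : ∀ n, W.hy.J n g - g = W.hy.R n v := by
    intro n
    have h1 : W.hy.R n (W.lam n • g - v) = g := by
      rw [hy_R]
      refine W.rs_eq _ fun x hx => ?_
      rw [map_sub, map_smul, smul_eq_mul, hv x hx]
    rw [map_sub, map_smul] at h1
    rw [HYData.J, _root_.smul_apply, hy_lam, sub_eq_iff_eq_add, ← sub_eq_iff_eq_add', h1]
  have h2 : Filter.Tendsto (fun n => 1 / (W.lam n - W.ω) * ‖v‖) Filter.atTop (nhds 0) := by
    have h3 : Filter.Tendsto (fun n => W.lam n - W.ω) Filter.atTop Filter.atTop :=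
      Filter.tendsto_atTop_add_const_right _ _ W.hy.htend
    simpa using (h3.const_div_atTop 1).mul_const ‖v‖
  obtain ⟨N, hN⟩ := Filter.eventually_atTop.1 (h2.eventually (gt_mem_nhds (show 0 < ε / 4 by positivity)))
  refine ⟨N, fun n hn => ?_⟩
  have h4 : ‖W.hy.J n g - g‖ < ε / 4 := by
    rw [e1]
    exact ((W.hy.R n).le_of_opNorm_le (W.hy.hR n) v).trans_lt (hN n hn)
  have h5 : ‖W.hy.J n (f - g)‖ < ε / 2 := (W.hy.J_norm n _).trans_lt (by linarith)
  rw [dist_eq_norm]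
  have e : W.hy.J n f - f = W.hy.J n (f - g) + (W.hy.J n g - g) - (f - g) := by
    rw [map_sub]; abel
  rw [e]
  refine (norm_sub_le _ _).trans_lt ?_
  have := norm_add_le (W.hy.J n (f - g)) (W.hy.J n g - g)
  linarith

theorem semigroup {f : W.YT} (hf : ∀ ε > 0, ∃ g v : W.YT, ‖f - g‖ < ε ∧
    ∀ x : ℝ, 0 < x → W.ev 0 x v = W.Lop x g) {T : ℝ} (hT : 0 ≤ T) :
    ∃ U : ℝ → W.YT, Continuous U ∧ U 0 = f ∧
      (∀ x : ℝ, 0 < x → ∀ t ∈ Icc (0 : ℝ) T,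
        HasDerivWithinAt (fun t => W.ev 0 x (U t)) (W.Lop x (U t)) (Icc 0 T) t) ∧
      (∀ M, 0 ≤ M → (∀ k ≤ 4, ∀ x : ℝ, 0 < x → |W.ev k x f| ≤ M * Wt (W.PX k) (W.QX k) x) →
        ∀ t ∈ Icc (0 : ℝ) T, ∀ k ≤ 4, ∀ x : ℝ, 0 < x →
          |W.ev k x (U t)| ≤ M * Real.exp (2 * W.ω * T) * Wt (W.PX k) (W.QX k) x) ∧
      (∀ M, 0 ≤ M → (∀ x : ℝ, 0 < x → |W.Lop x f| ≤ M * Wt (2 * D.α) 0 x) →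
        ∀ t ∈ Icc (0 : ℝ) T, ∀ x : ℝ, 0 < x →
          |W.Lop x (U t)| ≤ M * Real.exp (2 * W.ω * T) * Wt (2 * D.α) 0 x) := by
  obtain ⟨U, hUc, hU0, hlim, hder⟩ := W.hy.main (W.J_tendsto hf) hT
  have hω := W.hω
  have gen : ∀ (ℓ : W.YT →L[ℝ] ℝ) (c : ℝ), 0 ≤ c →
      (∀ n (j : ℕ), ‖ℓ ((W.hy.R n ^ j) f)‖ ≤ c * (1 / (W.hy.lam n - W.hy.ω)) ^ j) →
      ∀ t ∈ Icc (0 : ℝ) T, |ℓ (U t)| ≤ c * Real.exp (2 * W.ω * T) := by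
    intro ℓ c hc h t ht
    refine le_of_tendsto (((ℓ.continuous.tendsto _).comp (hlim t ht)).abs)
      (Filter.Eventually.of_forall fun n => ?_)
    refine (W.hy.S_bound ℓ f hc ht.1 n (h n)).trans ?_
    refine mul_le_mul_of_nonneg_left (Real.exp_le_exp.2 ?_) hc
    rw [hy_ω]
    exact mul_le_mul_of_nonneg_left ht.2 (by positivity)
  have hp : ∀ n, 0 < W.lam n - W.ω := fun n => by have := W.lam_gt n; linarith
  refine ⟨U, hUc, hU0, fun x hx t ht => hder (W.ev 0 x) (W.Lop x) (fun n g => ?_) t ht,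
    fun M hM h t ht k hk x hx => ?_, fun M hM h t ht x hx => ?_⟩
  · have h1 := W.rs_spec (W.lam_gt n) g x hx
    rw [HYData.A, HYData.J, _root_.smul_apply, _root_.sub_apply, _root_.smul_apply,
      hy_lam, hy_R, one_apply_eq_self]
    simp only [map_sub, map_smul, smul_eq_mul]
    rw [← h1]; ring
  · have key : ∀ n (j : ℕ), ∀ k ≤ 4, ∀ x : ℝ, 0 < x → |W.ev k x ((W.hy.R n ^ j) f)| ≤
        M * (1 / (W.lam n - W.ω)) ^ j * Wt (W.PX k) (W.QX k) x := by
      intro n j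
      have := hp n
      induction j with
      | zero => simpa using h
      | succ j ih =>
        rw [pow_succ' (W.hy.R n), pow_succ, ← mul_assoc]
        exact (W.res_exists (W.lam_gt n) _).choose_spec.2.2.1 _ (by positivity) ih
    have := gen (W.ev k x) (M * Wt (W.PX k) (W.QX k) x) (mul_nonneg hM (Wt_pos hx).le)
      (fun n j => (key n j k hk x hx).trans (le_of_eq (by rw [hy_lam, hy_ω]; ring))) t ht
    exact this.trans (le_of_eq (by ring))
  · have key : ∀ n (j : ℕ), ∀ x : ℝ, 0 < x → |W.Lop x ((W.hy.R n ^ j) f)| ≤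
        M * (1 / (W.lam n - W.ω)) ^ j * Wt (2 * D.α) 0 x := by
      intro n j
      have := hp n
      induction j with
      | zero => simpa using h
      | succ j ih =>
        rw [pow_succ' (W.hy.R n), pow_succ, ← mul_assoc]
        exact (W.res_exists (W.lam_gt n) _).choose_spec.2.2.2 _ (by positivity) ih
    have := gen (W.Lop x) (M * Wt (2 * D.α) 0 x) (mul_nonneg hM (Wt_pos hx).le)
      (fun n j => (key n j x hx).trans (le_of_eq (by rw [hy_lam, hy_ω]; ring))) t ht
    exact this.trans (le_of_eq (by ring))

end Wts
end KPde

namespace KPde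

/-- Leibniz product of two derivative sequences -/
noncomputable def pr (u v : ℕ → ℝ → ℝ) (k : ℕ) (x : ℝ) : ℝ :=
  ∑ i ∈ Finset.range (k + 1), (k.choose i : ℝ) * (u i x * v (k - i) x)

lemma pr_zero (u v : ℕ → ℝ → ℝ) (x : ℝ) : pr u v 0 x = u 0 x * v 0 x := by simp [pr]

lemma Chain.pr {n : ℕ} {u v : ℕ → ℝ → ℝ} (hu : Chain n u) (hv : Chain n v) :
    Chain n (pr u v) := by
  intro k hk x hx
  have h1 : HasDerivAt (KPde.pr u v k) (∑ i ∈ Finset.range (k + 1), (k.choose i : ℝ) *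
      (u (i + 1) x * v (k - i) x + u i x * v (k - i + 1) x)) x := by
    refine HasDerivAt.fun_sum fun i hi => ?_
    have hi' : i ≤ k := by simpa [Nat.lt_succ_iff] using hi
    exact ((hu i (by omega) x hx).mul (hv (k - i) (by omega) x hx)).const_mul _
  convert h1 using 1
  rw [KPde.pr, Finset.sum_choose_succ_mul (fun i j => u i x * v j x) k, ← Finset.sum_add_distrib]
  refine Finset.sum_congr rfl fun i hi => ?_
  have hi' : i ≤ k := by simpa [Nat.lt_succ_iff] using hi
  rw [show k + 1 - i = k - i + 1 by omega]
  ring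

lemma pr_bound {u v : ℕ → ℝ → ℝ} {k : ℕ} {x A B : ℝ} (hA : 0 ≤ A)
    (hu : ∀ i ≤ k, |u i x| ≤ A) (hv : ∀ i ≤ k, |v i x| ≤ B) : |pr u v k x| ≤ 2 ^ k * (A * B) := by
  unfold pr
  refine (Finset.abs_sum_le_sum_abs _ _).trans ?_
  have h2 : ∑ i ∈ Finset.range (k + 1), (k.choose i : ℝ) * (A * B) = 2 ^ k * (A * B) := by
    rw [← Finset.sum_mul]; congr 1; exact_mod_cast Nat.sum_range_choose k
  rw [← h2]
  refine Finset.sum_le_sum fun i hi => ?_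
  have hi' : i ≤ k := by simpa [Nat.lt_succ_iff] using hi
  rw [abs_mul, abs_mul, Nat.abs_cast]
  exact mul_le_mul_of_nonneg_left (mul_le_mul (hu i hi') (hv _ (by omega)) (abs_nonneg _) hA)
    (Nat.cast_nonneg _)

lemma pr_continuousOn {u v : ℕ → ℝ → ℝ} {k : ℕ} {s : Set ℝ}
    (hu : ∀ i ≤ k, ContinuousOn (u i) s) (hv : ∀ i ≤ k, ContinuousOn (v i) s) :
    ContinuousOn (pr u v k) s := by
  unfold pr
  refine continuousOn_finsetSum _ fun i hi => ?_
  have hi' : i ≤ k := by simpa [Nat.lt_succ_iff] using hi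
  exact continuousOn_const.mul ((hu i hi').mul (hv _ (by omega)))

lemma pr_eq_zero_right {u v : ℕ → ℝ → ℝ} {k : ℕ} {x : ℝ} (hv : ∀ i ≤ k, v i x = 0) :
    pr u v k x = 0 := by
  unfold pr
  refine Finset.sum_eq_zero fun i hi => ?_
  rw [hv _ (by omega)]; ring

lemma pr_eq_zero_left {u v : ℕ → ℝ → ℝ} {k : ℕ} {x : ℝ} (hv : ∀ i ≤ k, u i x = 0) :
    pr u v k x = 0 := by
  unfold pr
  refine Finset.sum_eq_zero fun i hi => ?_
  have hi' : i ≤ k := by simpa [Nat.lt_succ_iff] using hi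
  rw [hv _ hi']; ring

/-- one-sided cutoff -/
noncomputable def hcut (y : ℝ) : ℝ := 1 - Real.smoothTransition y

lemma hcut_contDiff {n : ℕ} : ContDiff ℝ n hcut :=
  contDiff_const.sub Real.smoothTransition.contDiff

/-- derivatives of the cutoff -/
noncomputable def hk (k : ℕ) (y : ℝ) : ℝ := iteratedDeriv k hcut y

lemma hk_cont (k : ℕ) : Continuous (hk k) :=
  (hcut_contDiff (n := k)).continuous_iteratedDeriv k le_rfl

lemma hk_deriv (k : ℕ) (y : ℝ) : HasDerivAt (hk k) (hk (k + 1) y) y := by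
  have h1 : Differentiable ℝ (iteratedDeriv k hcut) :=
    (hcut_contDiff (n := k + 1)).differentiable_iteratedDeriv k (by exact_mod_cast Nat.lt_succ_self k)
  have := (h1 y).hasDerivAt
  unfold hk
  rw [iteratedDeriv_succ]
  exact this

lemma hk_one_lt (k : ℕ) {y : ℝ} (hy : 1 < y) : hk k y = 0 := by
  have : hcut =ᶠ[nhds y] fun _ => (0 : ℝ) := by
    filter_upwards [Ioi_mem_nhds hy] with z hz
    simp [hcut, Real.smoothTransition.one_of_one_le (le_of_lt hz)]
  unfold hk
  rw [this.iteratedDeriv_eq]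
  simp [iteratedDeriv_const]

lemma hk_neg (k : ℕ) {y : ℝ} (hy : y < 0) : hk k y = if k = 0 then 1 else 0 := by
  have : hcut =ᶠ[nhds y] fun _ => (1 : ℝ) := by
    filter_upwards [Iio_mem_nhds hy] with z hz
    simp [hcut, Real.smoothTransition.zero_of_nonpos (le_of_lt hz)]
  unfold hk
  rw [this.iteratedDeriv_eq]
  simp [iteratedDeriv_const]

lemma hk_bound1 (k : ℕ) : ∃ C, 0 ≤ C ∧ ∀ y, |hk k y| ≤ C := by
  obtain ⟨C, hC⟩ := (isCompact_Icc (a := (0 : ℝ)) (b := 1)).exists_bound_of_continuousOn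
    (hk_cont k).continuousOn
  refine ⟨max C 1, by positivity, fun y => ?_⟩
  by_cases h0 : y < 0
  · rw [hk_neg k h0]; split_ifs <;> simp
  by_cases h1 : 1 < y
  · rw [hk_one_lt k h1]; simp
  · exact (hC y ⟨not_lt.1 h0, not_lt.1 h1⟩).trans (le_max_left _ _)

lemma hk_bound : ∃ C, 0 ≤ C ∧ ∀ k ≤ 4, ∀ y, |hk k y| ≤ C := by
  choose C h0 h using hk_bound1
  refine ⟨∑ k ∈ Finset.range 5, C k, Finset.sum_nonneg fun i _ => h0 i, fun k hk y => ?_⟩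
  exact (h k y).trans (Finset.single_le_sum (f := C) (fun i _ => h0 i)
    (Finset.mem_range.2 (by omega)))

/-- one minus the two-sided cutoff, with derivatives -/
noncomputable def Ec (n : ℝ) (k : ℕ) (x : ℝ) : ℝ :=
  hk k (2 * n * x - 1) * (2 * n) ^ k + hk k (2 - x / n) * (-(1 / n)) ^ k

/-- two-sided cutoff, with derivatives -/
noncomputable def chi (n : ℝ) (k : ℕ) (x : ℝ) : ℝ := (if k = 0 then 1 else 0) - Ec n k x

lemma Ec_chain (n : ℝ) (m : ℕ) : Chain m (Ec n) := by
  intro k _ x _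
  have h1 : HasDerivAt (fun x : ℝ => 2 * n * x - 1) (2 * n) x := by
    simpa using ((hasDerivAt_id x).const_mul (2 * n)).sub_const 1
  have h2 : HasDerivAt (fun x : ℝ => 2 - x / n) (-(1 / n)) x := by
    simpa using ((hasDerivAt_id x).div_const n).const_sub 2
  have := (((hk_deriv k _).comp x h1).mul_const ((2 * n) ^ k)).add
    (((hk_deriv k _).comp x h2).mul_const ((-(1 / n)) ^ k))
  refine this.congr_deriv ?_
  unfold Ec
  ring

lemma chi_chain (n : ℝ) (m : ℕ) : Chain m (chi n) := by
  intro k hk x hx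
  have := (hasDerivAt_const x (if k = 0 then (1 : ℝ) else 0)).sub (Ec_chain n m k hk x hx)
  refine this.congr_deriv ?_
  simp [chi]

lemma chi_zero {n : ℝ} (hn : 1 ≤ n) (k : ℕ) {x : ℝ} (h : x ∉ Icc (1 / (2 * n)) (2 * n)) :
    chi n k x = 0 := by
  have hn0 : 0 < n := by linarith
  unfold chi Ec
  rw [mem_Icc, not_and_or, not_le, not_le] at h
  rcases h with h | h
  · rw [lt_div_iff₀ (by positivity)] at h
    have h1 : 1 < 2 - x / n := by
      have : x / n < 1 := by
        rw [div_lt_one hn0]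
        nlinarith
      linarith
    rw [hk_neg k (by linarith), hk_one_lt k h1]
    split_ifs with h0 <;> simp [h0]
  · have h1 : 2 - x / n < 0 := by
      have : 2 < x / n := by rwa [lt_div_iff₀ hn0]
      linarith
    rw [hk_neg k h1, hk_one_lt k (by nlinarith)]
    split_ifs with h0 <;> simp [h0]

lemma Ec_bound : ∃ C, 0 ≤ C ∧ ∀ n : ℝ, 1 ≤ n → ∀ k ≤ 4, ∀ x : ℝ, 0 < x →
    |Ec n k x| ≤ C * ((if x ≤ 1 / n then n ^ k else 0) + (if n ≤ x then 1 else 0)) := by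
  obtain ⟨C, hC, h⟩ := hk_bound
  refine ⟨C * 16, by positivity, fun n hn k hk4 x hx => ?_⟩
  have hn0 : 0 < n := by linarith
  unfold Ec
  rw [mul_add]
  refine (abs_add_le _ _).trans (add_le_add ?_ ?_)
  · split_ifs with hx1
    · rw [abs_mul, abs_of_pos (a := (2 * n) ^ k) (by positivity), mul_pow, mul_assoc C]
      refine mul_le_mul (h k hk4 _) (mul_le_mul_of_nonneg_right ?_ (by positivity))
        (by positivity) hC
      calc (2 : ℝ) ^ k ≤ 2 ^ 4 := pow_le_pow_right₀ (by norm_num) hk4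
        _ = 16 := by norm_num
    · rw [hk_one_lt k]; · simp
      rw [not_le, div_lt_iff₀ hn0] at hx1
      nlinarith
  · split_ifs with hx1
    · rw [abs_mul, mul_one]
      refine mul_le_mul (h k hk4 _) ?_ (abs_nonneg _) hC
      rw [abs_pow, abs_neg, abs_of_pos (by positivity)]
      have : (1 / n) ^ k ≤ 1 := pow_le_one₀ (by positivity) (by rw [div_le_one hn0]; exact hn)
      linarith
    · rw [hk_one_lt k]; · simp
      rw [not_le] at hx1
      have : x / n < 1 := by rwa [div_lt_one hn0]
      linarith

lemma poly_int (p : Polynomial ℝ) : ∃ q : Polynomial ℝ, q.derivative = p := by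
  induction p using Polynomial.induction_on' with
  | add p q hp hq =>
    obtain ⟨a, ha⟩ := hp
    obtain ⟨c, hc⟩ := hq
    exact ⟨a + c, by simp [ha, hc]⟩
  | monomial n a =>
    refine ⟨Polynomial.monomial (n + 1) (a / (n + 1)), ?_⟩
    rw [Polynomial.derivative_monomial]
    congr 1
    push_cast
    have : (n : ℝ) + 1 ≠ 0 := by positivity
    field_simp

lemma poly_chain (p : Polynomial ℝ) (m : ℕ) :
    Chain m (fun k x => (Polynomial.derivative^[k] p).eval x) := by
  intro k _ x _
  simp only [Function.iterate_succ_apply']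
  exact Polynomial.hasDerivAt _ _

lemma poly_approx {a c : ℝ} (ha : 0 < a) (hac : a ≤ c) : ∀ (n : ℕ) (F : ℕ → ℝ → ℝ), Chain n F →
    ContinuousOn (F n) (Ioi 0) → ∀ η > 0, ∃ p : Polynomial ℝ, ∀ k ≤ n, ∀ x ∈ Icc a c,
      |F k x - (Polynomial.derivative^[k] p).eval x| ≤ η := by
  intro n
  induction n with
  | zero =>
    intro F _ hc η hη
    obtain ⟨p, hp⟩ := exists_polynomial_near_of_continuousOn a c (F 0)
      (hc.mono fun x hx => lt_of_lt_of_le ha hx.1) η hη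
    refine ⟨p, fun k hk x hx => ?_⟩
    obtain rfl : k = 0 := by omega
    rw [abs_sub_comm]
    exact (hp x hx).le
  | succ n ih =>
    intro F hF hc η hη
    have hL : 0 < 1 + (c - a) := by linarith
    obtain ⟨p1, hp1⟩ := ih (fun k => F (k + 1)) (fun k hk => hF (k + 1) (by omega)) hc
      (η / (1 + (c - a))) (by positivity)
    obtain ⟨q, hq⟩ := poly_int p1
    have hle : η / (1 + (c - a)) ≤ η := div_le_self hη.le (by linarith)
    refine ⟨q + Polynomial.C (F 0 a - q.eval a), fun k hk x hx => ?_⟩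
    rcases k with _ | k
    · have hd : ∀ y ∈ Icc a c, HasDerivWithinAt
          (fun y => F 0 y - (q + Polynomial.C (F 0 a - q.eval a)).eval y)
          (F 1 y - p1.eval y) (Icc a c) y := fun y hy => by
        have h1 := hF 0 (by omega) y (lt_of_lt_of_le ha hy.1)
        have h2 := (q + Polynomial.C (F 0 a - q.eval a)).hasDerivAt y
        have := (h1.sub h2).hasDerivWithinAt (s := Icc a c)
        refine this.congr_deriv ?_
        simp [hq]
      have := (convex_Icc a c).norm_image_sub_le_of_norm_hasDerivWithin_le hd
        (fun y hy => by simpa using hp1 0 (by omega) y hy) (left_mem_Icc.2 hac) hx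
      simp only [Polynomial.eval_add, Polynomial.eval_C, add_sub_cancel, sub_self, sub_zero,
        Real.norm_eq_abs] at this
      simp only [Function.iterate_zero, id_eq, Polynomial.eval_add, Polynomial.eval_C]
      refine this.trans ?_
      rw [abs_of_nonneg (by linarith [hx.1]), div_mul_eq_mul_div, div_le_iff₀ hL]
      exact mul_le_mul_of_nonneg_left (by linarith [hx.2]) hη.le
    · simp only [Function.iterate_succ_apply]
      rw [Polynomial.derivative_add, Polynomial.derivative_C, add_zero, hq]
      exact (hp1 k (by omega) x hx).trans hle

namespace Wts
variable {D : Par} (W : Wts D)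

lemma one_le_V {k : ℕ} {x : ℝ} (hx : 0 < x) : 1 ≤ W.V k x := one_le_Wt hx

lemma mk_cpt {g : ℕ → ℝ → ℝ} (hg : Chain 4 g) (hc : ContinuousOn (g 4) (Ioi 0)) {a c : ℝ}
    (ha : 0 < a) (h0 : ∀ k ≤ 4, ∀ x ∉ Icc a c, g k x = 0) :
    ∃ u : W.YT, ∀ k ≤ 4, ∀ x : ℝ, 0 < x → W.ev k x u = g k x := by
  have hcont : ∀ k ≤ 4, ContinuousOn (g k) (Icc a c) := fun k hk => by
    have : ContinuousOn (g k) (Ioi 0) := by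
      rcases Nat.lt_or_eq_of_le hk with h | h
      · exact hg.continuousOn h
      · rw [h]; exact hc
    exact this.mono fun x hx => lt_of_lt_of_le ha hx.1
  have : ∀ k, ∃ C, 0 ≤ C ∧ (k ≤ 4 → ∀ x, |g k x| ≤ C) := by
    intro k
    by_cases hk : k ≤ 4
    · obtain ⟨C, hC⟩ := isCompact_Icc.exists_bound_of_continuousOn (hcont k hk)
      refine ⟨max C 0, le_max_right _ _, fun _ x => ?_⟩
      by_cases hx : x ∈ Icc a c
      · exact (hC x hx).trans (le_max_left _ _)
      · rw [h0 k hk x hx]; simp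
    · exact ⟨0, le_rfl, fun h => absurd h hk⟩
  choose C hC0 hC using this
  refine W.exists_mk hg hc (N := ∑ k ∈ Finset.range 5, C k) fun k hk x hx => ?_
  have h1 : C k ≤ ∑ k ∈ Finset.range 5, C k :=
    Finset.single_le_sum (f := C) (fun i _ => hC0 i) (Finset.mem_range.2 (by omega))
  have h2 := W.one_le_V (k := k) hx
  have h3 := hC k hk x
  have h4 := hC0 k
  nlinarith

lemma E_small {C : ℝ} (hC : 0 ≤ C) {n : ℝ} (hn : 1 ≤ n) {k i : ℕ} (hi : i ≤ k) {x : ℝ} (hx : 0 < x) :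
    C * ((if x ≤ 1 / n then n ^ i else 0) + (if n ≤ x then 1 else 0))
      ≤ C * (1 / n + n ^ (-W.δ)) * W.V k x := by
  have hn0 : 0 < n := by linarith
  have hV := W.V_pos (k := k) hx
  rw [mul_assoc, add_mul]
  have hnd := rpow_pos_of_pos hn0 (-W.δ)
  refine mul_le_mul_of_nonneg_left (add_le_add ?_ ?_) hC
  · split_ifs with h
    · have h1 : x ^ (-((k : ℝ) + 1)) ≤ W.V k x := by
        refine rpow_le_Wt hx ?_ ?_
        · have := W.hQY k; linarith
        · have := W.hPY k
          have := W.hδ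
          have : (0 : ℝ) ≤ k := Nat.cast_nonneg k
          linarith
      have h2 : n ^ (k + 1) ≤ x ^ (-((k : ℝ) + 1)) := by
        rw [rpow_neg hx.le, ← inv_rpow hx.le]
        have : (x⁻¹) ^ ((k : ℝ) + 1) = (x⁻¹) ^ (k + 1) := by
          rw [← rpow_natCast]; push_cast; rfl
        rw [this]
        refine pow_le_pow_left₀ hn0.le ?_ _
        rw [le_inv_comm₀ hn0 hx]; simpa using h
      have h3 : n ^ i ≤ n ^ k := pow_le_pow_right₀ hn hi
      calc n ^ i ≤ n ^ k := h3
        _ = 1 / n * n ^ (k + 1) := by rw [pow_succ]; field_simp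
        _ ≤ _ := mul_le_mul_of_nonneg_left (h2.trans h1) (by positivity)
    · positivity
  · split_ifs with h
    · have h1 : x ^ W.δ ≤ W.V k x := by
        refine rpow_le_Wt hx ?_ (W.hPY k)
        have := W.hQY k
        have := W.hδ
        have : (0 : ℝ) ≤ k := Nat.cast_nonneg k
        linarith
      calc (1 : ℝ) = n ^ (-W.δ) * n ^ W.δ := by rw [← rpow_add hn0]; simp
        _ ≤ _ := mul_le_mul_of_nonneg_left
          ((rpow_le_rpow hn0.le h W.hδ.le).trans h1) hnd.le
    · positivity

theorem density {F : ℕ → ℝ → ℝ} (hF : Chain 4 F) (hF4 : ContinuousOn (F 4) (Ioi 0)) {M : ℝ}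
    (hM : 0 ≤ M) (hb : ∀ k ≤ 4, ∀ x : ℝ, 0 < x → |F k x| ≤ M) {f : W.YT}
    (hf : ∀ k ≤ 4, ∀ x : ℝ, 0 < x → W.ev k x f = F k x) :
    ∀ ε > 0, ∃ g v : W.YT, ‖f - g‖ < ε ∧ ∀ x : ℝ, 0 < x → W.ev 0 x v = W.Lop x g := by
  intro ε hε
  obtain ⟨C, hC, hE⟩ := Ec_bound
  -- choose n
  have ht : Filter.Tendsto (fun n : ℝ => 16 * (C * (1 / n + n ^ (-W.δ)) * M))
      Filter.atTop (nhds 0) := by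
    have h1 : Filter.Tendsto (fun n : ℝ => 1 / n) Filter.atTop (nhds 0) := by
      simpa using tendsto_inv_atTop_zero (𝕜 := ℝ)
    have := ((((h1.add (tendsto_rpow_neg_atTop W.hδ)).const_mul C).mul_const M).const_mul 16)
    simpa using this
  obtain ⟨n, hnε, hn⟩ := ((ht.eventually (gt_mem_nhds (show 0 < ε / 4 by positivity))).and
    (Filter.eventually_ge_atTop 1)).exists
  have hn0 : 0 < n := by linarith
  have ha : 0 < 1 / (2 * n) := by positivity
  have hac : 1 / (2 * n) ≤ 2 * n := by
    rw [div_le_iff₀ (by positivity)]; nlinarith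
  set N : ℝ := 1 + C * (n ^ 4 + 1) with hN
  have hN0 : 0 < N := by positivity
  have hchi : ∀ k ≤ 4, ∀ x : ℝ, 0 < x → |chi n k x| ≤ N := fun k hk x hx => by
    have h1 := hE n hn k hk x hx
    have h2 : (if x ≤ 1 / n then n ^ k else 0) + (if n ≤ x then (1 : ℝ) else 0) ≤ n ^ 4 + 1 := by
      have h3 : n ^ k ≤ n ^ 4 := pow_le_pow_right₀ hn hk
      have h4 : 0 < n ^ 4 := by positivity
      split_ifs <;> linarith
    have h5 := mul_le_mul_of_nonneg_left h2 hC
    unfold chi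
    refine (abs_sub _ _).trans ?_
    have : |(if k = 0 then (1 : ℝ) else 0)| ≤ 1 := by split_ifs <;> simp
    linarith
  obtain ⟨p, hp⟩ := poly_approx ha hac 4 F hF hF4 (ε / (64 * N)) (by positivity)
  set q : ℕ → ℝ → ℝ := fun k x => (Polynomial.derivative^[k] p).eval x with hq
  have hg : ∀ m, Chain m (pr (chi n) q) := fun m => (chi_chain n m).pr (poly_chain p m)
  have hgc : ∀ k, ContinuousOn (pr (chi n) q k) (Ioi 0) := fun k =>
    (hg (k + 1)).continuousOn (Nat.lt_succ_self k)
  have hg0 : ∀ k, ∀ x ∉ Icc (1 / (2 * n)) (2 * n), pr (chi n) q k x = 0 := fun k x hx =>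
    pr_eq_zero_left fun i _ => chi_zero hn i hx
  obtain ⟨g, hgv⟩ := W.mk_cpt (hg 4) (hgc 4) ha fun k _ => hg0 k
  have hLc : Chain 4 (fun k x => pr D.a (fun j => pr (chi n) q (j + 2)) k x
      + pr D.b (fun j => pr (chi n) q (j + 1)) k x) := by
    intro k hk x hx
    refine HasDerivAt.add ?_ ?_
    · exact Chain.pr (n := 4) (fun k _ x hx => D.a_hasDerivAt k hx)
        (fun k _ x hx => hg (k + 3) (k + 2) (by omega) x hx) k hk x hx
    · exact Chain.pr (n := 4) D.hchain
        (fun k _ x hx => hg (k + 2) (k + 1) (by omega) x hx) k hk x hx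
  obtain ⟨v, hv⟩ := W.mk_cpt hLc ((pr_continuousOn (fun i _ => a_continuousOn D i)
      (fun i _ => hgc (i + 2))).add (pr_continuousOn (fun i hi => b_continuousOn D i hi)
      (fun i _ => hgc (i + 1)))) ha (fun k _ x hx => by
        rw [pr_eq_zero_right fun i _ => hg0 (i + 2) x hx,
          pr_eq_zero_right fun i _ => hg0 (i + 1) x hx, add_zero])
  refine ⟨g, v, ?_, fun x hx => ?_⟩
  · suffices h : ‖f - g‖ ≤ ε / 2 by linarith
    refine W.norm_le _ (by positivity) fun k hk x hx => ?_
    have hV := W.one_le_V (k := k) hx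
    have h2k : (2 : ℝ) ^ k ≤ 16 := by
      calc (2 : ℝ) ^ k ≤ 2 ^ 4 := pow_le_pow_right₀ (by norm_num) hk
        _ = 16 := by norm_num
    rw [map_sub, hf k hk x hx, hgv k hk x hx]
    have e1 : F k x - pr (chi n) q k x = pr (Ec n) F k x
        + pr (chi n) (fun j y => F j y - q j y) k x := by
      have e2 : F k x = pr (fun k _ => if k = 0 then (1 : ℝ) else 0) F k x := by
        unfold pr
        rw [Finset.sum_eq_single 0]
        · simp
        · intro i _ hi; simp [hi]
        · simp
      rw [e2]
      unfold pr chi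
      rw [← Finset.sum_sub_distrib, ← Finset.sum_add_distrib]
      refine Finset.sum_congr rfl fun i _ => ?_
      ring
    rw [e1]
    refine (abs_add_le _ _).trans ?_
    have b1 : |pr (Ec n) F k x| ≤ ε / 4 * W.V k x := by
      have h1 := pr_bound (u := Ec n) (v := F) (k := k) (x := x)
        (A := C * (1 / n + n ^ (-W.δ)) * W.V k x) (B := M) (by positivity)
        (fun i hi => (hE n hn i (by omega) x hx).trans (W.E_small hC hn hi hx))
        (fun i hi => hb i (by omega) x hx)
      refine h1.trans ?_
      have hκ : 0 ≤ C * (1 / n + n ^ (-W.δ)) * M := by positivity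
      calc 2 ^ k * (C * (1 / n + n ^ (-W.δ)) * W.V k x * M)
          = 2 ^ k * (C * (1 / n + n ^ (-W.δ)) * M) * W.V k x := by ring
        _ ≤ ε / 4 * W.V k x := by
          refine mul_le_mul_of_nonneg_right ?_ (by linarith)
          exact (mul_le_mul_of_nonneg_right h2k hκ).trans hnε.le
    have b2 : |pr (chi n) (fun j y => F j y - q j y) k x| ≤ ε / 4 := by
      by_cases hxm : x ∈ Icc (1 / (2 * n)) (2 * n)
      · have h1 := pr_bound (u := chi n) (v := fun j y => F j y - q j y) (k := k) (x := x)
          (A := N) (B := ε / (64 * N)) hN0.le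
          (fun i hi => hchi i (by omega) x hx) (fun i hi => hp i (by omega) x hxm)
        refine h1.trans ?_
        have : N * (ε / (64 * N)) = ε / 64 := by field_simp
        rw [this]
        nlinarith
      · rw [pr_eq_zero_left fun i _ => chi_zero hn i hxm]; simp; positivity
    have : ε / 4 ≤ ε / 4 * W.V k x := by nlinarith
    linarith
  · rw [hv 0 (by omega) x hx, Lop_apply, ← ev_apply, ← ev_apply, hgv 2 (by omega) x hx,
      hgv 1 (by omega) x hx, pr_zero, pr_zero]

end Wts
end KPde

namespace KPde

/-- five-term sequence -/
def sq {β : Type} (a b c d e : β) : ℕ → β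
  | 0 => a
  | 1 => b
  | 2 => c
  | 3 => d
  | _ => e

lemma exists_wts (D : Par) {P3 Q3 Q4 : ℝ} (hg2 : 1 ≤ D.g2)
    (h1 : 2 * D.g2 ≤ P3) (h2 : D.g3 ≤ P3) (h3 : P3 + D.g2 ≤ D.β) (h4 : D.g2 + D.g3 ≤ D.β)
    (h5 : D.g4 ≤ D.β) (q1 : 2 * D.c2 ≤ Q3) (q2 : D.c3 ≤ Q3) (q3 : D.c2 + 3 - 2 * D.α ≤ Q3)
    (q4 : D.c2 + Q3 ≤ Q4) (q5 : 3 - 2 * D.α + Q3 ≤ Q4) (q6 : D.c2 + D.c3 ≤ Q4)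
    (q7 : D.c2 + (4 - 2 * D.α) ≤ Q4) (q8 : D.c4 ≤ Q4) :
    ∃ W : Wts D, W.PX = sq 0 0 D.g2 P3 D.β ∧ W.QX = sq 0 0 D.c2 Q3 Q4 := by
  have hβ := D.hβ
  have hg3 := D.hg3
  have hg4 := D.hg4
  have hc2 := D.hc2
  have hc3 := D.hc3
  have hc4 := D.hc4
  have hα := D.hα
  set δ : ℝ := 1 / (2 * (D.β + 1)) with hδ
  have hδ0 : 0 < δ := by positivity
  have hδ2 : 2 * δ = 1 / (D.β + 1) := by rw [hδ]; field_simp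
  have hβ1 : 0 < 1 / (D.β + 1) := by positivity
  set G : ℝ := 3 + 2 * D.α + D.c2 + D.c3 + D.c4 with hG
  set G' : ℝ := 3 * G + 8 * D.α + D.c2 + G with hG'
  have hX : Adm D (sq 0 0 D.g2 P3 D.β) (sq 0 0 D.c2 Q3 Q4) := by
    constructor
    · rintro (_ | _ | _ | _ | _) <;> simp only [sq] <;> linarith
    · rintro (_ | _ | _ | _ | _) <;> simp only [sq] <;> linarith
    · rintro (_ | _ | _ | _ | _) <;> simp only [sq] <;> linarith
    · rintro (_ | _ | _ | _ | _) <;> simp only [sq]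
      · left; trivial
      · left; trivial
      all_goals right; left; linarith
    · left; rfl
    all_goals simp only [sq]; linarith
  have gen : ∀ d H : ℝ, 0 ≤ d → d ≤ 2 * δ → G ≤ H →
      Adm D (sq d d (D.g2 + d) (P3 + d) (D.β + d)) (fun k => ((k : ℝ) + 1) * H) := by
    intro d H hd hd2 hH
    have hG1 : 3 + 2 * D.α + D.c2 + D.c3 + D.c4 ≤ H := hH
    have hQ1 : ∀ k : ℕ, H ≤ ((k : ℝ) + 1) * H := fun k => by
      have : (0 : ℝ) ≤ k := Nat.cast_nonneg k
      nlinarith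
    constructor
    · rintro (_ | _ | _ | _ | _) <;> simp only [sq] <;> linarith
    · intro k
      have := hQ1 k
      linarith
    · rintro (_ | _ | _ | _ | _) <;> simp only [sq] <;> linarith
    · intro k
      have := hQ1 k
      right; right
      linarith
    · right
      have := hQ1 0
      linarith
    all_goals (try simp only [sq]); (try push_cast); linarith
  obtain ⟨o1, ho1, hX'⟩ := good_of_adm hX
  obtain ⟨o2, ho2, hY'⟩ := good_of_adm (gen δ G hδ0.le (by linarith) le_rfl)
  obtain ⟨o3, ho3, hZ'⟩ := good_of_adm (gen (2 * δ) G' (by linarith) le_rfl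
    (by rw [hG', hG]; linarith))
  obtain ⟨o4, ho4, hL⟩ := lyap_zero D (p := 2 * D.α) (q := 0) (by linarith) le_rfl
    (Or.inr (Or.inl (by linarith))) (by
      have h1 := D.hB2b
      have h2 : 0 < D.σ ^ 2 := by have := D.hσ; positivity
      have h3 : D.σ ^ 2 / 2 * (2 * D.α - 1) - D.B2 ≤ 0 := by nlinarith
      nlinarith) (Or.inl rfl)
  have hG0 : 0 < G := by rw [hG]; linarith
  have hG1 : 1 ≤ G := by rw [hG]; linarith
  refine ⟨{
    PX := sq 0 0 D.g2 P3 D.β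
    QX := sq 0 0 D.c2 Q3 Q4
    PY := sq δ δ (D.g2 + δ) (P3 + δ) (D.β + δ)
    QY := fun k => ((k : ℝ) + 1) * G
    PZ := sq (2 * δ) (2 * δ) (D.g2 + 2 * δ) (P3 + 2 * δ) (D.β + 2 * δ)
    QZ := fun k => ((k : ℝ) + 1) * G'
    δ := δ
    q := 3 * G
    ω := o1 + o2 + o3 + o4
    hω := by linarith
    gX := hX' _ (by linarith)
    gY := hY' _ (by linarith)
    gZ := hZ' _ (by linarith)
    hly := fun x hx => (hL x hx).trans (mul_le_mul_of_nonneg_right (by linarith) (Wt_pos hx).le)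
    hδ := hδ0
    hPY0 := rfl
    hPY1 := rfl
    hPY2 := rfl
    hPY := ?_
    hQY := ?_
    hq := ?_
    hPZ := ?_
    hPZ4 := ?_
    hQZ := ?_ }, rfl, rfl⟩
  · rintro (_ | _ | _ | _ | _) <;> simp only [sq] <;> linarith
  · intro k
    have : (0 : ℝ) ≤ k := Nat.cast_nonneg k
    nlinarith
  · intro k hk
    have : (k : ℝ) ≤ 2 := by exact_mod_cast hk
    nlinarith
  · rintro (_ | _ | _ | _ | _) hk <;> simp only [sq] <;> first | linarith | omega
  · simp only [sq]; linarith
  · intro k _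
    have : (0 : ℝ) ≤ k := Nat.cast_nonneg k
    have h6 : 0 < G' := by rw [hG']; linarith
    nlinarith

lemma lipbd {g : ℝ → ℝ} {γ' γ : ℝ} (h' : 0 ≤ γ') (h : 0 ≤ γ)
    (hl : ∃ L : ℝ, 0 ≤ L ∧ ∀ x y : ℝ, 0 < x → 0 < y →
      |g x - g y| ≤ L * (1 + x ^ γ' + y ^ γ' + x ^ (-γ) + y ^ (-γ)) * |x - y|) :
    ∃ K, 0 ≤ K ∧ ∀ x : ℝ, 0 < x → |g x| ≤ K * Wt (γ' + 1) γ x := by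
  obtain ⟨L, hL, hl⟩ := hl
  refine ⟨|g 1| + L * 10, by positivity, fun x hx => ?_⟩
  have h1 := hl x 1 hx one_pos
  rw [one_rpow, one_rpow] at h1
  have e0 : 1 ≤ Wt (γ' + 1) γ x := one_le_Wt hx
  have e1 : x ≤ Wt (γ' + 1) γ x := by
    have := rpow_le_Wt (p := γ' + 1) (q := γ) (r := 1) hx (by linarith) (by linarith)
    rwa [rpow_one] at this
  have e2 : x ^ γ' ≤ Wt (γ' + 1) γ x := rpow_le_Wt hx (by linarith) (by linarith)
  have e3 : x ^ γ' * x ≤ Wt (γ' + 1) γ x := by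
    rw [← rpow_add_one hx.ne']
    exact rpow_le_Wt hx (by linarith) (by linarith)
  have e4 : x ^ (-γ) ≤ Wt (γ' + 1) γ x := rpow_le_Wt hx (by linarith) (by linarith)
  have e5 : x ^ (-γ) * x ≤ Wt (γ' + 1) γ x := by
    rw [← rpow_add_one hx.ne']
    exact rpow_le_Wt hx (by linarith) (by linarith)
  have hp1 := rpow_pos_of_pos hx γ'
  have hp2 := rpow_pos_of_pos hx (-γ)
  have h2 : |x - 1| ≤ x + 1 := by rw [abs_le]; constructor <;> linarith
  have h3 : (1 + x ^ γ' + 1 + x ^ (-γ) + 1) * |x - 1| ≤ 10 * Wt (γ' + 1) γ x := by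
    refine (mul_le_mul_of_nonneg_left h2 (by positivity)).trans ?_
    nlinarith
  have h4 := mul_le_mul_of_nonneg_left h3 hL
  have h5 : |g x| ≤ |g 1| + |g x - g 1| := by
    have := abs_add_le (g 1) (g x - g 1)
    rwa [add_sub_cancel] at this
  have h6 : |g 1| ≤ |g 1| * Wt (γ' + 1) γ x := le_mul_of_one_le_right (abs_nonneg _) e0
  rw [← mul_assoc] at h4
  rw [add_mul, mul_assoc L]
  linarith

lemma lipbd0 {α : ℝ} (hα : 1 < α) {b b1 : ℝ → ℝ} (hb0 : 0 ≤ b 0)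
    (hb1 : ∀ x ∈ Ioi (0 : ℝ), HasDerivAt b (b1 x) x)
    (hblip : ∃ L : ℝ, 0 ≤ L ∧ ∀ u v : ℝ, 0 ≤ u → 0 ≤ v →
      |b u - b v| ≤ L * (1 + u ^ (2 * (α - 1)) + v ^ (2 * (α - 1))) * |u - v|) :
    ∃ K, 0 ≤ K ∧ ∀ x : ℝ, 0 < x → -(K * (x + x ^ (2 * α - 1))) ≤ b x ∧
      |b x| ≤ K * (1 + x ^ (2 * α - 1)) ∧ |b1 x| ≤ K * (1 + x ^ (2 * α - 2)) := by
  obtain ⟨L, hL, hl⟩ := hblip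
  have e : 2 * (α - 1) = 2 * α - 2 := by ring
  rw [e] at hl
  refine ⟨b 0 + 2 * L, by positivity, fun x hx => ?_⟩
  have hx1 := rpow_pos_of_pos hx (2 * α - 1)
  have hx2 := rpow_pos_of_pos hx (2 * α - 2)
  have h1 := hl x 0 hx.le le_rfl
  rw [zero_rpow (by linarith), sub_zero, abs_of_pos hx] at h1
  have e2 : x ^ (2 * α - 2) * x = x ^ (2 * α - 1) := by
    rw [← rpow_add_one hx.ne']; congr 1; ring
  have h2 : L * (1 + x ^ (2 * α - 2) + 0) * x = L * (x + x ^ (2 * α - 1)) := by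
    rw [← e2]; ring
  rw [h2] at h1
  have h3 : x ≤ 1 + x ^ (2 * α - 1) := by
    rcases le_total x 1 with h | h
    · linarith
    · have := rpow_le_rpow_of_exponent_le h (show (1 : ℝ) ≤ 2 * α - 1 by linarith)
      rw [rpow_one] at this
      linarith
  have h4 := abs_le.1 h1
  have hbx : 0 ≤ b 0 * (x + x ^ (2 * α - 1)) := by positivity
  have hbx2 : 0 ≤ b 0 * x ^ (2 * α - 1) := by positivity
  have hLx : 0 ≤ L * (x + x ^ (2 * α - 1)) := by positivity
  have hL3 : L * x ≤ L * (1 + x ^ (2 * α - 1)) := mul_le_mul_of_nonneg_left h3 hL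
  refine ⟨by nlinarith, ?_, ?_⟩
  · rw [abs_le]; constructor <;> nlinarith
  · have h5 : ‖b1 x‖ ≤ L * (1 + (x ^ (2 * α - 2) + 1) + x ^ (2 * α - 2)) := by
      refine (hb1 x hx).le_of_lip' (by positivity) ?_
      have hc : ContinuousAt (fun y : ℝ => y ^ (2 * α - 2)) x :=
        continuousAt_rpow_const _ _ (Or.inl hx.ne')
      filter_upwards [hc.eventually (gt_mem_nhds (show x ^ (2 * α - 2) < x ^ (2 * α - 2) + 1 by
        linarith)), Ioi_mem_nhds hx] with y hy hy0
      refine (hl y x (le_of_lt hy0) hx.le).trans ?_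
      refine mul_le_mul_of_nonneg_right (mul_le_mul_of_nonneg_left ?_ hL) (abs_nonneg _)
      linarith
    rw [Real.norm_eq_abs] at h5
    nlinarith

theorem core (D : Par) (W : Wts D) {F : ℕ → ℝ → ℝ} (hF : Chain 4 F)
    (hF4 : ContinuousOn (F 4) (Ioi 0)) {M : ℝ}
    (hb : ∀ k ≤ 4, ∀ x : ℝ, 0 < x → |F k x| ≤ M) {T : ℝ} (hT : 0 < T) :
    ∃ (u : ℝ → ℕ → ℝ → ℝ) (ut : ℝ → ℝ → ℝ) (C : ℝ), 0 ≤ C ∧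
      (∀ t ∈ Icc (0 : ℝ) T, ∀ x ∈ Ioi (0 : ℝ),
        HasDerivWithinAt (fun s => u s 0 x) (ut t x) (Icc 0 T) t) ∧
      (∀ t, Chain 4 (u t)) ∧
      (∀ x ∈ Ioi (0 : ℝ), ContinuousOn (fun t => ut t x) (Icc 0 T)) ∧
      (∀ t, ContinuousOn (u t 4) (Ioi 0)) ∧
      (∀ t, ∀ x : ℝ, ut t x + D.b 0 x * u t 1 x + D.a 0 x * u t 2 x = 0) ∧
      (∀ x ∈ Ioi (0 : ℝ), u T 0 x = F 0 x) ∧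
      (∀ t ∈ Icc (0 : ℝ) T, ∀ x : ℝ, 0 < x → ∀ k ≤ 4, |u t k x| ≤ C * Wt (W.PX k) (W.QX k) x) ∧
      (∀ t ∈ Icc (0 : ℝ) T, ∀ x : ℝ, 0 < x → |ut t x| ≤ C * Wt (2 * D.α) 0 x) := by
  have hM : 0 ≤ M := (abs_nonneg _).trans (hb 0 (by omega) 1 one_pos)
  obtain ⟨f, hf⟩ := W.exists_mk hF hF4 (N := M) fun k hk x hx =>
    (hb k hk x hx).trans (le_mul_of_one_le_right hM (W.one_le_V hx))
  obtain ⟨U, hUc, hU0, hder, hX, hL⟩ := W.semigroup (W.density hF hF4 hM hb hf) hT.le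
  have hσ := D.hσ
  have hα := D.hα
  have hK := D.hK
  set M' : ℝ := M * (D.σ ^ 2 / 2 + 2 * D.K) with hM'
  have hM'0 : 0 ≤ M' := by positivity
  have hX' := hX M hM fun k hk x hx => by
    rw [hf k hk x hx]
    exact (hb k hk x hx).trans (le_mul_of_one_le_right hM (one_le_Wt hx))
  have hL' := hL M' hM'0 fun x hx => by
    rw [Wts.Lop_apply, ← Wts.ev_apply, ← Wts.ev_apply, hf 2 (by omega) x hx, hf 1 (by omega) x hx]
    have a1 : |D.a 0 x| ≤ D.σ ^ 2 / 2 * Wt (2 * D.α) 0 x := by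
      rw [D.a_zero, abs_of_pos (by positivity)]
      exact mul_le_mul_of_nonneg_left (rpow_le_Wt hx (by linarith) le_rfl) (by positivity)
    have a2 : |D.b 0 x| ≤ 2 * D.K * Wt (2 * D.α) 0 x := by
      refine (D.habs x hx).trans ?_
      have e1 : x ^ (2 * D.α - 1) ≤ Wt (2 * D.α) 0 x := rpow_le_Wt hx (by linarith) (by linarith)
      have e2 : 1 ≤ Wt (2 * D.α) 0 x := one_le_Wt hx
      nlinarith
    refine (abs_add_le _ _).trans ?_
    rw [abs_mul, abs_mul]
    have m1 := mul_le_mul a1 (hb 2 (by omega) x hx) (abs_nonneg _) ((abs_nonneg _).trans a1)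
    have m2 := mul_le_mul a2 (hb 1 (by omega) x hx) (abs_nonneg _) ((abs_nonneg _).trans a2)
    rw [hM']
    linarith
  have hexp := Real.exp_pos (2 * W.ω * T)
  have hmem : ∀ t ∈ Icc (0 : ℝ) T, T - t ∈ Icc (0 : ℝ) T := fun t ht =>
    ⟨by linarith [ht.2], by linarith [ht.1]⟩
  refine ⟨fun t k x => W.ev k x (U (T - t)), fun t x => -(W.Lop x (U (T - t))),
    (M + M') * Real.exp (2 * W.ω * T), by positivity, fun t ht x hx => ?_, fun t => W.chain _,
    fun x _ => ?_, fun t => W.fn_continuousOn _ 4, fun t x => ?_, fun x hx => ?_,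
    fun t ht x hx k hk => ?_, fun t ht x hx => ?_⟩
  · have h1 : HasDerivWithinAt (fun s : ℝ => T - s) (-1) (Icc 0 T) t :=
      (by simpa using (hasDerivAt_id t).const_sub T : HasDerivAt (fun s : ℝ => T - s) (-1) t).hasDerivWithinAt
    have := HasDerivWithinAt.scomp t (hder x hx (T - t) (hmem t ht)) h1 hmem
    refine this.congr_deriv ?_
    simp
  · exact (((W.Lop x).continuous.comp (hUc.comp (continuous_const.sub continuous_id))).neg).continuousOn
  · simp only [Wts.Lop_apply, Wts.ev_apply]; ring
  · simp only [sub_self, hU0]; exact hf 0 (by omega) x hx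
  · refine (hX' (T - t) (hmem t ht) k hk x hx).trans ?_
    refine mul_le_mul_of_nonneg_right (mul_le_mul_of_nonneg_right (by linarith) hexp.le) (Wt_pos hx).le
  · rw [abs_neg]
    refine (hL' (T - t) (hmem t ht) x hx).trans ?_
    refine mul_le_mul_of_nonneg_right (mul_le_mul_of_nonneg_right (by linarith) hexp.le) (Wt_pos hx).le

end KPde

/-- Regularity of the backward Kolmogorov PDE: under the standing assumptions
on `α, σ, b` (with derivatives `b1, …, b4` that are `(γ̄ᵢ, γᵢ)`-locally Lipschitz) and the
constraints on `B₂, B₂′`, for every bounded `C⁴` terminal condition `f` with bounded derivatives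
there is a `C^{1,4}` solution `u` of the PDE
`∂ₜu + b ∂ₓu + (σ²/2) x^{2α} ∂ₓₓu = 0`, `u(T,·) = f`, whose space and time derivatives satisfy
the stated polynomial bounds. -/
theorem stmt_7 (α σ B₁ B₂ B₁' B₂' T : ℝ)
    (γ'₁ γ'₂ γ'₃ γ'₄ γ₁ γ₂ γ₃ γ₄ : ℝ)
    (b b1 b2 b3 b4 : ℝ → ℝ)
    (hα : 1 < α) (hσ : 0 < σ) (hT : 0 < T)
    (hB₁ : 0 ≤ B₁) (hB₂ : 0 ≤ B₂) (hB₁' : 0 ≤ B₁') (hB₂' : 0 ≤ B₂')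
    (hγ'₁ : 0 ≤ γ'₁) (hγ'₂ : 0 ≤ γ'₂) (hγ'₃ : 0 ≤ γ'₃) (hγ'₄ : 0 ≤ γ'₄)
    (hγ₁ : 0 ≤ γ₁) (hγ₂ : 0 ≤ γ₂) (hγ₃ : 0 ≤ γ₃) (hγ₄ : 0 ≤ γ₄)
    (hb0 : 0 ≤ b 0)
    -- `b` is four times continuously differentiable on `(0,∞)`
    (hb1 : ∀ x ∈ Ioi (0 : ℝ), HasDerivAt b (b1 x) x)
    (hb2 : ∀ x ∈ Ioi (0 : ℝ), HasDerivAt b1 (b2 x) x)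
    (hb3 : ∀ x ∈ Ioi (0 : ℝ), HasDerivAt b2 (b3 x) x)
    (hb4 : ∀ x ∈ Ioi (0 : ℝ), HasDerivAt b3 (b4 x) x)
    (hb4cont : ContinuousOn b4 (Ioi 0))
    -- `b` is `2(α−1)`-locally Lipschitz on `[0,∞)`
    (hblip : ∃ L : ℝ, 0 ≤ L ∧ ∀ u v : ℝ, 0 ≤ u → 0 ≤ v →
      |b u - b v| ≤ L * (1 + u ^ (2 * (α - 1)) + v ^ (2 * (α - 1))) * |u - v|)
    -- the derivatives `b^{(i)}` are `(γ̄ᵢ, γᵢ)`-locally Lipschitz on `(0,∞)`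
    (hb1lip : ∃ L : ℝ, 0 ≤ L ∧ ∀ x y : ℝ, 0 < x → 0 < y →
      |b1 x - b1 y| ≤ L * (1 + x ^ γ'₁ + y ^ γ'₁ + x ^ (-γ₁) + y ^ (-γ₁)) * |x - y|)
    (hb2lip : ∃ L : ℝ, 0 ≤ L ∧ ∀ x y : ℝ, 0 < x → 0 < y →
      |b2 x - b2 y| ≤ L * (1 + x ^ γ'₂ + y ^ γ'₂ + x ^ (-γ₂) + y ^ (-γ₂)) * |x - y|)
    (hb3lip : ∃ L : ℝ, 0 ≤ L ∧ ∀ x y : ℝ, 0 < x → 0 < y →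
      |b3 x - b3 y| ≤ L * (1 + x ^ γ'₃ + y ^ γ'₃ + x ^ (-γ₃) + y ^ (-γ₃)) * |x - y|)
    (hb4lip : ∃ L : ℝ, 0 ≤ L ∧ ∀ x y : ℝ, 0 < x → 0 < y →
      |b4 x - b4 y| ≤ L * (1 + x ^ γ'₄ + y ^ γ'₄ + x ^ (-γ₄) + y ^ (-γ₄)) * |x - y|)
    -- growth conditions
    (hbgrowth : ∀ z : ℝ, 0 < z → b z ≤ B₁ * z - B₂ * z ^ (2 * α - 1) + b 0)
    (hb'growth : ∀ z : ℝ, 0 < z → b1 z ≤ B₁' - B₂' * z ^ (2 * (α - 1)))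
    -- constraints on the constants, with `β̄̄ = max(3(γ̄₂+1), γ̄₂+γ̄₃+2, γ̄₄+1)`
    (hB₂cond : B₂ ≥ 3 * σ ^ 2 * α + σ ^ 2 / 2
      * (max (2 * (max (max (3 * (γ'₂ + 1)) (γ'₂ + γ'₃ + 2)) (γ'₄ + 1)))
          ((max (max (3 * (γ'₂ + 1)) (γ'₂ + γ'₃ + 2)) (γ'₄ + 1)) + 2 * α) - 1))
    (hB₂'cond : B₂' ≥ σ ^ 2 * α * (17 * α / 2 - 3))
    (hb0pos : 0 < b 0 → (3 / 2 < α ∧ B₂ ≥ 3 * σ ^ 2 * α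
      + max (α ^ 2 / 2) (σ ^ 2 / 2
        * (max (2 * (max (max (3 * (γ'₂ + 1)) (γ'₂ + γ'₃ + 2)) (γ'₄ + 1)))
            ((max (max (3 * (γ'₂ + 1)) (γ'₂ + γ'₃ + 2)) (γ'₄ + 1)) + 2 * α) - 1))))
    -- the terminal condition: `f` is bounded `C⁴` with bounded derivatives
    (f f1 f2 f3 f4 : ℝ → ℝ)
    (hf1 : ∀ x ∈ Ioi (0 : ℝ), HasDerivAt f (f1 x) x)
    (hf2 : ∀ x ∈ Ioi (0 : ℝ), HasDerivAt f1 (f2 x) x)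
    (hf3 : ∀ x ∈ Ioi (0 : ℝ), HasDerivAt f2 (f3 x) x)
    (hf4 : ∀ x ∈ Ioi (0 : ℝ), HasDerivAt f3 (f4 x) x)
    (hf4cont : ContinuousOn f4 (Ioi 0))
    (hfbdd : ∃ M : ℝ, ∀ x : ℝ, 0 < x →
      |f x| ≤ M ∧ |f1 x| ≤ M ∧ |f2 x| ≤ M ∧ |f3 x| ≤ M ∧ |f4 x| ≤ M) :
    -- conclusion: existence of a `C^{1,4}` solution `u` with the stated bounds, where
    -- `β̄ = max(2(γ̄₂+1), 1+γ̄₃)`, `β = max(2γ₂, γ₃, γ₂+3−2α)`,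
    -- `β̲̲ = max(max(γ₂, 3−2α)+β, γ₂+max(γ₃, 4−2α), γ₄)`
    ∃ (u ut ux uxx uxxx uxxxx : ℝ → ℝ → ℝ) (C : ℝ), 0 ≤ C ∧
      (∀ t ∈ Icc (0 : ℝ) T, ∀ x ∈ Ioi (0 : ℝ),
        HasDerivWithinAt (fun s => u s x) (ut t x) (Icc 0 T) t ∧
        HasDerivAt (fun y => u t y) (ux t x) x ∧
        HasDerivAt (fun y => ux t y) (uxx t x) x ∧
        HasDerivAt (fun y => uxx t y) (uxxx t x) x ∧
        HasDerivAt (fun y => uxxx t y) (uxxxx t x) x) ∧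
      (∀ x ∈ Ioi (0 : ℝ), ContinuousOn (fun t => ut t x) (Icc 0 T)) ∧
      (∀ t ∈ Icc (0 : ℝ) T, ContinuousOn (fun y => uxxxx t y) (Ioi 0)) ∧
      (∀ t ∈ Ico (0 : ℝ) T, ∀ x ∈ Ioi (0 : ℝ),
        ut t x + b x * ux t x + σ ^ 2 / 2 * x ^ (2 * α) * uxx t x = 0) ∧
      (∀ x ∈ Ioi (0 : ℝ), u T x = f x) ∧
      (∀ t ∈ Icc (0 : ℝ) T, ∀ x ∈ Ioi (0 : ℝ),
        |u t x| ≤ C ∧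
        |ux t x| ≤ C ∧
        |ut t x| ≤ C * (1 + x ^ (2 * α)) ∧
        |uxx t x| ≤ C * (1 + x ^ (γ'₂ + 1) + x ^ (-γ₂)) ∧
        |uxxx t x| ≤ C * (1 + x ^ (max (2 * (γ'₂ + 1)) (1 + γ'₃))
          + x ^ (-(max (max (2 * γ₂) γ₃) (γ₂ + 3 - 2 * α)))) ∧
        |uxxxx t x| ≤ C * (1 + x ^ (max (max (3 * (γ'₂ + 1)) (γ'₂ + γ'₃ + 2)) (γ'₄ + 1))
          + x ^ (-(max (max ((max γ₂ (3 - 2 * α)) + (max (max (2 * γ₂) γ₃) (γ₂ + 3 - 2 * α)))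
              (γ₂ + max γ₃ (4 - 2 * α))) γ₄)))) := by
  obtain ⟨K0, hK0, hK0'⟩ := KPde.lipbd0 hα hb0 hb1 hblip
  obtain ⟨K2, hK2, hK2'⟩ := KPde.lipbd hγ'₂ hγ₂ hb2lip
  obtain ⟨K3, hK3, hK3'⟩ := KPde.lipbd hγ'₃ hγ₃ hb3lip
  obtain ⟨K4, hK4, hK4'⟩ := KPde.lipbd hγ'₄ hγ₄ hb4lip
  obtain ⟨M, hM⟩ := hfbdd
  clear hb0pos hb1lip hb2lip hb3lip hb4lip hblip
  set β : ℝ := max (max (3 * (γ'₂ + 1)) (γ'₂ + γ'₃ + 2)) (γ'₄ + 1) with hβ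
  set P3 : ℝ := max (2 * (γ'₂ + 1)) (1 + γ'₃) with hP3
  set Q3 : ℝ := max (max (2 * γ₂) γ₃) (γ₂ + 3 - 2 * α) with hQ3
  set Q4 : ℝ := max (max ((max γ₂ (3 - 2 * α)) + Q3) (γ₂ + max γ₃ (4 - 2 * α))) γ₄ with hQ4
  have x1 : 3 * (γ'₂ + 1) ≤ β := (le_max_left _ _).trans (le_max_left _ _)
  have x2 : γ'₂ + γ'₃ + 2 ≤ β := (le_max_right _ _).trans (le_max_left _ _)
  have x3 : γ'₄ + 1 ≤ β := le_max_right _ _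
  have x4 : 2 * (γ'₂ + 1) ≤ P3 := le_max_left _ _
  have x5 : 1 + γ'₃ ≤ P3 := le_max_right _ _
  have x6 : P3 + (γ'₂ + 1) ≤ β := by
    rw [← le_sub_iff_add_le]
    exact max_le (by linarith) (by linarith)
  have y1 : 2 * γ₂ ≤ Q3 := (le_max_left _ _).trans (le_max_left _ _)
  have y2 : γ₃ ≤ Q3 := (le_max_right _ _).trans (le_max_left _ _)
  have y3 : γ₂ + 3 - 2 * α ≤ Q3 := le_max_right _ _
  have y4 : max γ₂ (3 - 2 * α) + Q3 ≤ Q4 := (le_max_left _ _).trans (le_max_left _ _)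
  have y5 : γ₂ + max γ₃ (4 - 2 * α) ≤ Q4 := (le_max_right _ _).trans (le_max_left _ _)
  have y6 : γ₄ ≤ Q4 := le_max_right _ _
  have y7 := le_max_left γ₂ (3 - 2 * α)
  have y8 := le_max_right γ₂ (3 - 2 * α)
  have y9 := le_max_left γ₃ (4 - 2 * α)
  have y10 := le_max_right γ₃ (4 - 2 * α)
  have hs2 : 0 < σ ^ 2 / 2 := by positivity
  have z1 := mul_le_mul_of_nonneg_left
    (sub_le_sub_right (le_max_left (2 * β) (β + 2 * α)) 1) hs2.le
  have z2 := mul_le_mul_of_nonneg_left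
    (sub_le_sub_right (le_max_right (2 * β) (β + 2 * α)) 1) hs2.le
  have kw : ∀ {a c : ℝ}, 0 ≤ c → a ≤ 1 + K0 + K2 + K3 + K4 →
      a * c ≤ (1 + K0 + K2 + K3 + K4) * c := fun hc h => mul_le_mul_of_nonneg_right h hc
  have e22 : 2 * (α - 1) = 2 * α - 2 := by ring
  let D : KPde.Par :=
    { α := α, σ := σ, B1 := B₁, B2 := B₂, B1' := B₁', B2' := B₂', K := 1 + K0 + K2 + K3 + K4
      b00 := b 0, β := β, g2 := γ'₂ + 1, g3 := γ'₃ + 1, g4 := γ'₄ + 1, c2 := γ₂, c3 := γ₃, c4 := γ₄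
      b := KPde.sq b b1 b2 b3 b4
      hα := hα, hσ := hσ, hB1 := hB₁, hB2 := hB₂, hB1' := hB₁', hB2' := hB₂'
      hK := by linarith
      hb00 := hb0
      hβ := by linarith
      hg2 := by linarith
      hg3 := by linarith
      hg4 := by linarith
      hc2 := hγ₂, hc3 := hγ₃, hc4 := hγ₄
      hchain := by
        intro k hk x hx
        interval_cases k
        · exact hb1 x hx
        · exact hb2 x hx
        · exact hb3 x hx
        · exact hb4 x hx
      hcont := hb4cont
      hlow := fun x hx => by
        refine le_trans (neg_le_neg ?_) (hK0' x hx).1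
        have := Real.rpow_pos_of_pos hx (2 * α - 1)
        exact kw (by positivity) (by linarith)
      habs := fun x hx => by
        have := Real.rpow_pos_of_pos hx (2 * α - 1)
        exact (hK0' x hx).2.1.trans (kw (by positivity) (by linarith))
      hb1abs := fun x hx => by
        have := Real.rpow_pos_of_pos hx (2 * α - 2)
        exact (hK0' x hx).2.2.trans (kw (by positivity) (by linarith))
      hb2abs := fun x hx => (hK2' x hx).trans (kw (KPde.Wt_pos hx).le (by linarith))
      hb3abs := fun x hx => (hK3' x hx).trans (kw (KPde.Wt_pos hx).le (by linarith))
      hb4abs := fun x hx => (hK4' x hx).trans (kw (KPde.Wt_pos hx).le (by linarith))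
      hup := hbgrowth
      hb1up := fun x hx => by rw [← e22]; exact hb'growth x hx
      hB2a := by linarith
      hB2b := by linarith
      hB2c := hB₂'cond }
  obtain ⟨W, hPX, hQX⟩ := KPde.exists_wts D (P3 := P3) (Q3 := Q3) (Q4 := Q4)
    (show (1 : ℝ) ≤ γ'₂ + 1 by linarith) x4 (show γ'₃ + 1 ≤ P3 by linarith) x6
    (show γ'₂ + 1 + (γ'₃ + 1) ≤ β by linarith) x3 y1 y2 y3
    (show γ₂ + Q3 ≤ Q4 by linarith) (show 3 - 2 * α + Q3 ≤ Q4 by linarith)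
    (show γ₂ + γ₃ ≤ Q4 by linarith) (show γ₂ + (4 - 2 * α) ≤ Q4 by linarith) y6
  obtain ⟨u, ut, C, hC, ht, hch, hutc, hu4, hpde, hT', hbd, hbt⟩ := KPde.core D W
    (F := KPde.sq f f1 f2 f3 f4) (M := M) (by
      intro k hk x hx
      interval_cases k
      · exact hf1 x hx
      · exact hf2 x hx
      · exact hf3 x hx
      · exact hf4 x hx) hf4cont (by
      intro k hk x hx
      obtain ⟨m0, m1, m2, m3, m4⟩ := hM x hx
      interval_cases k
      · exact m0
      · exact m1
      · exact m2
      · exact m3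
      · exact m4) hT
  rw [hPX, hQX] at hbd
  refine ⟨fun t x => u t 0 x, ut, fun t x => u t 1 x, fun t x => u t 2 x, fun t x => u t 3 x,
    fun t x => u t 4 x, 3 * C, by positivity, fun t htm x hx => ⟨ht t htm x hx,
      hch t 0 (by omega) x hx, hch t 1 (by omega) x hx, hch t 2 (by omega) x hx,
      hch t 3 (by omega) x hx⟩, hutc, fun t _ => hu4 t, fun t _ x _ => ?_, hT',
    fun t htm x hx => ?_⟩
  · have h1 := hpde t x
    rw [D.a_zero] at h1
    exact h1
  · have w : ∀ p q : ℝ, C * KPde.Wt p q x ≤ 3 * C * KPde.Wt p q x := fun p q =>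
      mul_le_mul_of_nonneg_right (by linarith) (KPde.Wt_pos hx).le
    have b0 := hbd t htm x hx 0 (by omega)
    have b1 := hbd t htm x hx 1 (by omega)
    have b2 := hbd t htm x hx 2 (by omega)
    have b3 := hbd t htm x hx 3 (by omega)
    have b4 := hbd t htm x hx 4 (by omega)
    have bt := hbt t htm x hx
    have hp := Real.rpow_pos_of_pos hx (2 * α)
    refine ⟨b0.trans (le_of_eq ?_), b1.trans (le_of_eq ?_), bt.trans ?_, b2.trans (w _ _),
      b3.trans (w _ _), b4.trans (w _ _)⟩
    · simp only [KPde.sq, KPde.Wt, neg_zero, Real.rpow_zero]; ring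
    · simp only [KPde.sq, KPde.Wt, neg_zero, Real.rpow_zero]; ring
    · have e : KPde.Wt (2 * D.α) 0 x = 2 + x ^ (2 * α) := by
        simp only [KPde.Wt, neg_zero, Real.rpow_zero]
        change 1 + x ^ (2 * α) + 1 = _
        ring
      rw [e]
      nlinarith
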